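/- arXiv:2310.13750 — 2 statements merged into one kernel-verified Lean document; each statement's English description precedes it below -/
import Mathlib

section
/- Let 0 ≤ γ < ∞ and 1 < r ≤ q < ∞. Assume γ > 2/q − 1/2, γ = max{3/(2q) − 1/(2r′), 2/q − 1/r′} and q ≠ r′. Then there is a constant C > 0 such that for every measurable F : ℝ → ℂ one has ‖R*_γF‖_{L^q(ℝ²)} ≤ C · ‖F‖_{L^r(S¹)}. -/
open MeasureTheory Real Set Filter
open scoped ENNReal

noncomputable section

/-- Fourier extension operator of the unit circle,
`(R*F)(x,y) = (1/(2π)) ∫_0^{2π} F(φ) exp(i(x cos φ + y sin φ)) dφ`. -/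
def Rext (F : ℝ → ℂ) (x y : ℝ) : ℂ :=
  Complex.ofReal (1 / (2 * π)) *
    ∫ φ in (0:ℝ)..(2 * π),
      F φ * Complex.exp (Complex.I * Complex.ofReal (x * Real.cos φ + y * Real.sin φ))

/-- Weighted extension operator with product weight `(1+|x|)^{-α}(1+|y|)^{-β}`. -/
def Rab (α β : ℝ) (F : ℝ → ℂ) (x y : ℝ) : ℂ :=
  Rext F x y * Complex.ofReal ((1 + |x|) ^ (-α) * (1 + |y|) ^ (-β))

/-- Weighted extension operator with weight `(1+|x|+|y|)^{-γ}`. -/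
def Rgamma (γ : ℝ) (F : ℝ → ℂ) (x y : ℝ) : ℂ :=
  Rext F x y * Complex.ofReal ((1 + |x| + |y|) ^ (-γ))

/-- `L^r` norm on the circle, parametrized by `[0, 2π]`. -/
def circleLp (r : ℝ≥0∞) (F : ℝ → ℂ) : ℝ≥0∞ :=
  eLpNorm F r (volume.restrict (Ioc (0:ℝ) (2 * π)))

/-- `L^q` quasinorm on the plane. -/
def planeLp (q : ℝ≥0∞) (g : ℝ × ℝ → ℂ) : ℝ≥0∞ :=
  eLpNorm g q (volume : Measure (ℝ × ℝ))

/-- Weak `L^q` quasinorm on the line. -/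
def wline (q : ℝ) (g : ℝ → ℂ) : ℝ≥0∞ :=
  ⨆ (t : ℝ) (_ : 0 < t), ENNReal.ofReal t * (volume {x : ℝ | t < ‖g x‖}) ^ (1 / q)

/-- Weak `L^q` quasinorm on the line, for `ℝ≥0∞`-valued functions. -/
def wlineE (q : ℝ) (g : ℝ → ℝ≥0∞) : ℝ≥0∞ :=
  ⨆ (t : ℝ) (_ : 0 < t), ENNReal.ofReal t * (volume {x : ℝ | ENNReal.ofReal t < g x}) ^ (1 / q)

/-- Mixed weak quasinorm `L^{q,∞}_x(L^{q,∞}_y)`. -/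
def mixedXY (q : ℝ) (g : ℝ × ℝ → ℂ) : ℝ≥0∞ :=
  wlineE q fun x => wline q fun y => g (x, y)

/-- Mixed weak quasinorm `L^{q,∞}_y(L^{q,∞}_x)`. -/
def mixedYX (q : ℝ) (g : ℝ × ℝ → ℂ) : ℝ≥0∞ :=
  wlineE q fun y => wline q fun x => g (x, y)

/-- Weak `L^q` quasinorm on the plane. -/
def wplane (q : ℝ) (g : ℝ × ℝ → ℂ) : ℝ≥0∞ :=
  ⨆ (t : ℝ) (_ : 0 < t), ENNReal.ofReal t * (volume {p : ℝ × ℝ | t < ‖g p‖}) ^ (1 / q)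

/-- Lorentz `L^{r,1}` norm on the circle. -/
def lorentz1 (r : ℝ) (F : ℝ → ℂ) : ℝ≥0∞ :=
  ∫⁻ t in Ioi (0:ℝ), (volume {φ ∈ Icc (0:ℝ) (2 * π) | t < ‖F φ‖}) ^ (1 / r)

/-- Weak `L^r` quasinorm on the circle. -/
def wcircle (r : ℝ) (F : ℝ → ℂ) : ℝ≥0∞ :=
  ⨆ (t : ℝ) (_ : 0 < t), ENNReal.ofReal t * (volume {φ ∈ Icc (0:ℝ) (2 * π) | t < ‖F φ‖}) ^ (1 / r)


/-- Minkowski for countable sums -/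
theorem mink_tsum {α ι : Type*} [MeasurableSpace α] [Countable ι] (μ : Measure α) (p : ℝ) (hp : 1 ≤ p)
    (f : ι → α → ℝ≥0∞) (hf : ∀ i, Measurable (f i)) :
    (∫⁻ a, (∑' i, f i a) ^ p ∂μ) ^ (1 / p) ≤ ∑' i, (∫⁻ a, (f i a) ^ p ∂μ) ^ (1 / p) := by
  have hp0 : 0 < p := by linarith
  have fin : ∀ s : Finset ι, (∫⁻ a, (∑ i ∈ s, f i a) ^ p ∂μ) ^ (1 / p)
      ≤ ∑ i ∈ s, (∫⁻ a, (f i a) ^ p ∂μ) ^ (1 / p) := by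
    intro s
    classical
    induction s using Finset.induction_on with
    | empty => simp [hp0]
    | insert i s his ih =>
      simp only [Finset.sum_insert his]
      refine (ENNReal.lintegral_Lp_add_le (hf i).aemeasurable
        (Finset.measurable_sum s (fun i _ => hf i)).aemeasurable hp).trans ?_
      gcongr
  have h1 : ∀ a, (∑' i, f i a) ^ p = ⨆ s : Finset ι, (∑ i ∈ s, f i a) ^ p := by
    intro a
    rw [ENNReal.tsum_eq_iSup_sum]
    exact (ENNReal.orderIsoRpow p hp0).map_iSup _
  have h2 : ∫⁻ a, (∑' i, f i a) ^ p ∂μ = ⨆ s : Finset ι, ∫⁻ a, (∑ i ∈ s, f i a) ^ p ∂μ := by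
    simp_rw [h1]
    refine lintegral_iSup_directed (fun s => ?_) ?_
    · exact ((Finset.measurable_sum s (fun i _ => hf i)).pow_const p).aemeasurable
    · refine directed_of_isDirected_le ?_
      intro s t hst a
      dsimp only
      gcongr
  rw [h2]
  have h3 : (⨆ s : Finset ι, ∫⁻ a, (∑ i ∈ s, f i a) ^ p ∂μ) ^ (1 / p)
      = ⨆ s : Finset ι, (∫⁻ a, (∑ i ∈ s, f i a) ^ p ∂μ) ^ (1 / p) :=
    (ENNReal.orderIsoRpow (1/p) (by positivity)).map_iSup _
  rw [h3]
  exact iSup_le fun s => (fin s).trans (ENNReal.sum_le_tsum s)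

theorem tele_step (x y ρ : ℝ) (hx : 0 < x) (hy : 0 < y) (_hρ : 0 < ρ) (hρ1 : ρ < 1) (h : y ≤ ρ * x) :
    (1 - ρ) / 4 * min x x⁻¹ ≤ x / (1 + x) - y / (1 + y) := by
  have e : x / (1 + x) - y / (1 + y) = (x - y) / ((1 + x) * (1 + y)) := by field_simp; ring
  have hm : 0 ≤ min x x⁻¹ := by positivity
  have h1 : (1 + x) ^ 2 * min x x⁻¹ ≤ 4 * x := by
    rcases le_total x 1 with hx1 | hx1
    · have : (1 + x) ^ 2 ≤ 4 := by nlinarith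
      have := min_le_left x x⁻¹
      nlinarith
    · have h2 := min_le_right x x⁻¹
      have : (1 + x) ^ 2 * x⁻¹ ≤ 4 * x := by
        rw [← div_eq_mul_inv, div_le_iff₀ hx]; nlinarith
      nlinarith [sq_nonneg (1 + x)]
  have hyx : y ≤ x := by nlinarith
  rw [e, le_div_iff₀ (by positivity)]
  have h3 : (1 + x) * (1 + y) ≤ (1 + x) ^ 2 := by nlinarith
  have h4 : (1 - ρ) * x ≤ x - y := by nlinarith
  have h5 : (1 - ρ) / 4 * min x x⁻¹ * ((1 + x) * (1 + y)) ≤ (1 - ρ) / 4 * min x x⁻¹ * (1 + x) ^ 2 := by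
    apply mul_le_mul_of_nonneg_left h3; apply mul_nonneg _ hm; linarith
  have h6 : (1 - ρ) / 4 * min x x⁻¹ * (1 + x) ^ 2 ≤ (1 - ρ) / 4 * (4 * x) := by
    rw [mul_assoc, mul_comm (min x x⁻¹)]
    apply mul_le_mul_of_nonneg_left h1; linarith
  linarith

theorem tele_sum (Y : ℤ → ℝ) (ρ : ℝ) (hρ : 0 < ρ) (hρ1 : ρ < 1) (hY : ∀ j, 0 < Y j)
    (h : ∀ j, Y (j + 1) ≤ ρ * Y j) :
    ∑' j, ENNReal.ofReal (min (Y j) (Y j)⁻¹) ≤ ENNReal.ofReal (4 / (1 - ρ)) := by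
  have key : ∀ (a : ℤ) (n : ℕ), ∑ i ∈ Finset.range n, (1 - ρ) / 4 * min (Y (a + i)) (Y (a + i))⁻¹
      ≤ Y a / (1 + Y a) - Y (a + n) / (1 + Y (a + n)) := by
    intro a n
    induction n with
    | zero => simp
    | succ n ih =>
      rw [Finset.sum_range_succ]
      have := tele_step (Y (a + n)) (Y (a + n + 1)) ρ (hY _) (hY _) hρ hρ1 (h _)
      push_cast
      rw [← add_assoc]
      linarith
  rw [ENNReal.tsum_eq_iSup_sum]
  refine iSup_le fun s => ?_
  obtain ⟨N, hN⟩ : ∃ N : ℕ, ∀ j ∈ s, -(N : ℤ) ≤ j ∧ j < N := by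
    refine ⟨s.sup Int.natAbs + 1, fun j hj => ?_⟩
    have := Finset.le_sup (f := Int.natAbs) hj
    omega
  have hs : s ⊆ (Finset.range (2 * N)).image (fun i : ℕ => -(N : ℤ) + i) := by
    intro j hj
    have := hN j hj
    simp only [Finset.mem_image, Finset.mem_range]
    exact ⟨(j + N).toNat, by omega, by omega⟩
  refine (Finset.sum_le_sum_of_subset hs).trans ?_
  rw [Finset.sum_image (by intro a _ b _ hab; simpa using hab),
    ← ENNReal.ofReal_sum_of_nonneg (by intro i _; have := hY (-(N : ℤ) + i); positivity)]
  apply ENNReal.ofReal_le_ofReal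
  have k := key (-(N : ℤ)) (2 * N)
  rw [← Finset.mul_sum] at k
  have h1 : Y (-(N : ℤ)) / (1 + Y (-(N : ℤ))) ≤ 1 := by
    have := hY (-(N : ℤ)); rw [div_le_one (by linarith)]; linarith
  have h2 : 0 ≤ Y (-(N : ℤ) + (2 * N : ℕ)) / (1 + Y (-(N : ℤ) + (2 * N : ℕ))) := by
    have := hY (-(N : ℤ) + (2 * N : ℕ)); positivity
  rw [le_div_iff₀ (by linarith)]
  nlinarith

/-- sum of `min(X^α, X^{-β})` over the geometric progression `X = 2^{jb} c`. -/
theorem geo_sum (b α β : ℝ) (hb : 0 < b) (hα : 0 < α) (hβ : 0 < β) :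
    ∃ C : ℝ, 0 < C ∧ ∀ c : ℝ, 0 < c →
      ∑' j : ℤ, ENNReal.ofReal (min (((2:ℝ) ^ ((j:ℝ) * b) * c) ^ α) (((2:ℝ) ^ ((j:ℝ) * b) * c) ^ (-β)))
        ≤ ENNReal.ofReal C := by
  set ε := min α β with hε
  have hε0 : 0 < ε := lt_min hα hβ
  have hr1 : (2:ℝ) ^ (-(b * ε)) < 1 := by
    apply Real.rpow_lt_one_of_one_lt_of_neg (by norm_num); nlinarith
  refine ⟨4 / (1 - (2:ℝ) ^ (-(b * ε))), by apply div_pos; norm_num; linarith, fun c hc => ?_⟩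
  set Z : ℤ → ℝ := fun j => (2:ℝ) ^ ((j:ℝ) * b) * c with hZ
  have hZ0 : ∀ j, 0 < Z j := fun j => by positivity
  refine le_trans ?_ (tele_sum (fun j => (Z j) ^ (-ε)) _ (by positivity) hr1
    (fun j => Real.rpow_pos_of_pos (hZ0 j) _) ?_)
  · refine ENNReal.tsum_le_tsum fun j => ENNReal.ofReal_le_ofReal ?_
    rw [← Real.rpow_neg (hZ0 j).le, neg_neg]
    change min (Z j ^ α) (Z j ^ (-β)) ≤ _
    rcases le_total (Z j) 1 with h | h
    · refine (min_le_left _ _).trans (le_min ?_ ?_)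
      · exact (Real.rpow_le_rpow_of_exponent_ge (hZ0 j) h (by linarith [hε0]))
      · exact Real.rpow_le_rpow_of_exponent_ge (hZ0 j) h (min_le_left _ _)
    · refine (min_le_right _ _).trans (le_min ?_ ?_)
      · exact Real.rpow_le_rpow_of_exponent_le h (by linarith [min_le_right α β])
      · exact Real.rpow_le_rpow_of_exponent_le h (by linarith)
  · intro j
    have : Z (j + 1) = (2:ℝ) ^ b * Z j := by
      simp only [hZ]; push_cast
      rw [add_mul, one_mul, Real.rpow_add (by norm_num)]; ring
    rw [this, Real.mul_rpow (by positivity) (hZ0 j).le, ← Real.rpow_mul (by norm_num)]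
    ring_nf; rfl


theorem gauss1 (ε : ℝ) (hε : 0 < ε) (t : ℝ) :
    ∫ x : ℝ, Complex.exp (Complex.I * Complex.ofReal (x * t)) * Complex.ofReal (Real.exp (-ε * x ^ 2))
      = Complex.ofReal (Real.sqrt (π / ε) * Real.exp (- t ^ 2 / (4 * ε))) := by
  have h := fourierIntegral_gaussian (b := (ε : ℂ)) (by simpa using hε) (t : ℂ)
  have e : ∀ x : ℝ, Complex.exp (Complex.I * Complex.ofReal (x * t)) * Complex.ofReal (Real.exp (-ε * x ^ 2))
      = Complex.exp (Complex.I * t * x) * Complex.exp (-(ε : ℂ) * x ^ 2) := by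
    intro x; push_cast; ring_nf
  simp_rw [e]
  rw [h]
  push_cast
  rw [Real.sqrt_eq_rpow, Complex.ofReal_cpow (by positivity)]
  push_cast
  ring_nf

def gw (ε : ℝ) (p : ℝ × ℝ) : ℝ := Real.exp (-ε * p.1 ^ 2) * Real.exp (-ε * p.2 ^ 2)

theorem gw_int (ε : ℝ) (hε : 0 < ε) : Integrable (gw ε) :=
  (integrable_exp_neg_mul_sq hε).mul_prod (integrable_exp_neg_mul_sq hε)

theorem gw_nonneg (ε : ℝ) (p : ℝ × ℝ) : 0 ≤ gw ε p := by unfold gw; positivity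

def gk (ε s t : ℝ) : ℝ := π / ε * Real.exp (-(s ^ 2 + t ^ 2) / (4 * ε))

theorem gauss2 (ε : ℝ) (hε : 0 < ε) (s t : ℝ) :
    ∫ p : ℝ × ℝ, Complex.exp (Complex.I * Complex.ofReal (p.1 * s + p.2 * t)) * Complex.ofReal (gw ε p)
      = Complex.ofReal (gk ε s t) := by
  have e : ∀ p : ℝ × ℝ, Complex.exp (Complex.I * Complex.ofReal (p.1 * s + p.2 * t)) * Complex.ofReal (gw ε p)
    = (Complex.exp (Complex.I * Complex.ofReal (p.1 * s)) * Complex.ofReal (Real.exp (-ε * p.1 ^ 2))) *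
      (Complex.exp (Complex.I * Complex.ofReal (p.2 * t)) * Complex.ofReal (Real.exp (-ε * p.2 ^ 2))) := by
    intro p; unfold gw; push_cast; rw [mul_add, Complex.exp_add]; ring
  simp_rw [e]
  rw [Measure.volume_eq_prod, integral_prod_mul (fun x : ℝ => Complex.exp (Complex.I * Complex.ofReal (x * s)) * Complex.ofReal (Real.exp (-ε * x ^ 2))) (fun x : ℝ => Complex.exp (Complex.I * Complex.ofReal (x * t)) * Complex.ofReal (Real.exp (-ε * x ^ 2))),
    gauss1 ε hε, gauss1 ε hε, ← Complex.ofReal_mul]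
  congr 1
  unfold gk
  have : Real.sqrt (π / ε) * Real.sqrt (π / ε) = π / ε := Real.mul_self_sqrt (by positivity)
  have e2 : Real.exp (-(s ^ 2 + t ^ 2) / (4 * ε)) = Real.exp (- s ^ 2 / (4 * ε)) * Real.exp (- t ^ 2 / (4 * ε)) := by
    rw [← Real.exp_add]; ring_nf
  rw [e2]
  linear_combination (Real.exp (- s ^ 2 / (4 * ε)) * Real.exp (- t ^ 2 / (4 * ε))) * this

theorem gauss_schur {X : Type*} [MeasurableSpace X] (μ : Measure X) [IsFiniteMeasure μ]
    (u v : X → ℝ) (hu : Measurable u) (hv : Measurable v) (f : X → ℂ) (hf : Measurable f)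
    (hf1 : ∀ x, ‖f x‖ ≤ 1) (ε : ℝ) (hε : 0 < ε) (S : ℝ≥0∞)
    (hS : ∀ᵐ x ∂μ, ∫⁻ x', ENNReal.ofReal (gk ε (u x - u x') (v x - v x')) ∂μ ≤ S) :
    ∫⁻ p : ℝ × ℝ, ‖∫ x, f x * Complex.exp (Complex.I * Complex.ofReal (p.1 * u x + p.2 * v x)) ∂μ‖ₑ ^ 2
      * ENNReal.ofReal (gw ε p) ≤ S * ∫⁻ x, ‖f x‖ₑ ∂μ := by
  have hfi : Integrable f μ := Integrable.of_bound hf.aestronglyMeasurable 1 (ae_of_all _ hf1)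
  set E : ℝ × ℝ → X → ℂ := fun p x => Complex.exp (Complex.I * Complex.ofReal (p.1 * u x + p.2 * v x)) with hE
  have hEn : ∀ p x, ‖E p x‖ = 1 := by
    intro p x; simp only [hE]; rw [mul_comm]; exact Complex.norm_exp_ofReal_mul_I _
  have hEm : Measurable (fun z : (ℝ × ℝ) × X => E z.1 z.2) := by
    simp only [hE]; fun_prop
  set g : ℝ × ℝ → ℂ := fun p => ∫ x, f x * E p x ∂μ with hg
  have hgm : StronglyMeasurable g := by
    simp only [hg]
    refine StronglyMeasurable.integral_prod_right (f := fun p x => f x * E p x) ?_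
    exact ((hf.comp measurable_snd).mul hEm).stronglyMeasurable
  -- big integrand
  set H : (ℝ × ℝ) → (X × X) → ℂ := fun p z =>
    (f z.1 * E p z.1) * (starRingEnd ℂ) (f z.2 * E p z.2) * Complex.ofReal (gw ε p) with hH
  have hHm : Measurable (Function.uncurry H) := by
    have h1 : Measurable (fun w : (ℝ × ℝ) × (X × X) => E w.1 w.2.1) := hEm.comp (measurable_fst.prodMk (measurable_fst.comp measurable_snd))
    have h2 : Measurable (fun w : (ℝ × ℝ) × (X × X) => E w.1 w.2.2) := hEm.comp (measurable_fst.prodMk (measurable_snd.comp measurable_snd))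
    have h3 : Measurable (gw ε) := by unfold gw; fun_prop
    have h5 := (hf.comp (measurable_fst.comp (measurable_snd : Measurable (Prod.snd : (ℝ × ℝ) × (X × X) → X × X)))).mul h1
    have h6 := (Complex.continuous_conj.measurable.comp ((hf.comp (measurable_snd.comp (measurable_snd : Measurable (Prod.snd : (ℝ × ℝ) × (X × X) → X × X)))).mul h2))
    have h7 := Complex.measurable_ofReal.comp (h3.comp (measurable_fst : Measurable (Prod.fst : (ℝ × ℝ) × (X × X) → ℝ × ℝ)))
    exact (h5.mul h6).mul h7
  have hHi : Integrable (Function.uncurry H) ((volume : Measure (ℝ × ℝ)).prod (μ.prod μ)) := by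
    have : Integrable (fun w : (ℝ × ℝ) × (X × X) => gw ε w.1 * (‖f w.2.1‖ * ‖f w.2.2‖))
        ((volume : Measure (ℝ × ℝ)).prod (μ.prod μ)) :=
      (gw_int ε hε).mul_prod (hfi.norm.mul_prod hfi.norm)
    refine this.mono' hHm.aestronglyMeasurable (ae_of_all _ fun w => ?_)
    simp only [Function.uncurry, hH, norm_mul, RCLike.norm_conj, hEn, mul_one, Complex.norm_real, Real.norm_eq_abs, abs_of_nonneg (gw_nonneg ε _)]
    linarith
  have i1 : ∀ p, ∫ z, H p z ∂(μ.prod μ) = Complex.ofReal (‖g p‖ ^ 2 * gw ε p) := by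
    intro p
    simp only [hH]
    rw [integral_mul_const, integral_prod_mul (fun x => f x * E p x) (fun x => (starRingEnd ℂ) (f x * E p x)),
      integral_conj]
    change g p * (starRingEnd ℂ) (g p) * _ = _
    rw [Complex.mul_conj']
    push_cast; rfl
  have i2 : ∀ z, ∫ p, H p z = f z.1 * (starRingEnd ℂ) (f z.2) * Complex.ofReal (gk ε (u z.1 - u z.2) (v z.1 - v z.2)) := by
    intro z
    rw [← gauss2 ε hε, ← integral_const_mul]
    congr 1
    ext p
    simp only [hH, hE, map_mul, ← Complex.exp_conj, Complex.conj_I, Complex.conj_ofReal]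
    have : Complex.exp (Complex.I * Complex.ofReal (p.1 * (u z.1 - u z.2) + p.2 * (v z.1 - v z.2)))
      = Complex.exp (Complex.I * Complex.ofReal (p.1 * u z.1 + p.2 * v z.1)) *
        Complex.exp (-Complex.I * Complex.ofReal (p.1 * u z.2 + p.2 * v z.2)) := by
      rw [← Complex.exp_add]; congr 1; push_cast; ring
    rw [this]; ring
  have sw := integral_integral_swap hHi
  simp_rw [i1, i2] at sw
  have hint : Integrable (fun p => ‖g p‖ ^ 2 * gw ε p) := by
    have := hHi.integral_prod_left
    simp only [Function.uncurry, i1] at this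
    have h2 := this.re
    exact h2
  have l1 : ∫⁻ p, ‖g p‖ₑ ^ 2 * ENNReal.ofReal (gw ε p) = ENNReal.ofReal (∫ p, ‖g p‖ ^ 2 * gw ε p) := by
    rw [ofReal_integral_eq_lintegral_ofReal hint (ae_of_all _ fun p => mul_nonneg (by positivity) (gw_nonneg ε p))]
    refine lintegral_congr fun p => ?_
    rw [ENNReal.ofReal_mul (by positivity), ENNReal.ofReal_pow (norm_nonneg _), ofReal_norm]
  rw [l1]
  rw [integral_complex_ofReal] at sw
  have l2 : ENNReal.ofReal (∫ p, ‖g p‖ ^ 2 * gw ε p) ≤ ‖Complex.ofReal (∫ p, ‖g p‖ ^ 2 * gw ε p)‖ₑ := by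
    rw [← ofReal_norm, Complex.norm_real]
    exact ENNReal.ofReal_le_ofReal (le_abs_self _)
  refine l2.trans ?_
  rw [sw]
  refine (enorm_integral_le_lintegral_enorm _).trans ?_
  have hgkm : Measurable (fun z : X × X => gk ε (u z.1 - u z.2) (v z.1 - v z.2)) := by
    unfold gk; fun_prop
  have l3 : ∀ z : X × X, ‖f z.1 * (starRingEnd ℂ) (f z.2) * Complex.ofReal (gk ε (u z.1 - u z.2) (v z.1 - v z.2))‖ₑ
      ≤ ‖f z.1‖ₑ * ENNReal.ofReal (gk ε (u z.1 - u z.2) (v z.1 - v z.2)) := by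
    intro z
    have hk : 0 ≤ gk ε (u z.1 - u z.2) (v z.1 - v z.2) := by unfold gk; positivity
    rw [← ofReal_norm, ← ofReal_norm, ← ENNReal.ofReal_mul (norm_nonneg _)]
    apply ENNReal.ofReal_le_ofReal
    rw [norm_mul, norm_mul, Complex.norm_real, Real.norm_eq_abs, abs_of_nonneg hk, RCLike.norm_conj]
    gcongr
    exact mul_le_of_le_one_right (norm_nonneg _) (hf1 _)
  refine (lintegral_mono l3).trans ?_
  rw [lintegral_prod _ (by
    apply Measurable.aemeasurable
    exact (hf.comp measurable_fst).enorm.mul hgkm.ennreal_ofReal)]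
  have l4 : ∀ᵐ x ∂μ, ∫⁻ y, ‖f x‖ₑ * ENNReal.ofReal (gk ε (u x - u y) (v x - v y)) ∂μ ≤ S * ‖f x‖ₑ := by
    filter_upwards [hS] with x hSx
    have hm : Measurable (fun y => ENNReal.ofReal (gk ε (u x - u y) (v x - v y))) := by
      unfold gk; fun_prop
    rw [lintegral_const_mul _ hm, mul_comm]
    gcongr
  refine (lintegral_mono_ae l4).trans ?_
  rw [lintegral_const_mul _ hf.enorm]


def Phi (z : ℝ × ℝ) : ℝ × ℝ := (Real.cos z.1 + Real.cos z.2, Real.sin z.1 + Real.sin z.2)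

def dPhi (z : ℝ × ℝ) : ℝ × ℝ →L[ℝ] ℝ × ℝ :=
  (Matrix.toLin (.finTwoProd ℝ) (.finTwoProd ℝ)
    !![-Real.sin z.1, -Real.sin z.2; Real.cos z.1, Real.cos z.2]).toContinuousLinearMap

theorem hasFDerivAt_Phi (z : ℝ × ℝ) : HasFDerivAt Phi (dPhi z) z := by
  unfold dPhi
  rw [Matrix.toLin_finTwoProd_toContinuousLinearMap]
  exact
    HasFDerivAt.prodMk (𝕜 := ℝ)
      (((hasDerivAt_cos z.1).comp_hasFDerivAt z hasFDerivAt_fst).add ((hasDerivAt_cos z.2).comp_hasFDerivAt z hasFDerivAt_snd))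
      (((hasDerivAt_sin z.1).comp_hasFDerivAt z hasFDerivAt_fst).add ((hasDerivAt_sin z.2).comp_hasFDerivAt z hasFDerivAt_snd))

theorem det_dPhi (z : ℝ × ℝ) : (dPhi z).det = Real.sin (z.2 - z.1) := by
  unfold dPhi
  simp only [LinearMap.det_toContinuousLinearMap, LinearMap.det_toLin,
    Matrix.det_fin_two_of, Real.sin_sub]
  ring

theorem ang_inj {a b : ℝ} (ha : a ∈ Ioc (0:ℝ) (2 * π)) (hb : b ∈ Ioc (0:ℝ) (2 * π))
    (hc : Real.cos a = Real.cos b) (hs : Real.sin a = Real.sin b) : a = b := by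
  have h : Real.cos (a - b) = 1 := by
    rw [Real.cos_sub, hc, hs]; nlinarith [Real.sin_sq_add_cos_sq b]
  have := (Real.cos_eq_one_iff_of_lt_of_lt (by linarith [ha.1, hb.2]) (by linarith [ha.2, hb.1])).1 h
  linarith

theorem pair_inj {a b c d : ℝ} (ha : a ∈ Ioc (0:ℝ) (2 * π)) (hb : b ∈ Ioc (0:ℝ) (2 * π))
    (hc : c ∈ Ioc (0:ℝ) (2 * π)) (hd : d ∈ Ioc (0:ℝ) (2 * π))
    (hab : Real.sin (a - b) ≠ 0)
    (h1 : Real.cos a + Real.cos b = Real.cos c + Real.cos d)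
    (h2 : Real.sin a + Real.sin b = Real.sin c + Real.sin d) : (a = c ∧ b = d) ∨ (a = d ∧ b = c) := by
  set za := Complex.exp (a * Complex.I) with hza
  set zb := Complex.exp (b * Complex.I) with hzb
  set zc := Complex.exp (c * Complex.I) with hzc
  set zd := Complex.exp (d * Complex.I) with hzd
  have ex : ∀ t : ℝ, Complex.exp (t * Complex.I) = ⟨Real.cos t, Real.sin t⟩ := by
    intro t; apply Complex.ext
    · simp [Complex.exp_ofReal_mul_I_re]
    · simp [Complex.exp_ofReal_mul_I_im]
  have cj : ∀ t : ℝ, Complex.exp (t * Complex.I) * Complex.exp (-(t * Complex.I)) = 1 := by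
    intro t; rw [← Complex.exp_add]; simp
  have ex' : ∀ t : ℝ, Complex.exp (-(t * Complex.I)) = ⟨Real.cos t, -Real.sin t⟩ := by
    intro t
    have := ex (-t)
    rw [← Real.cos_neg, ← Real.sin_neg, ← this]; push_cast; congr 1; ring
  have e1 : za + zb = zc + zd := by
    rw [hza, hzb, hzc, hzd, ex, ex, ex, ex]
    apply Complex.ext <;> simpa
  have e2 : Complex.exp (-(a * Complex.I)) + Complex.exp (-(b * Complex.I)) = Complex.exp (-(c * Complex.I)) + Complex.exp (-(d * Complex.I)) := by
    rw [ex', ex', ex', ex']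
    apply Complex.ext
    · simpa
    · simp; linarith
  have p1 : za + zb = za * zb * (Complex.exp (-(a * Complex.I)) + Complex.exp (-(b * Complex.I))) := by
    linear_combination (-zb) * cj a - za * cj b
  have p2 : zc + zd = zc * zd * (Complex.exp (-(c * Complex.I)) + Complex.exp (-(d * Complex.I))) := by
    linear_combination (-zd) * cj c - zc * cj d
  have hne : Complex.exp (-(c * Complex.I)) + Complex.exp (-(d * Complex.I)) ≠ 0 := by
    rw [← e2, ex', ex']
    intro h
    have hr : Real.cos a + Real.cos b = 0 := by simpa using congrArg Complex.re h
    have hi : Real.sin a + Real.sin b = 0 := by have := congrArg Complex.im h; simp at this; linarith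
    apply hab
    rw [Real.sin_sub]
    have : Real.cos a = - Real.cos b := by linarith
    have h3 : Real.sin a = - Real.sin b := by linarith
    rw [this, h3]; ring
  have p3 : za * zb = zc * zd := by
    apply mul_right_cancel₀ hne
    rw [← p2, ← e2, ← p1, e1]
  have q : (za - zc) * (za - zd) = 0 := by
    linear_combination za * e1 - p3
  have fin : ∀ s t : ℝ, Complex.exp (s * Complex.I) = Complex.exp (t * Complex.I) → Real.cos s = Real.cos t ∧ Real.sin s = Real.sin t := by
    intro s t h
    rw [ex, ex] at h
    exact ⟨(Complex.ext_iff.1 h).1, (Complex.ext_iff.1 h).2⟩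
  rcases mul_eq_zero.1 q with h | h
  · left
    have := fin a c (sub_eq_zero.1 h)
    exact ⟨ang_inj ha hc this.1 this.2, ang_inj hb hd (by linarith) (by linarith)⟩
  · right
    have := fin a d (sub_eq_zero.1 h)
    exact ⟨ang_inj ha hd this.1 this.2, ang_inj hb hc (by linarith) (by linarith)⟩

theorem cv_half (D : Set (ℝ × ℝ)) (hD : MeasurableSet D) (δ : ℝ)
    (hD1 : ∀ z ∈ D, z.1 ∈ Ioc (0:ℝ) (2 * π) ∧ z.2 ∈ Ioc (0:ℝ) (2 * π) ∧ δ ≤ |Real.sin (z.1 - z.2)|)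
    (hinj : InjOn Phi D) (g : ℝ × ℝ → ℝ≥0∞) :
    ENNReal.ofReal δ * ∫⁻ z in D, g (Phi z) ≤ ∫⁻ w, g w := by
  have h := lintegral_image_eq_lintegral_abs_det_fderiv_mul volume hD
    (fun z _ => (hasFDerivAt_Phi z).hasFDerivWithinAt) hinj g
  rw [← lintegral_const_mul' _ _ ENNReal.ofReal_ne_top]
  calc ∫⁻ z in D, ENNReal.ofReal δ * g (Phi z) ≤ ∫⁻ z in D, ENNReal.ofReal |(dPhi z).det| * g (Phi z) := by
        refine setLIntegral_mono' hD fun z hz => ?_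
        gcongr
        rw [det_dPhi, ← neg_sub, Real.sin_neg, abs_neg]
        exact (hD1 z hz).2.2
    _ = ∫⁻ w in Phi '' D, g w := h.symm
    _ ≤ ∫⁻ w, g w := setLIntegral_le_lintegral _ _

theorem cv (D : Set (ℝ × ℝ)) (hD : MeasurableSet D) (δ : ℝ) (hδ : 0 < δ)
    (hD1 : ∀ z ∈ D, z.1 ∈ Ioc (0:ℝ) (2 * π) ∧ z.2 ∈ Ioc (0:ℝ) (2 * π) ∧ δ ≤ |Real.sin (z.1 - z.2)|)
    (g : ℝ × ℝ → ℝ≥0∞) :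
    ENNReal.ofReal δ * ∫⁻ z in D, g (Phi z) ≤ 2 * ∫⁻ w, g w := by
  have hm : MeasurableSet {z : ℝ × ℝ | z.1 < z.2} := measurableSet_lt measurable_fst measurable_snd
  rw [← lintegral_inter_add_sdiff _ D hm, mul_add, two_mul]
  have ne : ∀ z ∈ D, Real.sin (z.1 - z.2) ≠ 0 := by
    intro z hz h
    have := (hD1 z hz).2.2
    rw [h, abs_zero] at this; linarith
  have P : ∀ z ∈ D, ∀ w ∈ D, Phi z = Phi w → (z = w ∨ (z.1 = w.2 ∧ z.2 = w.1)) := by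
    intro z hz w hw h
    have h1 := congrArg Prod.fst h
    have h2 := congrArg Prod.snd h
    rcases pair_inj (hD1 z hz).1 (hD1 z hz).2.1 (hD1 w hw).1 (hD1 w hw).2.1 (ne z hz) h1 h2 with h | h
    · left; exact Prod.ext h.1 h.2
    · right; exact h
  gcongr
  · apply cv_half _ (hD.inter hm) δ (fun z hz => hD1 z hz.1)
    intro z hz w hw h
    rcases P z hz.1 w hw.1 h with h | h
    · exact h
    · have h1 : z.1 < z.2 := hz.2
      have h2 : w.1 < w.2 := hw.2
      linarith
  · apply cv_half _ (hD.diff hm) δ (fun z hz => hD1 z hz.1)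
    intro z hz w hw h
    rcases P z hz.1 w hw.1 h with h | h
    · exact h
    · have h1 : z.2 ≤ z.1 := not_lt.1 hz.2
      have h2 : w.2 ≤ w.1 := not_lt.1 hw.2
      exact Prod.ext (by linarith) (by linarith)

theorem gk_int (ε : ℝ) (hε : 0 < ε) (a : ℝ × ℝ) :
    ∫⁻ w : ℝ × ℝ, ENNReal.ofReal (gk ε (a.1 - w.1) (a.2 - w.2)) = ENNReal.ofReal (4 * π ^ 2) := by
  have h1 := (gw_int (1 / (4 * ε)) (by positivity))
  have e : ∀ w : ℝ × ℝ, gk ε (a.1 - w.1) (a.2 - w.2) = π / ε * gw (1 / (4 * ε)) (a - w) := by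
    intro w; unfold gk gw; rw [← Real.exp_add]; congr 2
    simp only [Prod.fst_sub, Prod.snd_sub]; ring
  simp_rw [e]
  rw [lintegral_sub_left_eq_self (fun w : ℝ × ℝ => ENNReal.ofReal (π / ε * gw (1 / (4 * ε)) w)) a]
  rw [← ofReal_integral_eq_lintegral_ofReal (h1.const_mul _) (ae_of_all _ fun w => by
    have := gw_nonneg (1 / (4 * ε)) w
    simp only [Pi.zero_apply]; positivity)]
  congr 1
  rw [integral_const_mul]
  unfold gw
  rw [Measure.volume_eq_prod, integral_prod_mul (fun x : ℝ => Real.exp (-(1 / (4 * ε)) * x ^ 2)) (fun x : ℝ => Real.exp (-(1 / (4 * ε)) * x ^ 2)), integral_gaussian,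
    Real.mul_self_sqrt (by positivity)]
  field_simp

/-- Plancherel-type estimate for the sum map. -/
theorem bil_L2 (D : Set (ℝ × ℝ)) (hD : MeasurableSet D) (δ : ℝ) (hδ : 0 < δ)
    (hD1 : ∀ z ∈ D, z.1 ∈ Ioc (0:ℝ) (2 * π) ∧ z.2 ∈ Ioc (0:ℝ) (2 * π) ∧ δ ≤ |Real.sin (z.1 - z.2)|)
    (f : ℝ × ℝ → ℂ) (hf : Measurable f) (hf1 : ∀ z, ‖f z‖ ≤ 1) :
    ∫⁻ p : ℝ × ℝ, ‖∫ z in D, f z * Complex.exp (Complex.I * Complex.ofReal (p.1 * (Phi z).1 + p.2 * (Phi z).2))‖ₑ ^ 2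
      ≤ ENNReal.ofReal (8 * π ^ 2 / δ) * ∫⁻ z in D, ‖f z‖ₑ := by
  have hPm : Measurable Phi := by unfold Phi; fun_prop
  have hfin : IsFiniteMeasure (volume.restrict D) := by
    refine ⟨?_⟩
    rw [Measure.restrict_apply_univ]
    have : D ⊆ (Ioc (0:ℝ) (2 * π)) ×ˢ (Ioc (0:ℝ) (2 * π)) := fun z hz => ⟨(hD1 z hz).1, (hD1 z hz).2.1⟩
    refine (measure_mono this).trans_lt ?_
    rw [Measure.volume_eq_prod, Measure.prod_prod]
    simp only [Real.volume_Ioc]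
    exact ENNReal.mul_lt_top ENNReal.ofReal_lt_top ENNReal.ofReal_lt_top
  have key : ∀ n : ℕ, ∫⁻ p : ℝ × ℝ, ‖∫ z in D, f z * Complex.exp (Complex.I * Complex.ofReal (p.1 * (Phi z).1 + p.2 * (Phi z).2))‖ₑ ^ 2 * ENNReal.ofReal (gw (1 / (n + 1)) p)
      ≤ ENNReal.ofReal (8 * π ^ 2 / δ) * ∫⁻ z in D, ‖f z‖ₑ := by
    intro n
    refine gauss_schur (volume.restrict D) (fun z => (Phi z).1) (fun z => (Phi z).2) (by fun_prop) (by fun_prop) f hf hf1 _ (by positivity) _ ?_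
    refine ae_of_all _ fun x => ?_
    have h := cv D hD δ hδ hD1 (fun w => ENNReal.ofReal (gk (1 / (n + 1)) ((Phi x).1 - w.1) ((Phi x).2 - w.2)))
    rw [gk_int _ (by positivity)] at h
    rw [ENNReal.ofReal_div_of_pos hδ, ENNReal.le_div_iff_mul_le (by simp [hδ]) (by simp), mul_comm]
    refine h.trans (le_of_eq ?_)
    rw [show (2:ℝ≥0∞) = ENNReal.ofReal 2 by simp, ← ENNReal.ofReal_mul (by norm_num)]
    congr 1; ring
  have hm : Measurable (fun p : ℝ × ℝ => ∫ z in D, f z * Complex.exp (Complex.I * Complex.ofReal (p.1 * (Phi z).1 + p.2 * (Phi z).2))) := by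
    refine (StronglyMeasurable.integral_prod_right (f := fun (p : ℝ × ℝ) z => f z * Complex.exp (Complex.I * Complex.ofReal (p.1 * (Phi z).1 + p.2 * (Phi z).2))) ?_).measurable
    apply Measurable.stronglyMeasurable
    simp only [Function.uncurry_def]
    fun_prop
  have lim : ∀ p : ℝ × ℝ, Tendsto (fun n : ℕ => ‖∫ z in D, f z * Complex.exp (Complex.I * Complex.ofReal (p.1 * (Phi z).1 + p.2 * (Phi z).2))‖ₑ ^ 2 * ENNReal.ofReal (gw (1 / ((n:ℝ) + 1)) p)) atTop
      (nhds (‖∫ z in D, f z * Complex.exp (Complex.I * Complex.ofReal (p.1 * (Phi z).1 + p.2 * (Phi z).2))‖ₑ ^ 2 * 1)) := by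
    intro p
    refine ENNReal.Tendsto.const_mul ?_ (Or.inl one_ne_zero)
    rw [← ENNReal.ofReal_one]
    apply ENNReal.tendsto_ofReal
    have h0 := tendsto_one_div_add_atTop_nhds_zero_nat (𝕜 := ℝ)
    have : Continuous (fun e : ℝ => gw e p) := by unfold gw; fun_prop
    have h2 := (this.tendsto 0).comp h0
    simpa [gw, Function.comp_def] using h2
  calc _ = ∫⁻ p : ℝ × ℝ, liminf (fun n : ℕ => ‖∫ z in D, f z * Complex.exp (Complex.I * Complex.ofReal (p.1 * (Phi z).1 + p.2 * (Phi z).2))‖ₑ ^ 2 * ENNReal.ofReal (gw (1 / ((n:ℝ) + 1)) p)) atTop := by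
        refine lintegral_congr fun p => ?_
        rw [(lim p).liminf_eq, mul_one]
    _ ≤ _ := lintegral_liminf_le (fun n => (hm.enorm.pow_const 2).mul (by unfold gw; fun_prop))
    _ ≤ _ := by
        refine liminf_le_of_le (by isBoundedDefault) ?_
        intro b hb
        obtain ⟨n, hn⟩ := hb.exists
        exact hn.trans (key n)


def mu0 : Measure ℝ := volume.restrict (Ioc (0:ℝ) (2 * π))

instance : IsFiniteMeasure mu0 := by unfold mu0; infer_instance

def IE (F : ℝ → ℂ) (p : ℝ × ℝ) : ℂ :=
  ∫ φ, F φ * Complex.exp (Complex.I * Complex.ofReal (p.1 * Real.cos φ + p.2 * Real.sin φ)) ∂mu0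

structure SubF (F : ℝ → ℂ) (m : ℝ) : Prop where
  meas : Measurable F
  bd : ∀ φ, ‖F φ‖ ≤ 1
  supp : mu0 {φ | F φ ≠ 0} ≤ ENNReal.ofReal m

def AK (k : ℕ) : Set (ℝ × ℝ) := {p | (2:ℝ) ^ k ≤ 1 + |p.1| + |p.2| ∧ 1 + |p.1| + |p.2| < (2:ℝ) ^ (k + 1)}

theorem AK_meas (k : ℕ) : MeasurableSet (AK k) := by
  have m : Measurable (fun p : ℝ × ℝ => 1 + |p.1| + |p.2|) :=
    (continuous_const.add continuous_fst.abs |>.add continuous_snd.abs).measurable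
  exact (measurableSet_le measurable_const m).inter (measurableSet_lt m measurable_const)

theorem IE_meas {F : ℝ → ℂ} (hF : Measurable F) : Measurable (IE F) := by
  unfold IE
  refine (StronglyMeasurable.integral_prod_right (f := fun (p : ℝ × ℝ) φ => F φ * Complex.exp (Complex.I * Complex.ofReal (p.1 * Real.cos φ + p.2 * Real.sin φ))) ?_).measurable
  apply Measurable.stronglyMeasurable
  simp only [Function.uncurry_def]
  fun_prop

theorem enorm_ph (z : ℂ) (t : ℝ) : ‖z * Complex.exp (Complex.I * Complex.ofReal t)‖ₑ = ‖z‖ₑ := by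
  rw [enorm_mul, ← ofReal_norm (Complex.exp _), mul_comm Complex.I, Complex.norm_exp_ofReal_mul_I]; simp

theorem SubF.lint {F : ℝ → ℂ} {m : ℝ} (h : SubF F m) : ∫⁻ φ, ‖F φ‖ₑ ∂mu0 ≤ ENNReal.ofReal m := by
  have hs : MeasurableSet {φ | F φ ≠ 0} := (h.meas (measurableSet_singleton 0)).compl
  refine le_trans ?_ h.supp
  rw [← lintegral_indicator_one hs]
  refine lintegral_mono fun φ => ?_
  by_cases hφ : F φ = 0
  · simp [hφ]
  · rw [indicator_of_mem (by exact hφ), Pi.one_apply, ← ofReal_norm]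
    exact ENNReal.ofReal_le_one.2 (h.bd φ)

theorem SubF.linf {F : ℝ → ℂ} {m : ℝ} (h : SubF F m) (p : ℝ × ℝ) : ‖IE F p‖ₑ ≤ ENNReal.ofReal m := by
  refine (enorm_integral_le_lintegral_enorm _).trans (le_trans (le_of_eq ?_) h.lint)
  exact lintegral_congr fun φ => enorm_ph _ _

theorem cos_gauss (R u : ℝ) (hu : u ∈ Ioo (-(2 * π)) (2 * π)) :
    Real.exp (-(R ^ 2 * (2 - 2 * Real.cos u) / 4)) ≤
      Real.exp (-(R ^ 2 / π ^ 2) * u ^ 2) + Real.exp (-(R ^ 2 / π ^ 2) * (u - 2 * π) ^ 2)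
        + Real.exp (-(R ^ 2 / π ^ 2) * (u + 2 * π) ^ 2) := by
  have gen : ∀ w : ℝ, |w| ≤ π → Real.cos w = Real.cos u →
      Real.exp (-(R ^ 2 * (2 - 2 * Real.cos u) / 4)) ≤ Real.exp (-(R ^ 2 / π ^ 2) * w ^ 2) := by
    intro w hw hc
    rw [← hc]
    apply Real.exp_le_exp.2
    have h := Real.cos_le_one_sub_mul_cos_sq hw
    have : R ^ 2 / π ^ 2 * w ^ 2 = R ^ 2 * (2 / π ^ 2 * w ^ 2) / 2 := by ring
    nlinarith [sq_nonneg R]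
  have p1 := Real.exp_pos (-(R ^ 2 / π ^ 2) * u ^ 2)
  have p2 := Real.exp_pos (-(R ^ 2 / π ^ 2) * (u - 2 * π) ^ 2)
  have p3 := Real.exp_pos (-(R ^ 2 / π ^ 2) * (u + 2 * π) ^ 2)
  rcases le_total |u| π with h | h
  · have := gen u h rfl; linarith
  · rcases le_total 0 u with h0 | h0
    · rw [abs_of_nonneg h0] at h
      have := gen (u - 2 * π) (by rw [abs_le]; constructor <;> linarith [hu.2, Real.pi_pos]) (Real.cos_sub_two_pi u)
      linarith
    · rw [abs_of_nonpos h0] at h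
      have := gen (u + 2 * π) (by rw [abs_le]; constructor <;> linarith [hu.1, Real.pi_pos]) (Real.cos_add_two_pi u)
      linarith

theorem gauss_shift (c a : ℝ) (hc : 0 < c) :
    ∫⁻ y : ℝ, ENNReal.ofReal (Real.exp (-c * (a - y) ^ 2)) = ENNReal.ofReal (Real.sqrt (π / c)) := by
  rw [lintegral_sub_left_eq_self (fun y : ℝ => ENNReal.ofReal (Real.exp (-c * y ^ 2))) a,
    ← ofReal_integral_eq_lintegral_ofReal (integrable_exp_neg_mul_sq hc) (ae_of_all _ fun y => (Real.exp_pos _).le), integral_gaussian]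

theorem circ_S (R : ℝ) (hR : 0 < R) (x : ℝ) (hx : x ∈ Ioc (0:ℝ) (2 * π)) :
    ∫⁻ y, ENNReal.ofReal (gk (1 / R ^ 2) (Real.cos x - Real.cos y) (Real.sin x - Real.sin y)) ∂mu0
      ≤ ENNReal.ofReal (3 * π * π * Real.sqrt π * R) := by
  have hc : 0 < R ^ 2 / π ^ 2 := by positivity
  have pt : ∀ y ∈ Ioc (0:ℝ) (2 * π), ENNReal.ofReal (gk (1 / R ^ 2) (Real.cos x - Real.cos y) (Real.sin x - Real.sin y))
      ≤ ENNReal.ofReal (π * R ^ 2) * ((ENNReal.ofReal (Real.exp (-(R ^ 2 / π ^ 2) * (x - y) ^ 2)) +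
        ENNReal.ofReal (Real.exp (-(R ^ 2 / π ^ 2) * (x - 2 * π - y) ^ 2))) +
        ENNReal.ofReal (Real.exp (-(R ^ 2 / π ^ 2) * (x + 2 * π - y) ^ 2))) := by
    intro y hy
    rw [← ENNReal.ofReal_add (by positivity) (by positivity), ← ENNReal.ofReal_add (by positivity) (by positivity),
      ← ENNReal.ofReal_mul (by positivity)]
    apply ENNReal.ofReal_le_ofReal
    have h := cos_gauss R (x - y) ⟨by linarith [hx.1, hy.2], by linarith [hx.2, hy.1]⟩
    have e : gk (1 / R ^ 2) (Real.cos x - Real.cos y) (Real.sin x - Real.sin y)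
        = π * R ^ 2 * Real.exp (-(R ^ 2 * (2 - 2 * Real.cos (x - y)) / 4)) := by
      unfold gk
      have : (Real.cos x - Real.cos y) ^ 2 + (Real.sin x - Real.sin y) ^ 2 = 2 - 2 * Real.cos (x - y) := by
        rw [Real.cos_sub]; nlinarith [Real.sin_sq_add_cos_sq x, Real.sin_sq_add_cos_sq y]
      rw [this]
      congr 1
      · field_simp
      · congr 1; field_simp
    rw [e, show x - 2 * π - y = x - y - 2 * π by ring, show x + 2 * π - y = x - y + 2 * π by ring]
    gcongr
  unfold mu0
  refine (setLIntegral_mono' measurableSet_Ioc pt).trans ?_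
  refine (setLIntegral_le_lintegral _ _).trans ?_
  rw [lintegral_const_mul _ (by fun_prop), lintegral_add_left (by fun_prop), lintegral_add_left (by fun_prop),
    gauss_shift _ _ hc, gauss_shift _ _ hc, gauss_shift _ _ hc,
    ← ENNReal.ofReal_add (by positivity) (by positivity), ← ENNReal.ofReal_add (by positivity) (by positivity),
      ← ENNReal.ofReal_mul (by positivity)]
  apply ENNReal.ofReal_le_ofReal
  have : Real.sqrt (π / (R ^ 2 / π ^ 2)) = π * Real.sqrt π / R := by
    rw [show π / (R ^ 2 / π ^ 2) = π * (π / R) ^ 2 by field_simp, Real.sqrt_mul (by positivity), Real.sqrt_sq (by positivity)]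
    ring
  rw [this]
  apply le_of_eq
  field_simp
  ring

theorem L2loc : ∃ C : ℝ, 0 < C ∧ ∀ (k : ℕ) (F : ℝ → ℂ) (m : ℝ), SubF F m →
    ∫⁻ p in AK k, ‖IE F p‖ₑ ^ (2:ℝ) ≤ ENNReal.ofReal (C * 2 ^ k * m) := by
  refine ⟨Real.exp 4 * (3 * π * π * Real.sqrt π), by positivity, fun k F m h => ?_⟩
  set R : ℝ := 2 ^ k with hR
  have hR0 : 0 < R := by positivity
  have g := gauss_schur mu0 Real.cos Real.sin (by fun_prop) (by fun_prop) F h.meas h.bd (1 / R ^ 2) (by positivity)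
    (ENNReal.ofReal (3 * π * π * Real.sqrt π * R)) (by
      unfold mu0
      filter_upwards [ae_restrict_mem measurableSet_Ioc] with x hx
      exact circ_S R hR0 x hx)
  have pt : ∀ p ∈ AK k, ‖IE F p‖ₑ ^ (2:ℝ) ≤ ENNReal.ofReal (Real.exp 4) * (‖IE F p‖ₑ ^ 2 * ENNReal.ofReal (gw (1 / R ^ 2) p)) := by
    intro p hp
    rw [mul_left_comm, ← ENNReal.ofReal_mul (by positivity), ENNReal.rpow_two]
    refine le_mul_of_one_le_right (zero_le) ?_
    rw [← ENNReal.ofReal_one]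
    apply ENNReal.ofReal_le_ofReal
    unfold gw
    rw [← Real.exp_add, ← Real.exp_add]
    apply Real.one_le_exp
    have h2 : |p.1| + |p.2| ≤ 2 * R := by
      have := hp.2; rw [pow_succ] at this; rw [hR]; linarith
    have h3 : p.1 ^ 2 + p.2 ^ 2 ≤ 4 * R ^ 2 := by
      have a1 := abs_nonneg p.1
      have a2 := abs_nonneg p.2
      rw [← sq_abs p.1, ← sq_abs p.2]; nlinarith
    have h4 : 1 / R ^ 2 * (p.1 ^ 2 + p.2 ^ 2) ≤ 4 := by
      rw [one_div, inv_mul_le_iff₀ (by positivity)]; linarith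
    linarith
  calc _ ≤ ∫⁻ p in AK k, ENNReal.ofReal (Real.exp 4) * (‖IE F p‖ₑ ^ 2 * ENNReal.ofReal (gw (1 / R ^ 2) p)) :=
        setLIntegral_mono' (AK_meas k) pt
    _ ≤ ∫⁻ p, ENNReal.ofReal (Real.exp 4) * (‖IE F p‖ₑ ^ 2 * ENNReal.ofReal (gw (1 / R ^ 2) p)) := setLIntegral_le_lintegral _ _
    _ ≤ ENNReal.ofReal (Real.exp 4) * (ENNReal.ofReal (3 * π * π * Real.sqrt π * R) * ENNReal.ofReal m) := by
        rw [lintegral_const_mul' _ _ ENNReal.ofReal_ne_top]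
        gcongr
        exact g.trans (by gcongr; exact h.lint)
    _ = _ := by
        rw [← ENNReal.ofReal_mul (by positivity), ← ENNReal.ofReal_mul (by positivity)]
        congr 1; ring


theorem sublevel (x h : ℝ) (hx : x ∈ Ioc (0:ℝ) (2 * π)) (hh : 0 ≤ h) :
    mu0 {y | |Real.sin (x - y)| ≤ h} ≤ ENNReal.ofReal (5 * π * h) := by
  unfold mu0
  rw [Measure.restrict_apply (by
    exact measurableSet_le (by fun_prop) measurable_const)]
  have sub : {y | |Real.sin (x - y)| ≤ h} ∩ Ioc (0:ℝ) (2 * π) ⊆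
      ⋃ n ∈ Finset.Icc (-2:ℤ) 2, Icc (x - n * π - π * h / 2) (x - n * π + π * h / 2) := by
    rintro y ⟨h1, h2⟩
    have hpi := Real.pi_pos
    set u := x - y with hu
    set n := round (u / π) with hn
    have hr := abs_sub_round (u / π)
    have e : u - n * π = (u / π - n) * π := by field_simp
    have a1 : |u - n * π| ≤ π / 2 := by
      rw [e, abs_mul, abs_of_pos hpi]; nlinarith
    have a2 := Real.mul_abs_le_abs_sin a1
    have a3 : |Real.sin (u - n * π)| = |Real.sin u| := by
      rw [Real.sin_sub_int_mul_pi, abs_mul]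
      simp
    rw [a3] at a2
    have a4 : |u - n * π| ≤ π * h / 2 := by
      have : 2 / π * |u - n * π| ≤ h := a2.trans h1
      rw [div_mul_eq_mul_div, div_le_iff₀ hpi] at this
      linarith
    have b := abs_le.1 hr
    have u1 : u / π < 2 := by rw [div_lt_iff₀ hpi]; rw [hu]; linarith [hx.2, h2.1]
    have u2 : -2 < u / π := by rw [lt_div_iff₀ hpi]; rw [hu]; linarith [hx.1, h2.2]
    have n1 : (n:ℝ) < 3 := by linarith [b.1]
    have n2 : (-3:ℝ) < n := by linarith [b.2]
    have n1' : n < 3 := by exact_mod_cast n1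
    have n2' : -3 < n := by exact_mod_cast n2
    simp only [mem_iUnion]
    refine ⟨n, Finset.mem_Icc.2 ⟨by omega, by omega⟩, ?_⟩
    have c := abs_le.1 a4
    constructor <;> linarith [c.1, c.2]
  refine (measure_mono sub).trans ((measure_biUnion_finset_le _ _).trans ?_)
  simp only [Real.volume_Icc]
  rw [← ENNReal.ofReal_sum_of_nonneg (by intro i _; nlinarith [Real.pi_pos])]
  apply ENNReal.ofReal_le_ofReal
  have : ∀ i : ℤ, x - i * π + π * h / 2 - (x - i * π - π * h / 2) = π * h := by intro i; ring
  simp only [this, Finset.sum_const, Int.card_Icc, nsmul_eq_mul]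
  apply le_of_eq
  rw [show ((2:ℤ) + 1 - (-2)).toNat = 5 by decide]
  norm_num; ring

def DL (l : ℕ) : Set (ℝ × ℝ) :=
  (Ioc (0:ℝ) (2 * π) ×ˢ Ioc (0:ℝ) (2 * π)) ∩
    {z | ((2:ℝ)⁻¹) ^ (l + 1) < |Real.sin (z.1 - z.2)| ∧ |Real.sin (z.1 - z.2)| ≤ ((2:ℝ)⁻¹) ^ l}

theorem abs_sin_meas : Measurable (fun z : ℝ × ℝ => |Real.sin (z.1 - z.2)|) :=
  (Real.continuous_sin.comp (continuous_fst.sub continuous_snd)).abs.measurable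

theorem DL_meas (l : ℕ) : MeasurableSet (DL l) := by
  refine (measurableSet_Ioc.prod measurableSet_Ioc).inter ?_
  exact (measurableSet_lt measurable_const abs_sin_meas).inter (measurableSet_le abs_sin_meas measurable_const)

theorem DL_disj : Pairwise (Function.onFun Disjoint DL) := by
  have key : ∀ i j : ℕ, i < j → Disjoint (DL i) (DL j) := by
    intro i j hij
    rw [Set.disjoint_left]
    intro z hz hz'
    have h1 := hz.2.1
    have h2 := hz'.2.2
    have : ((2:ℝ)⁻¹) ^ j ≤ ((2:ℝ)⁻¹) ^ (i + 1) := pow_le_pow_of_le_one (by norm_num) (by norm_num) hij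
    linarith
  intro i j hij
  rcases lt_or_gt_of_ne hij with h | h
  · exact key i j h
  · exact (key j i h).symm

theorem DL_union : (⋃ l, DL l) =ᵐ[volume] (Ioc (0:ℝ) (2 * π) ×ˢ Ioc (0:ℝ) (2 * π)) := by
  have hnull : volume {z : ℝ × ℝ | Real.sin (z.1 - z.2) = 0} = 0 := by
    have hm : MeasurableSet {z : ℝ × ℝ | Real.sin (z.1 - z.2) = 0} :=
      measurableSet_eq_fun (by fun_prop) measurable_const
    rw [Measure.volume_eq_prod, Measure.measure_prod_null hm]
    refine ae_of_all _ fun x => ?_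
    have : (Prod.mk x ⁻¹' {z : ℝ × ℝ | Real.sin (z.1 - z.2) = 0}) ⊆ Set.range (fun n : ℤ => x - n * π) := by
      intro y hy
      obtain ⟨n, hn⟩ := Real.sin_eq_zero_iff.1 hy
      exact ⟨n, by simp only at hn ⊢; linarith⟩
    exact measure_mono_null this ((Set.countable_range _).measure_zero _)
  have hne : ∀ᵐ z : ℝ × ℝ, Real.sin (z.1 - z.2) ≠ 0 := by
    rw [ae_iff]; simpa using hnull
  filter_upwards [hne] with z hz
  refine propext ⟨fun h => ?_, fun h => ?_⟩
  · obtain ⟨l, hl⟩ := mem_iUnion.1 h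
    exact hl.1
  · have h0 : 0 < |Real.sin (z.1 - z.2)| := abs_pos.2 hz
    obtain ⟨n, hn1, hn2⟩ := exists_nat_pow_near_of_lt_one (y := (2:ℝ)⁻¹) h0 (Real.abs_sin_le_one _) (by norm_num) (by norm_num)
    exact mem_iUnion.2 ⟨n, h, hn1, hn2⟩

def BL (F G : ℝ → ℂ) (l : ℕ) (p : ℝ × ℝ) : ℂ :=
  ∫ z in DL l, (F z.1 * G z.2) * Complex.exp (Complex.I * Complex.ofReal (p.1 * (Phi z).1 + p.2 * (Phi z).2))

theorem BL_meas {F G : ℝ → ℂ} (hF : Measurable F) (hG : Measurable G) (l : ℕ) : Measurable (BL F G l) := by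
  unfold BL
  have hPm : Measurable Phi := by unfold Phi; fun_prop
  refine (StronglyMeasurable.integral_prod_right (f := fun (p : ℝ × ℝ) (z : ℝ × ℝ) => (F z.1 * G z.2) * Complex.exp (Complex.I * Complex.ofReal (p.1 * (Phi z).1 + p.2 * (Phi z).2))) ?_).measurable
  apply Measurable.stronglyMeasurable
  simp only [Function.uncurry_def]
  fun_prop

theorem prod_le_BL {F G : ℝ → ℂ} {m M : ℝ} (hF : SubF F m) (hG : SubF G M) (p : ℝ × ℝ) :
    ‖IE F p‖ₑ * ‖IE G p‖ₑ ≤ ∑' l, ‖BL F G l p‖ₑ := by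
  have hPm : Measurable Phi := by unfold Phi; fun_prop
  have hFm := hF.meas
  have hGm := hG.meas
  set f : ℝ × ℝ → ℂ := fun z => (F z.1 * G z.2) * Complex.exp (Complex.I * Complex.ofReal (p.1 * (Phi z).1 + p.2 * (Phi z).2)) with hf
  have e : IE F p * IE G p = ∫ z in (Ioc (0:ℝ) (2 * π) ×ˢ Ioc (0:ℝ) (2 * π)), f z := by
    unfold IE
    rw [← integral_prod_mul, Measure.volume_eq_prod, ← Measure.prod_restrict]
    refine integral_congr_ae (ae_of_all _ fun z => ?_)
    simp only [hf, Phi]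
    have : Complex.exp (Complex.I * Complex.ofReal (p.1 * (Real.cos z.1 + Real.cos z.2) + p.2 * (Real.sin z.1 + Real.sin z.2)))
      = Complex.exp (Complex.I * Complex.ofReal (p.1 * Real.cos z.1 + p.2 * Real.sin z.1)) * Complex.exp (Complex.I * Complex.ofReal (p.1 * Real.cos z.2 + p.2 * Real.sin z.2)) := by
      rw [← Complex.exp_add]; congr 1; push_cast; ring
    rw [this]; ring
  rw [← enorm_mul, e, ← Measure.restrict_congr_set DL_union]
  have hint : IntegrableOn f (⋃ l, DL l) := by
    unfold IntegrableOn
    rw [Measure.restrict_congr_set DL_union, Measure.volume_eq_prod, ← Measure.prod_restrict]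
    have hfm : Measurable f := by simp only [hf]; fun_prop
    refine Integrable.of_bound hfm.aestronglyMeasurable 1 (ae_of_all _ fun z => ?_)
    simp only [hf]
    rw [norm_mul, mul_comm Complex.I, Complex.norm_exp_ofReal_mul_I, mul_one, norm_mul]
    exact mul_le_one₀ (hF.bd _) (norm_nonneg _) (hG.bd _)
  have hs := hasSum_integral_iUnion DL_meas DL_disj hint
  rw [← hs.tsum_eq]
  exact enorm_tsum_le_tsum_enorm

theorem mass_DL {F G : ℝ → ℂ} {m M : ℝ} (hm : 0 ≤ m) (hF : SubF F m) (hG : SubF G M) (l : ℕ) :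
    ∫⁻ z in DL l, ‖F z.1 * G z.2‖ₑ ≤ ENNReal.ofReal (5 * π * (m * min M (((2:ℝ)⁻¹) ^ l))) := by
  have hFm := hF.meas
  have hGm := hG.meas
  have hpi := Real.pi_gt_three
  rw [mul_left_comm, mul_min_of_nonneg _ _ (by positivity), mul_min_of_nonneg _ _ hm, ENNReal.ofReal_min]
  apply le_min
  · calc _ ≤ ∫⁻ z in (Ioc (0:ℝ) (2 * π) ×ˢ Ioc (0:ℝ) (2 * π)), ‖F z.1 * G z.2‖ₑ := lintegral_mono_set inter_subset_left
      _ = ∫⁻ x, ∫⁻ y, ‖F x‖ₑ * ‖G y‖ₑ ∂mu0 ∂mu0 := by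
          rw [Measure.volume_eq_prod, ← Measure.prod_restrict]
          simp_rw [enorm_mul]
          exact lintegral_prod _ (by fun_prop)
      _ = (∫⁻ x, ‖F x‖ₑ ∂mu0) * ∫⁻ y, ‖G y‖ₑ ∂mu0 := by
          rw [← lintegral_mul_const _ hFm.enorm]
          exact lintegral_congr fun x => lintegral_const_mul _ hGm.enorm
      _ ≤ ENNReal.ofReal m * ENNReal.ofReal M := by gcongr; exact hF.lint; exact hG.lint
      _ = ENNReal.ofReal (m * M) := (ENNReal.ofReal_mul hm).symm
      _ ≤ _ := by
          rcases le_total 0 M with hM | hM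
          · apply ENNReal.ofReal_le_ofReal; nlinarith [mul_nonneg hm hM]
          · rw [ENNReal.ofReal_of_nonpos]; simp
            exact mul_nonpos_of_nonneg_of_nonpos hm hM
  · set h : ℝ := ((2:ℝ)⁻¹) ^ l with hh
    have hh0 : 0 ≤ h := by positivity
    have hSm : MeasurableSet {z : ℝ × ℝ | |Real.sin (z.1 - z.2)| ≤ h} := measurableSet_le abs_sin_meas measurable_const
    calc _ ≤ ∫⁻ z in DL l, ‖F z.1‖ₑ * ({z : ℝ × ℝ | |Real.sin (z.1 - z.2)| ≤ h}).indicator 1 z := by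
          refine setLIntegral_mono' (DL_meas l) fun z hz => ?_
          rw [indicator_of_mem (by exact hz.2.2), Pi.one_apply, enorm_mul]
          gcongr
          rw [← ofReal_norm]
          exact ENNReal.ofReal_le_one.2 (hG.bd _)
      _ ≤ ∫⁻ z in (Ioc (0:ℝ) (2 * π) ×ˢ Ioc (0:ℝ) (2 * π)), ‖F z.1‖ₑ * ({z : ℝ × ℝ | |Real.sin (z.1 - z.2)| ≤ h}).indicator 1 z := lintegral_mono_set inter_subset_left
      _ = ∫⁻ x, ∫⁻ y, ‖F x‖ₑ * ({z : ℝ × ℝ | |Real.sin (z.1 - z.2)| ≤ h}).indicator 1 (x, y) ∂mu0 ∂mu0 := by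
          rw [Measure.volume_eq_prod, ← Measure.prod_restrict]
          refine lintegral_prod _ (Measurable.aemeasurable ?_)
          exact (hFm.comp measurable_fst).enorm.mul (measurable_one.indicator hSm)
      _ ≤ ∫⁻ x, ‖F x‖ₑ * ENNReal.ofReal (5 * π * h) ∂mu0 := by
          unfold mu0
          refine setLIntegral_mono' measurableSet_Ioc fun x hx => ?_
          have hm1 : Measurable (fun y => ({z : ℝ × ℝ | |Real.sin (z.1 - z.2)| ≤ h}).indicator (1 : ℝ × ℝ → ℝ≥0∞) (x, y)) :=
            (measurable_one.indicator hSm).comp measurable_prodMk_left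
          rw [lintegral_const_mul _ hm1]
          gcongr
          refine le_trans (le_of_eq ?_) (sublevel x h hx hh0)
          rw [← lintegral_indicator_one (by exact measurable_prodMk_left hSm)]
          rfl
      _ ≤ _ := by
          rw [lintegral_mul_const _ hFm.enorm]
          refine (mul_le_mul_left hF.lint _).trans (le_of_eq ?_)
          rw [← ENNReal.ofReal_mul hm]


theorem BL_Lp {F G : ℝ → ℂ} {m M p : ℝ} (hp : 2 < p) (hm : 0 < m) (hM : 0 < M) (hF : SubF F m) (hG : SubF G M) (l : ℕ) :
    (∫⁻ x, ‖BL F G l x‖ₑ ^ p) ^ (1 / p) ≤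
      ENNReal.ofReal ((16 * π ^ 2 * 2 ^ l * (5 * π * (m * min M (((2:ℝ)⁻¹) ^ l))) ^ (p - 1)) ^ (1 / p)) := by
  set W : ℝ := 5 * π * (m * min M (((2:ℝ)⁻¹) ^ l)) with hW
  have hW0 : 0 < W := by positivity
  have hmass := mass_DL hm.le hF hG l
  have hFm := hF.meas
  have hGm := hG.meas
  have hinf : ∀ x, ‖BL F G l x‖ₑ ≤ ENNReal.ofReal W := by
    intro x
    refine (enorm_integral_le_lintegral_enorm _).trans (le_trans (le_of_eq ?_) hmass)
    exact lintegral_congr fun φ => enorm_ph _ _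
  have hL2 : ∫⁻ x, ‖BL F G l x‖ₑ ^ 2 ≤ ENNReal.ofReal (16 * π ^ 2 * 2 ^ l * W) := by
    have h := bil_L2 (DL l) (DL_meas l) (((2:ℝ)⁻¹) ^ (l + 1)) (by positivity) (fun z hz => ⟨hz.1.1, hz.1.2, hz.2.1.le⟩)
      (fun z => F z.1 * G z.2) (by fun_prop) (fun z => by rw [norm_mul]; exact mul_le_one₀ (hF.bd _) (norm_nonneg _) (hG.bd _))
    refine h.trans ((mul_le_mul_right hmass _).trans (le_of_eq ?_))
    rw [← ENNReal.ofReal_mul (by positivity)]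
    congr 1
    rw [← hW, inv_pow, pow_succ]; field_simp; try ring
  rw [← ENNReal.ofReal_rpow_of_pos (by positivity)]
  apply ENNReal.rpow_le_rpow _ (by positivity)
  calc ∫⁻ x, ‖BL F G l x‖ₑ ^ p ≤ ∫⁻ x, ENNReal.ofReal W ^ (p - 2) * ‖BL F G l x‖ₑ ^ 2 := by
        refine lintegral_mono fun x => ?_
        conv_lhs => rw [show p = (p - 2) + 2 by ring, ENNReal.rpow_add_of_nonneg _ _ (by linarith) (by norm_num), ENNReal.rpow_two]
        exact mul_le_mul_left (ENNReal.rpow_le_rpow (hinf x) (by linarith)) _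
    _ = ENNReal.ofReal W ^ (p - 2) * ∫⁻ x, ‖BL F G l x‖ₑ ^ 2 :=
        lintegral_const_mul _ ((BL_meas hF.meas hG.meas l).enorm.pow_const 2)
    _ ≤ ENNReal.ofReal W ^ (p - 2) * ENNReal.ofReal (16 * π ^ 2 * 2 ^ l * W) := by gcongr
    _ = _ := by
        rw [ENNReal.ofReal_rpow_of_pos hW0, ← ENNReal.ofReal_mul (by positivity)]
        congr 1
        rw [show p - 1 = (p - 2) + 1 by ring, Real.rpow_add hW0, Real.rpow_one]; ring

theorem bil_arith (l : ℕ) (m M p : ℝ) (hp : 2 < p) (hm : 0 < m) (hM : 0 < M) :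
    (16 * π ^ 2 * 2 ^ l * (5 * π * (m * min M (((2:ℝ)⁻¹) ^ l))) ^ (p - 1)) ^ (1 / p) ≤
      (16 * π ^ 2 * (5 * π) ^ (p - 1)) ^ (1 / p) * (m ^ (1 - 1 / p) * M ^ (1 - 2 / p)) *
        min (((2:ℝ) ^ (((l:ℤ):ℝ) * 1) * M) ^ (1 / p)) (((2:ℝ) ^ (((l:ℤ):ℝ) * 1) * M) ^ (-(1 - 2 / p))) := by
  have hp0 : 0 < p := by linarith
  have e2 : (2:ℝ) ^ (((l:ℤ):ℝ) * 1) = 2 ^ l := by rw [mul_one]; simp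
  rw [e2, inv_pow]
  set A : ℝ := 2 ^ l with hA
  have hA0 : 0 < A := by positivity
  have exx : (p - 1) * (1 / p) = 1 - 1 / p := by field_simp
  have gen : ∀ X, 0 < X → (16 * π ^ 2 * A * (5 * π * (m * X)) ^ (p - 1)) ^ (1 / p) =
      (16 * π ^ 2 * (5 * π) ^ (p - 1)) ^ (1 / p) * (m ^ (1 - 1 / p) * (A ^ (1 / p) * X ^ (1 - 1 / p))) := by
    intro X hX
    rw [← exx, Real.rpow_mul hm.le, Real.rpow_mul hX.le, ← Real.mul_rpow (by positivity) (by positivity),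
      ← Real.mul_rpow (by positivity) (by positivity), ← Real.mul_rpow (by positivity) (by positivity)]
    congr 1
    rw [Real.mul_rpow (x := 5 * π) (y := m * X) (by positivity) (by positivity), Real.mul_rpow hm.le hX.le]; ring
  rw [mul_min_of_nonneg ((A * M) ^ (1 / p)) ((A * M) ^ (-(1 - 2 / p))) (by positivity)]
  apply le_min
  · calc _ ≤ (16 * π ^ 2 * A * (5 * π * (m * M)) ^ (p - 1)) ^ (1 / p) := by
          gcongr
          · linarith
          · exact min_le_left _ _
      _ = _ := by
          rw [gen M hM, Real.mul_rpow hA0.le hM.le]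
          have : M ^ (1 - 1 / p) = M ^ (1 - 2 / p) * M ^ (1 / p) := by
            rw [← Real.rpow_add hM]; congr 1; ring
          rw [this]; ring
  · calc _ ≤ (16 * π ^ 2 * A * (5 * π * (m * A⁻¹)) ^ (p - 1)) ^ (1 / p) := by
          gcongr
          · linarith
          · exact min_le_right _ _
      _ = _ := by
          rw [gen A⁻¹ (by positivity), Real.mul_rpow hA0.le hM.le, Real.rpow_neg hM.le]
          have h1 : M ^ (1 - 2 / p) ≠ 0 := by positivity
          have : A ^ (-(1 - 2 / p)) = A ^ (1 / p) * A⁻¹ ^ (1 - 1 / p) := by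
            rw [← Real.rpow_neg_eq_inv_rpow, ← Real.rpow_add hA0]; congr 1; ring
          rw [this]; field_simp

theorem BIL (p : ℝ) (hp : 2 < p) : ∃ C : ℝ, 0 < C ∧ ∀ (F G : ℝ → ℂ) (m M : ℝ), 0 < m → 0 < M → SubF F m → SubF G M →
    (∫⁻ x, (‖IE F x‖ₑ * ‖IE G x‖ₑ) ^ p) ^ (1 / p) ≤ ENNReal.ofReal (C * (m ^ (1 - 1 / p) * M ^ (1 - 2 / p))) := by
  have hp0 : 0 < p := by linarith
  have h2p : 0 < 1 - 2 / p := by rw [sub_pos, div_lt_one hp0]; exact hp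
  obtain ⟨C, hC, hgeo⟩ := geo_sum 1 (1 / p) (1 - 2 / p) one_pos (by positivity) h2p
  set K : ℝ := (16 * π ^ 2 * (5 * π) ^ (p - 1)) ^ (1 / p) with hK
  have hK0 : 0 < K := by positivity
  refine ⟨K * C, by positivity, fun F G m M hm hM hF hG => ?_⟩
  calc (∫⁻ x, (‖IE F x‖ₑ * ‖IE G x‖ₑ) ^ p) ^ (1 / p) ≤ (∫⁻ x, (∑' l, ‖BL F G l x‖ₑ) ^ p) ^ (1 / p) := by
        gcongr with x
        exact prod_le_BL hF hG x
    _ ≤ ∑' l, (∫⁻ x, ‖BL F G l x‖ₑ ^ p) ^ (1 / p) := mink_tsum _ p (by linarith) _ (fun l => (BL_meas hF.meas hG.meas l).enorm)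
    _ ≤ ∑' l : ℕ, ENNReal.ofReal (K * (m ^ (1 - 1 / p) * M ^ (1 - 2 / p))) *
          (fun j : ℤ => ENNReal.ofReal (min (((2:ℝ) ^ ((j:ℝ) * 1) * M) ^ (1 / p)) (((2:ℝ) ^ ((j:ℝ) * 1) * M) ^ (-(1 - 2 / p))))) (l : ℤ) := by
        refine ENNReal.tsum_le_tsum fun l => (BL_Lp hp hm hM hF hG l).trans ?_
        rw [← ENNReal.ofReal_mul (by positivity)]
        exact ENNReal.ofReal_le_ofReal (bil_arith l m M p hp hm hM)
    _ ≤ ENNReal.ofReal (K * (m ^ (1 - 1 / p) * M ^ (1 - 2 / p))) * ENNReal.ofReal C := by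
        rw [ENNReal.tsum_mul_left]
        gcongr
        exact (ENNReal.tsum_comp_le_tsum_of_injective Nat.cast_injective _).trans (hgeo M hM)
    _ = _ := by
        rw [← ENNReal.ofReal_mul (by positivity)]; congr 1; ring

/-- restricted Zygmund -/
theorem ZYG (q : ℝ) (hq : 4 < q) : ∃ C : ℝ, 0 < C ∧ ∀ (F : ℝ → ℂ) (m : ℝ), 0 < m → SubF F m →
    (∫⁻ x, ‖IE F x‖ₑ ^ q) ^ (1 / q) ≤ ENNReal.ofReal (C * m ^ (1 - 3 / q)) := by
  obtain ⟨C, hC, h⟩ := BIL (q / 2) (by linarith)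
  refine ⟨C ^ (1 / 2 : ℝ), by positivity, fun F m hm hF => ?_⟩
  have h1 := h F F m m hm hm hF hF
  have e : ∀ x, (‖IE F x‖ₑ * ‖IE F x‖ₑ) ^ (q / 2) = ‖IE F x‖ₑ ^ q := by
    intro x
    rw [← pow_two, ← ENNReal.rpow_two, ← ENNReal.rpow_mul]; congr 1; ring
  simp_rw [e] at h1
  have h2 := ENNReal.rpow_le_rpow h1 (show (0:ℝ) ≤ 1 / 2 by norm_num)
  rw [← ENNReal.rpow_mul, show 1 / (q / 2) * (1 / 2) = 1 / q by field_simp] at h2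
  refine h2.trans (le_of_eq ?_)
  rw [ENNReal.ofReal_rpow_of_pos (by positivity)]
  congr 1
  rw [← Real.rpow_add hm, Real.mul_rpow hC.le (by positivity), ← Real.rpow_mul hm.le]
  congr 2
  field_simp; ring


def hh (r : ℝ) (j : ℤ) (x : ℝ) : ℝ := min (2 * x / 2 ^ (j:ℝ)) ((2 * x / 2 ^ (j:ℝ)) ^ (r + 1))

theorem hh_meas (r : ℝ) (j : ℤ) : Measurable (hh r j) := by
  unfold hh; fun_prop

theorem hh_nonneg (r : ℝ) (j : ℤ) {x : ℝ} (hx : 0 ≤ x) : 0 ≤ hh r j x := by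
  unfold hh; positivity

theorem hh_half (r : ℝ) (hr : 0 < r) (j : ℤ) {x : ℝ} (hx : 0 ≤ x) : hh r (j + 1) x ≤ 1 / 2 * hh r j x := by
  unfold hh
  have e : 2 * x / 2 ^ (((j + 1 : ℤ)) : ℝ) = 1 / 2 * (2 * x / 2 ^ (j:ℝ)) := by
    push_cast; rw [Real.rpow_add two_pos, Real.rpow_one]; field_simp
  rw [e]
  set y := 2 * x / 2 ^ (j:ℝ)
  have hy : 0 ≤ y := by positivity
  rw [mul_min_of_nonneg _ _ (by norm_num : (0:ℝ) ≤ 1 / 2)]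
  apply min_le_min le_rfl
  rw [Real.mul_rpow (by norm_num) hy]
  gcongr
  calc ((1:ℝ) / 2) ^ (r + 1) ≤ (1 / 2) ^ (1:ℝ) :=
        Real.rpow_le_rpow_of_exponent_ge (by norm_num) (by norm_num) (by linarith)
    _ = _ := Real.rpow_one _

def lev (F : ℝ → ℂ) (j : ℤ) (φ : ℝ) : ℂ :=
  if j = ⌊Real.logb 2 ‖F φ‖⌋ + 1 then F φ / ((2 ^ (j:ℝ) : ℝ) : ℂ) else 0

theorem lev_meas {F : ℝ → ℂ} (hF : Measurable F) (j : ℤ) : Measurable (lev F j) := by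
  unfold lev
  have : Measurable fun φ => ⌊Real.logb 2 ‖F φ‖⌋ + 1 := by
    have h : Measurable fun φ => Real.logb 2 ‖F φ‖ := by
      unfold Real.logb; exact (Real.measurable_log.comp hF.norm).div_const _
    exact (Int.measurable_floor.comp h).add_const 1
  refine Measurable.ite ?_ (hF.div_const _) measurable_const
  have h2 := this (measurableSet_singleton j)
  convert h2 using 1
  ext φ; simp [eq_comm]

theorem lev_bds {F : ℝ → ℂ} {j : ℤ} {φ : ℝ} (h : lev F j φ ≠ 0) :
    ‖F φ‖ < 2 ^ (j:ℝ) ∧ (2:ℝ) ^ (j:ℝ) ≤ 2 * ‖F φ‖ := by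
  unfold lev at h
  split_ifs at h with hj
  · have hF : F φ ≠ 0 := by rintro h0; simp [h0] at h
    have hp : 0 < ‖F φ‖ := norm_pos_iff.2 hF
    have e : (j:ℝ) = (⌊Real.logb 2 ‖F φ‖⌋ : ℝ) + 1 := by rw [hj]; push_cast; rfl
    constructor
    · rw [← Real.logb_lt_iff_lt_rpow one_lt_two hp, e]; exact Int.lt_floor_add_one _
    · rw [e, Real.rpow_add two_pos, Real.rpow_one, mul_comm]
      have := (Real.le_logb_iff_rpow_le one_lt_two hp).1 (Int.floor_le (Real.logb 2 ‖F φ‖))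
      linarith
  · exact absurd rfl h

theorem lev_sub {F : ℝ → ℂ} (hF : Measurable F) (r : ℝ) (hr : 0 < r) (j : ℤ) (ν : ℝ)
    (hν : ∫⁻ φ, ENNReal.ofReal (hh r j ‖F φ‖) ∂mu0 = ENNReal.ofReal ν) : SubF (lev F j) ν := by
  refine ⟨lev_meas hF j, fun φ => ?_, ?_⟩
  · by_cases h : lev F j φ = 0
    · simp [h]
    · have hb := lev_bds h
      unfold lev at h ⊢
      split_ifs at h ⊢ with hj
      · rw [norm_div, Complex.norm_real, Real.norm_of_nonneg (by positivity), div_le_one (by positivity)]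
        exact hb.1.le
      · simp
  · rw [← hν]
    have hs : MeasurableSet {φ | lev F j φ ≠ 0} := ((lev_meas hF j) (measurableSet_singleton 0)).compl
    rw [← lintegral_indicator_one hs]
    refine lintegral_mono fun φ => ?_
    by_cases hφ : lev F j φ = 0
    · rw [indicator_of_notMem (by simpa using hφ)]; exact zero_le
    · rw [indicator_of_mem (by exact hφ), Pi.one_apply]
      have hb := (lev_bds hφ).2
      rw [← ENNReal.ofReal_one]
      apply ENNReal.ofReal_le_ofReal
      have : 1 ≤ 2 * ‖F φ‖ / 2 ^ (j:ℝ) := by rwa [one_le_div (by positivity)]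
      exact le_min this (Real.one_le_rpow this (by linarith))

theorem lev_tsum (F : ℝ → ℂ) (φ : ℝ) : ∑' j : ℤ, ((2 ^ (j:ℝ) : ℝ) : ℂ) * lev F j φ = F φ := by
  rw [tsum_eq_single (⌊Real.logb 2 ‖F φ‖⌋ + 1)]
  · unfold lev; rw [if_pos rfl, mul_div_cancel₀]
    exact Complex.ofReal_ne_zero.2 (by positivity)
  · intro j hj; unfold lev; rw [if_neg hj, mul_zero]

theorem lev_tsum' (F : ℝ → ℂ) (φ : ℝ) : ∑' j : ℤ, ‖((2 ^ (j:ℝ) : ℝ) : ℂ) * lev F j φ‖ₑ = ‖F φ‖ₑ := by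
  rw [tsum_eq_single (⌊Real.logb 2 ‖F φ‖⌋ + 1)]
  · unfold lev; rw [if_pos rfl, mul_div_cancel₀]
    exact Complex.ofReal_ne_zero.2 (by positivity)
  · intro j hj; unfold lev; rw [if_neg hj, mul_zero]; simp

theorem lev_IE {F : ℝ → ℂ} (hF : Measurable F) (hi : ∫⁻ φ, ‖F φ‖ₑ ∂mu0 ≠ ∞) (p : ℝ × ℝ) :
    ‖IE F p‖ₑ ≤ ∑' j : ℤ, ENNReal.ofReal (2 ^ (j:ℝ)) * ‖IE (lev F j) p‖ₑ := by
  have hlm := fun j => lev_meas hF j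
  have e : IE F p = ∑' j : ℤ, ((2 ^ (j:ℝ) : ℝ) : ℂ) * IE (lev F j) p := by
    unfold IE
    simp_rw [← integral_const_mul]
    rw [← integral_tsum]
    · congr 1; ext φ
      conv_lhs => rw [← lev_tsum F φ, ← tsum_mul_right]
      simp_rw [mul_assoc]
    · intro j
      exact (by fun_prop : Measurable _).aestronglyMeasurable
    · rw [← lintegral_tsum]
      · refine ne_of_eq_of_ne ?_ hi
        refine lintegral_congr fun φ => ?_
        rw [← lev_tsum' F φ]
        refine tsum_congr fun j => ?_
        rw [← mul_assoc, enorm_ph]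
      · intro j
        exact (by fun_prop : Measurable _).aemeasurable
  rw [e]
  refine enorm_tsum_le_tsum_enorm.trans (le_of_eq (tsum_congr fun j => ?_))
  rw [enorm_mul]
  congr 1
  rw [← ofReal_norm, Complex.norm_real, Real.norm_of_nonneg (by positivity)]

theorem hh_sum (r : ℝ) (hr : 1 < r) : ∃ C, 0 < C ∧ ∀ x : ℝ, 0 ≤ x →
    ∑' j : ℤ, ENNReal.ofReal (2 ^ ((j:ℝ) * r) * hh r j x) ≤ ENNReal.ofReal (C * x ^ r) := by
  obtain ⟨C, hC, hg⟩ := geo_sum 1 (r - 1) 1 one_pos (by linarith) one_pos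
  refine ⟨C * 2 ^ r, by positivity, fun x hx => ?_⟩
  rcases hx.eq_or_lt with rfl | hx
  · have : ∀ j, hh r j 0 = 0 := fun j => by unfold hh; rw [mul_zero, zero_div, Real.zero_rpow (by linarith)]; simp
    simp [this]
  · have key : ∀ j : ℤ, 2 ^ ((j:ℝ) * r) * hh r j x =
        (2 * x) ^ r * min (((2:ℝ)^((j:ℝ)*1)*(2*x)⁻¹)^(r-1)) (((2:ℝ)^((j:ℝ)*1)*(2*x)⁻¹)^(-1:ℝ)) := by
      intro j
      unfold hh
      rw [mul_one, Real.rpow_mul two_pos.le]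
      set A : ℝ := 2 ^ (j:ℝ)
      have hA : 0 < A := by positivity
      have hX : 0 < 2 * x := by positivity
      generalize 2 * x = X at hX
      rw [mul_min_of_nonneg _ _ (by positivity), mul_min_of_nonneg _ _ (by positivity)]
      congr 1
      · rw [Real.mul_rpow hA.le (by positivity), Real.inv_rpow hX.le, Real.rpow_sub hA, Real.rpow_sub hX, Real.rpow_one, Real.rpow_one]
        have : X ^ r ≠ 0 := by positivity
        field_simp
      · rw [Real.rpow_neg (by positivity), Real.rpow_one, Real.div_rpow hX.le hA.le, Real.rpow_add hX, Real.rpow_add hA, Real.rpow_one, Real.rpow_one]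
        have : A ^ r ≠ 0 := by positivity
        field_simp
    simp_rw [key]
    have : ∀ j : ℤ, ENNReal.ofReal ((2 * x) ^ r * min (((2:ℝ)^((j:ℝ)*1)*(2*x)⁻¹)^(r-1)) (((2:ℝ)^((j:ℝ)*1)*(2*x)⁻¹)^(-1:ℝ)))
      = ENNReal.ofReal ((2 * x) ^ r) * ENNReal.ofReal (min (((2:ℝ)^((j:ℝ)*1)*(2*x)⁻¹)^(r-1)) (((2:ℝ)^((j:ℝ)*1)*(2*x)⁻¹)^(-1:ℝ))) :=
      fun j => ENNReal.ofReal_mul (by positivity)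
    simp_rw [this]
    rw [ENNReal.tsum_mul_left]
    refine (mul_le_mul_right (hg (2 * x)⁻¹ (by positivity)) _).trans (le_of_eq ?_)
    rw [← ENNReal.ofReal_mul (by positivity), Real.mul_rpow two_pos.le hx.le]
    congr 1; ring

theorem L1_of_Lr {F : ℝ → ℂ} (r : ℝ) (hr : 1 < r) (hi : ∫⁻ φ, ‖F φ‖ₑ ^ r ∂mu0 ≠ ∞) : ∫⁻ φ, ‖F φ‖ₑ ∂mu0 ≠ ∞ := by
  refine ne_top_of_le_ne_top (b := ∫⁻ φ, (1 + ‖F φ‖ₑ ^ r) ∂mu0) ?_ (lintegral_mono fun φ => ?_)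
  · rw [lintegral_add_left measurable_const]
    simp only [lintegral_const, one_mul]
    exact ENNReal.add_ne_top.2 ⟨measure_ne_top _ _, hi⟩
  · rcases le_total ‖F φ‖ₑ 1 with h | h
    · exact h.trans le_self_add
    · refine le_trans ?_ le_add_self
      conv_lhs => rw [← ENNReal.rpow_one ‖F φ‖ₑ]
      exact ENNReal.rpow_le_rpow_of_exponent_le h hr.le

theorem LEVEL (r : ℝ) (hr : 1 < r) : ∃ C, 0 < C ∧ ∀ F : ℝ → ℂ, Measurable F → ∫⁻ φ, ‖F φ‖ₑ ^ r ∂mu0 ≠ 0 →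
    ∫⁻ φ, ‖F φ‖ₑ ^ r ∂mu0 ≠ ∞ → ∃ (f : ℤ → ℝ → ℂ) (ν : ℤ → ℝ), (∀ j, 0 < ν j) ∧ (∀ j, ν (j + 1) ≤ 1 / 2 * ν j) ∧
      (∀ j, SubF (f j) (ν j)) ∧ (∀ p, ‖IE F p‖ₑ ≤ ∑' j : ℤ, ENNReal.ofReal (2 ^ (j:ℝ)) * ‖IE (f j) p‖ₑ) ∧
      ∑' j : ℤ, ENNReal.ofReal (2 ^ ((j:ℝ) * r) * ν j) ≤ ENNReal.ofReal C * ∫⁻ φ, ‖F φ‖ₑ ^ r ∂mu0 := by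
  obtain ⟨C, hC, hs⟩ := hh_sum r hr
  refine ⟨C, hC, fun F hF h0 hi => ?_⟩
  have hL1 := L1_of_Lr r hr hi
  have hm : ∀ j, Measurable fun φ => ENNReal.ofReal (hh r j ‖F φ‖) := fun j =>
    ENNReal.measurable_ofReal.comp ((hh_meas r j).comp hF.norm)
  have fin : ∀ j, ∫⁻ φ, ENNReal.ofReal (hh r j ‖F φ‖) ∂mu0 ≠ ∞ := by
    intro j
    refine ne_top_of_le_ne_top (b := ∫⁻ φ, ENNReal.ofReal (2 / 2 ^ (j:ℝ)) * ‖F φ‖ₑ ∂mu0) ?_ (lintegral_mono fun φ => ?_)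
    · rw [lintegral_const_mul _ hF.enorm]
      exact ENNReal.mul_ne_top ENNReal.ofReal_ne_top hL1
    · rw [← ofReal_norm (F φ), ← ENNReal.ofReal_mul (by positivity)]
      apply ENNReal.ofReal_le_ofReal
      refine (min_le_left _ _).trans (le_of_eq (by ring))
  have hev : ∀ j, ∫⁻ φ, ENNReal.ofReal (hh r j ‖F φ‖) ∂mu0 = ENNReal.ofReal (∫⁻ φ, ENNReal.ofReal (hh r j ‖F φ‖) ∂mu0).toReal :=
    fun j => (ENNReal.ofReal_toReal (fin j)).symm
  refine ⟨lev F, fun j => (∫⁻ φ, ENNReal.ofReal (hh r j ‖F φ‖) ∂mu0).toReal, fun j => ?_, fun j => ?_, fun j => ?_, ?_, ?_⟩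
  · refine ENNReal.toReal_pos (fun h => h0 ?_) (fin j)
    rw [lintegral_eq_zero_iff (hm j)] at h
    rw [lintegral_eq_zero_iff (by fun_prop)]
    filter_upwards [h] with φ hφ
    simp only [Pi.zero_apply, ENNReal.ofReal_eq_zero] at hφ ⊢
    by_contra hne
    have hp : 0 < ‖F φ‖ := by
      apply norm_pos_iff.2
      rintro h0; apply hne; rw [h0]; simp; linarith
    have : 0 < hh r j ‖F φ‖ := by unfold hh; positivity
    linarith
  · rw [show (1 / 2 : ℝ) = (ENNReal.ofReal (1 / 2)).toReal by rw [ENNReal.toReal_ofReal]; norm_num, ← ENNReal.toReal_mul]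
    apply ENNReal.toReal_mono (ENNReal.mul_ne_top ENNReal.ofReal_ne_top (fin j))
    rw [← lintegral_const_mul _ (hm j)]
    refine lintegral_mono fun φ => ?_
    rw [← ENNReal.ofReal_mul (by norm_num)]
    exact ENNReal.ofReal_le_ofReal (hh_half r (by linarith) j (norm_nonneg _))
  · exact lev_sub hF r (by linarith) j _ (hev j)
  · exact lev_IE hF hL1
  · calc _ = ∑' j : ℤ, ∫⁻ φ, ENNReal.ofReal (2 ^ ((j:ℝ) * r) * hh r j ‖F φ‖) ∂mu0 := by
          refine tsum_congr fun j => ?_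
          rw [ENNReal.ofReal_mul (by positivity), ← hev j, ← lintegral_const_mul _ (hm j)]
          refine lintegral_congr fun φ => ?_
          rw [ENNReal.ofReal_mul (by positivity)]
      _ = ∫⁻ φ, ∑' j : ℤ, ENNReal.ofReal (2 ^ ((j:ℝ) * r) * hh r j ‖F φ‖) ∂mu0 := by
          rw [lintegral_tsum]
          intro j
          exact (ENNReal.measurable_ofReal.comp (((hh_meas r j).comp hF.norm).const_mul _)).aemeasurable
      _ ≤ ∫⁻ φ, ENNReal.ofReal C * ‖F φ‖ₑ ^ r ∂mu0 := by
          refine lintegral_mono fun φ => (hs _ (norm_nonneg _)).trans (le_of_eq ?_)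
          rw [ENNReal.ofReal_mul hC.le, ← ofReal_norm (F φ), ENNReal.ofReal_rpow_of_nonneg (norm_nonneg _) (by linarith)]
      _ = _ := by rw [lintegral_const_mul _ (by fun_prop)]


theorem jensen_tsum {ι : Type*} [Countable ι] (q : ℝ) (hq : 1 < q) (w b : ι → ℝ≥0∞) :
    (∑' j, w j * b j) ^ q ≤ (∑' j, w j) ^ (q - 1) * ∑' j, w j * b j ^ q := by
  let _ : MeasurableSpace ι := ⊤
  have hq0 : 0 < q := by linarith
  have hc := Real.HolderConjugate.conjExponent hq
  set q' := Real.conjExponent q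
  have hq'0 : 0 < q' := hc.symm.pos
  have H := ENNReal.lintegral_mul_le_Lp_mul_Lq (Measure.count : Measure ι) hc.symm
    (f := fun j => w j ^ (1 / q')) (g := fun j => w j ^ (1 / q) * b j)
    (measurable_from_top).aemeasurable (measurable_from_top).aemeasurable
  simp only [Pi.mul_apply] at H
  rw [lintegral_count, lintegral_count, lintegral_count] at H
  have e1 : ∀ j, w j ^ (1 / q') * (w j ^ (1 / q) * b j) = w j * b j := by
    intro j
    rw [← mul_assoc, ← ENNReal.rpow_add_of_nonneg _ _ (by positivity) (by positivity)]
    have : 1 / q' + 1 / q = 1 := by have := hc.symm.inv_add_inv_eq_one; simpa [one_div] using this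
    rw [this, ENNReal.rpow_one]
  have e2 : ∀ j, (w j ^ (1 / q')) ^ q' = w j := by
    intro j; rw [← ENNReal.rpow_mul, one_div_mul_cancel hq'0.ne', ENNReal.rpow_one]
  have e3 : ∀ j, (w j ^ (1 / q) * b j) ^ q = w j * b j ^ q := by
    intro j; rw [ENNReal.mul_rpow_of_nonneg _ _ hq0.le, ← ENNReal.rpow_mul, one_div_mul_cancel hq0.ne', ENNReal.rpow_one]
  simp_rw [e1, e2, e3] at H
  have H2 := ENNReal.rpow_le_rpow H hq0.le
  refine H2.trans (le_of_eq ?_)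
  rw [ENNReal.mul_rpow_of_nonneg _ _ hq0.le, ← ENNReal.rpow_mul, ← ENNReal.rpow_mul, one_div_mul_cancel hq0.ne', ENNReal.rpow_one]
  congr 2
  have : 1 / q' = 1 - 1 / q := by have := hc.symm.inv_add_inv_eq_one; simp only [one_div]; linarith
  rw [this]; field_simp

theorem seq_schur (q : ℝ) (hq : 1 < q) (w : ℕ → ℤ → ℝ≥0∞) (b : ℤ → ℝ≥0∞) (A B : ℝ≥0∞)
    (hA : ∀ k, ∑' j, w k j ≤ A) (hB : ∀ j, ∑' k, w k j ≤ B) :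
    ∑' k, (∑' j, w k j * b j) ^ q ≤ A ^ (q - 1) * (B * ∑' j, b j ^ q) := by
  calc ∑' k, (∑' j, w k j * b j) ^ q ≤ ∑' k, A ^ (q - 1) * ∑' j, w k j * b j ^ q := by
        refine ENNReal.tsum_le_tsum fun k => (jensen_tsum q hq (w k) b).trans ?_
        exact mul_le_mul_left (ENNReal.rpow_le_rpow (hA k) (by linarith)) _
    _ = A ^ (q - 1) * ∑' j, (∑' k, w k j) * b j ^ q := by
        rw [ENNReal.tsum_mul_left, ENNReal.tsum_comm]
        simp_rw [ENNReal.tsum_mul_right]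
    _ ≤ A ^ (q - 1) * ∑' j, B * b j ^ q := by
        gcongr with j
        exact hB j
    _ = _ := by rw [ENNReal.tsum_mul_left]

theorem lr_lq {ι : Type*} (r q : ℝ) (hr : 0 < r) (hrq : r ≤ q) (b : ι → ℝ≥0∞) :
    ∑' j, b j ^ q ≤ (∑' j, b j ^ r) ^ (q / r) := by
  set S := ∑' j, b j ^ r with hS
  have hb : ∀ j, b j ≤ S ^ (1 / r) := by
    intro j
    have := ENNReal.rpow_le_rpow (ENNReal.le_tsum (f := fun j => b j ^ r) j) (show 0 ≤ 1 / r by positivity)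
    simpa [← ENNReal.rpow_mul, hr.ne'] using this
  have h1 : 1 ≤ q / r := by rwa [one_le_div hr]
  calc ∑' j, b j ^ q ≤ ∑' j, b j ^ r * S ^ (q / r - 1) := by
        refine ENNReal.tsum_le_tsum fun j => ?_
        rw [show q = r + (q - r) by ring, ENNReal.rpow_add_of_nonneg _ _ hr.le (by linarith)]
        gcongr
        refine (ENNReal.rpow_le_rpow (hb j) (by linarith)).trans (le_of_eq ?_)
        rw [← ENNReal.rpow_mul]
        congr 1
        field_simp; ring
    _ = S ^ (1:ℝ) * S ^ (q / r - 1) := by rw [ENNReal.tsum_mul_right, ENNReal.rpow_one]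
    _ = _ := by
        rw [← ENNReal.rpow_add_of_nonneg _ _ zero_le_one (by linarith)]; congr 1; ring

theorem INTERP (γ r q b η C0 : ℝ) (hr : 1 < r) (hrq : r ≤ q) (hb : 0 < b) (hη : 0 < η) (hC0 : 0 < C0)
    (hyp : ∀ (k : ℕ) (F : ℝ → ℂ) (m : ℝ), 0 < m → SubF F m →
      ENNReal.ofReal (2 ^ (-((k:ℝ) * γ))) * (∫⁻ p in AK k, ‖IE F p‖ₑ ^ q) ^ (1 / q) ≤
        ENNReal.ofReal (C0 * (m ^ (1 / r) * min (((2:ℝ) ^ ((k:ℝ) * b) * m) ^ η) (((2:ℝ) ^ ((k:ℝ) * b) * m) ^ (-η))))) :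
    ∃ C, 0 < C ∧ ∀ F : ℝ → ℂ, Measurable F → ∫⁻ φ, ‖F φ‖ₑ ^ r ∂mu0 ≠ 0 → ∫⁻ φ, ‖F φ‖ₑ ^ r ∂mu0 ≠ ∞ →
      ∑' k : ℕ, ENNReal.ofReal (2 ^ (-((k:ℝ) * γ))) ^ q * ∫⁻ p in AK k, ‖IE F p‖ₑ ^ q ≤
        ENNReal.ofReal C * (∫⁻ φ, ‖F φ‖ₑ ^ r ∂mu0) ^ (q / r) := by
  obtain ⟨C1, hC1, hlev⟩ := LEVEL r hr
  obtain ⟨C2, hC2, hgeo⟩ := geo_sum b η η hb hη hη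
  have hq : 1 < q := by linarith
  have hq0 : 0 < q := by linarith
  have hr0 : 0 < r := by linarith
  set ρ : ℝ := (1 / 2) ^ η with hρ
  have hρ0 : 0 < ρ := by positivity
  have hρ1 : ρ < 1 := Real.rpow_lt_one (by norm_num) (by norm_num) hη
  set A : ℝ := 4 / (1 - ρ) with hA
  have hA0 : 0 < A := by have : 0 < 1 - ρ := by linarith
                         positivity
  refine ⟨C0 ^ q * (A ^ (q - 1) * (C2 * C1 ^ (q / r))), by positivity, fun F hF h0 hi => ?_⟩
  obtain ⟨f, ν, hν, hhalf, hsub, hIE, hsum⟩ := hlev F hF h0 hi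
  set bb : ℤ → ℝ≥0∞ := fun j => ENNReal.ofReal (2 ^ (j:ℝ) * ν j ^ (1 / r)) with hbb
  set w : ℕ → ℤ → ℝ≥0∞ := fun k j => ENNReal.ofReal (min (((2:ℝ) ^ ((k:ℝ) * b) * ν j) ^ η) (((2:ℝ) ^ ((k:ℝ) * b) * ν j) ^ (-η))) with hw
  have step : ∀ k : ℕ, ENNReal.ofReal (2 ^ (-((k:ℝ) * γ))) ^ q * ∫⁻ p in AK k, ‖IE F p‖ₑ ^ q ≤
      ENNReal.ofReal C0 ^ q * (∑' j, w k j * bb j) ^ q := by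
    intro k
    have e : ENNReal.ofReal (2 ^ (-((k:ℝ) * γ))) ^ q * ∫⁻ p in AK k, ‖IE F p‖ₑ ^ q =
        (ENNReal.ofReal (2 ^ (-((k:ℝ) * γ))) * (∫⁻ p in AK k, ‖IE F p‖ₑ ^ q) ^ (1 / q)) ^ q := by
      rw [ENNReal.mul_rpow_of_nonneg _ _ hq0.le, ← ENNReal.rpow_mul, one_div_mul_cancel hq0.ne', ENNReal.rpow_one]
    rw [e, ← ENNReal.mul_rpow_of_nonneg _ _ hq0.le]
    apply ENNReal.rpow_le_rpow _ hq0.le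
    calc ENNReal.ofReal (2 ^ (-((k:ℝ) * γ))) * (∫⁻ p in AK k, ‖IE F p‖ₑ ^ q) ^ (1 / q)
        ≤ ENNReal.ofReal (2 ^ (-((k:ℝ) * γ))) * (∫⁻ p in AK k, (∑' j : ℤ, ENNReal.ofReal (2 ^ (j:ℝ)) * ‖IE (f j) p‖ₑ) ^ q) ^ (1 / q) := by
          gcongr with p
          exact hIE p
      _ ≤ ENNReal.ofReal (2 ^ (-((k:ℝ) * γ))) * ∑' j : ℤ, (∫⁻ p in AK k, (ENNReal.ofReal (2 ^ (j:ℝ)) * ‖IE (f j) p‖ₑ) ^ q) ^ (1 / q) := by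
          gcongr
          exact mink_tsum _ q hq.le _ (fun j => (IE_meas (hsub j).meas).enorm.const_mul _)
      _ = ∑' j : ℤ, ENNReal.ofReal (2 ^ (j:ℝ)) * (ENNReal.ofReal (2 ^ (-((k:ℝ) * γ))) * (∫⁻ p in AK k, ‖IE (f j) p‖ₑ ^ q) ^ (1 / q)) := by
          rw [← ENNReal.tsum_mul_left]
          refine tsum_congr fun j => ?_
          simp_rw [ENNReal.mul_rpow_of_nonneg _ _ hq0.le]
          rw [lintegral_const_mul _ ((IE_meas (hsub j).meas).enorm.pow_const q),
            ENNReal.mul_rpow_of_nonneg _ _ (by positivity), ← ENNReal.rpow_mul, mul_one_div_cancel hq0.ne', ENNReal.rpow_one]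
          ring
      _ ≤ ∑' j : ℤ, ENNReal.ofReal C0 * (w k j * bb j) := by
          refine ENNReal.tsum_le_tsum fun j => (mul_le_mul_right (hyp k (f j) (ν j) (hν j) (hsub j)) _).trans (le_of_eq ?_)
          have := hν j
          rw [hw, hbb]
          simp only
          rw [← ENNReal.ofReal_mul (by positivity), ← ENNReal.ofReal_mul (by positivity), ← ENNReal.ofReal_mul (by positivity)]
          congr 1; ring
      _ = _ := by rw [ENNReal.tsum_mul_left]
  have hwA : ∀ k, ∑' j, w k j ≤ ENNReal.ofReal A := by
    intro k
    have := tele_sum (fun j => ((2:ℝ) ^ ((k:ℝ) * b) * ν j) ^ η) ρ hρ0 hρ1 (fun j => by have := hν j; positivity) (fun j => by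
      have := hν j
      have := hν (j + 1)
      rw [hρ, ← Real.mul_rpow (by norm_num) (by positivity)]
      apply Real.rpow_le_rpow (by positivity) _ hη.le
      have := mul_le_mul_of_nonneg_left (hhalf j) (show (0:ℝ) ≤ 2 ^ ((k:ℝ) * b) by positivity)
      linarith)
    refine le_trans (le_of_eq (tsum_congr fun j => ?_)) this
    have := hν j
    rw [hw]; simp only
    rw [Real.rpow_neg (by positivity)]
  have hwB : ∀ j, ∑' k, w k j ≤ ENNReal.ofReal C2 := by
    intro j
    refine le_trans ?_ (hgeo (ν j) (hν j))
    exact ENNReal.tsum_comp_le_tsum_of_injective (f := fun k : ℕ => (k : ℤ)) Nat.cast_injective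
      (fun i : ℤ => ENNReal.ofReal (min (((2:ℝ) ^ ((i:ℝ) * b) * ν j) ^ η) (((2:ℝ) ^ ((i:ℝ) * b) * ν j) ^ (-η))))
  have hbr : ∑' j, bb j ^ q ≤ (ENNReal.ofReal C1 * ∫⁻ φ, ‖F φ‖ₑ ^ r ∂mu0) ^ (q / r) := by
    refine (lr_lq r q hr0 hrq bb).trans (ENNReal.rpow_le_rpow (le_trans (le_of_eq (tsum_congr fun j => ?_)) hsum) (by positivity))
    have := hν j
    rw [hbb]; simp only
    rw [ENNReal.ofReal_rpow_of_pos (by positivity), Real.mul_rpow (by positivity) (by positivity),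
      ← Real.rpow_mul (by positivity), ← Real.rpow_mul this.le, one_div_mul_cancel hr0.ne', Real.rpow_one]
  calc _ ≤ ∑' k, ENNReal.ofReal C0 ^ q * (∑' j, w k j * bb j) ^ q := ENNReal.tsum_le_tsum step
    _ = ENNReal.ofReal C0 ^ q * ∑' k, (∑' j, w k j * bb j) ^ q := ENNReal.tsum_mul_left
    _ ≤ ENNReal.ofReal C0 ^ q * (ENNReal.ofReal A ^ (q - 1) * (ENNReal.ofReal C2 * (ENNReal.ofReal C1 * ∫⁻ φ, ‖F φ‖ₑ ^ r ∂mu0) ^ (q / r))) := by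
        gcongr
        refine (seq_schur q hq w bb _ _ hwA hwB).trans ?_
        gcongr
    _ = _ := by
        rw [ENNReal.mul_rpow_of_nonneg _ _ (by positivity), ENNReal.ofReal_rpow_of_pos hC0, ENNReal.ofReal_rpow_of_pos hA0,
          ENNReal.ofReal_rpow_of_pos hC1, ENNReal.ofReal_mul (by positivity), ENNReal.ofReal_mul (by positivity), ENNReal.ofReal_mul (by positivity)]
        ring


def LOC (q a e : ℝ) : Prop := ∃ C : ℝ, 0 < C ∧ ∀ (k : ℕ) (F : ℝ → ℂ) (m : ℝ), 0 < m → SubF F m →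
  (∫⁻ p in AK k, ‖IE F p‖ₑ ^ q) ^ (1 / q) ≤ ENNReal.ofReal (C * ((2:ℝ) ^ ((k:ℝ) * a) * m ^ e))

def STR (γ r q : ℝ) : Prop := ∃ C : ℝ, 0 < C ∧ ∀ F : ℝ → ℂ, Measurable F → ∫⁻ φ, ‖F φ‖ₑ ^ r ∂mu0 ≠ 0 → ∫⁻ φ, ‖F φ‖ₑ ^ r ∂mu0 ≠ ∞ →
      ∑' k : ℕ, ENNReal.ofReal (2 ^ (-((k:ℝ) * γ))) ^ q * ∫⁻ p in AK k, ‖IE F p‖ₑ ^ q ≤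
        ENNReal.ofReal C * (∫⁻ φ, ‖F φ‖ₑ ^ r ∂mu0) ^ (q / r)

theorem COMB (γ r q b η : ℝ) (hr : 1 < r) (hrq : r ≤ q) (hb : 0 < b) (hη : 0 < η)
    (h1 : LOC q (γ + b * η) (1 / r + η)) (h2 : LOC q (γ - b * η) (1 / r - η)) : STR γ r q := by
  obtain ⟨C1, hC1, h1⟩ := h1
  obtain ⟨C2, hC2, h2⟩ := h2
  refine INTERP γ r q b η (max C1 C2) hr hrq hb hη (by positivity) fun k F m hm hF => ?_
  rw [mul_min_of_nonneg _ _ (by positivity), mul_min_of_nonneg _ _ (by positivity)]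
  have hA : (0:ℝ) < 2 ^ ((k:ℝ) * b) := by positivity
  rw [ENNReal.ofReal_min]
  apply le_min
  · refine (mul_le_mul_right (h1 k F m hm hF) _).trans ?_
    rw [← ENNReal.ofReal_mul (by positivity)]
    apply ENNReal.ofReal_le_ofReal
    have e : (2:ℝ) ^ (-((k:ℝ) * γ)) * (C1 * ((2:ℝ) ^ ((k:ℝ) * (γ + b * η)) * m ^ (1 / r + η))) =
        C1 * (m ^ (1 / r) * ((2:ℝ) ^ ((k:ℝ) * b) * m) ^ η) := by
      rw [Real.mul_rpow hA.le hm.le, ← Real.rpow_mul two_pos.le, Real.rpow_add hm,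
        show (k:ℝ) * (γ + b * η) = k * γ + k * b * η by ring, Real.rpow_add two_pos, Real.rpow_neg two_pos.le]
      have : (2:ℝ) ^ ((k:ℝ) * γ) ≠ 0 := by positivity
      field_simp
    rw [e]
    gcongr
    exact le_max_left _ _
  · refine (mul_le_mul_right (h2 k F m hm hF) _).trans ?_
    rw [← ENNReal.ofReal_mul (by positivity)]
    apply ENNReal.ofReal_le_ofReal
    have e : (2:ℝ) ^ (-((k:ℝ) * γ)) * (C2 * ((2:ℝ) ^ ((k:ℝ) * (γ - b * η)) * m ^ (1 / r - η))) =
        C2 * (m ^ (1 / r) * ((2:ℝ) ^ ((k:ℝ) * b) * m) ^ (-η)) := by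
      rw [Real.mul_rpow hA.le hm.le, ← Real.rpow_mul two_pos.le, show 1 / r - η = 1 / r + -η by ring, Real.rpow_add hm,
        show (k:ℝ) * (γ - b * η) = k * γ + k * b * -η by ring, Real.rpow_add two_pos, Real.rpow_neg two_pos.le ((k:ℝ) * γ)]
      have : (2:ℝ) ^ ((k:ℝ) * γ) ≠ 0 := by positivity
      field_simp
    rw [e]
    gcongr
    exact le_max_right _ _

theorem AK_vol (k : ℕ) : volume (AK k) ≤ ENNReal.ofReal (16 * 4 ^ k) := by
  have : AK k ⊆ Icc (-(2:ℝ) ^ (k + 1)) (2 ^ (k + 1)) ×ˢ Icc (-(2:ℝ) ^ (k + 1)) (2 ^ (k + 1)) := by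
    rintro ⟨x, y⟩ ⟨-, h⟩
    simp only at h
    have hx := abs_nonneg x
    have hy := abs_nonneg y
    exact ⟨abs_le.1 (by simp only; linarith), abs_le.1 (by simp only; linarith)⟩
  refine (measure_mono this).trans (le_of_eq ?_)
  rw [Measure.volume_eq_prod, Measure.prod_prod, Real.volume_Icc, ← ENNReal.ofReal_mul (by rw [sub_neg_eq_add]; positivity)]
  congr 1
  rw [show (4:ℝ) = 2 ^ 2 by norm_num, ← pow_mul]; ring

theorem LOCA (q σ : ℝ) (hq : 0 < q) (hσ : 0 < σ) (h1 : σ ≤ 1 / q) (h2 : σ ≤ 1 / 2) :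
    LOC q (2 / q - σ) (1 - σ) := by
  obtain ⟨C, hC, hL⟩ := L2loc
  refine ⟨C ^ σ * 16 ^ (1 / q - σ), by positivity, fun k F m hm hF => ?_⟩
  have hσq : σ * q ≤ 1 := by rwa [le_div_iff₀ hq] at h1
  have hmeas := (IE_meas hF.meas).enorm
  have H := ENNReal.lintegral_mul_norm_pow_le (μ := volume.restrict (AK k)) (f := fun p => ‖IE F p‖ₑ ^ (2:ℝ)) (g := fun _ => 1)
    (hmeas.pow_const _).aemeasurable measurable_const.aemeasurable (p := σ * q) (q := 1 - σ * q) (by positivity) (by linarith) (by ring)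
  simp only [ENNReal.one_rpow, mul_one, lintegral_const, one_mul, Measure.restrict_apply MeasurableSet.univ, univ_inter] at H
  have hpt : ∀ p, ‖IE F p‖ₑ ^ q ≤ ENNReal.ofReal m ^ ((1 - 2 * σ) * q) * (‖IE F p‖ₑ ^ (2:ℝ)) ^ (σ * q) := by
    intro p
    have h0 : 0 ≤ (1 - 2 * σ) * q := mul_nonneg (by linarith) hq.le
    rw [← ENNReal.rpow_mul]
    conv_lhs => rw [show q = (1 - 2 * σ) * q + 2 * (σ * q) by ring, ENNReal.rpow_add_of_nonneg _ _ h0 (by positivity)]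
    exact mul_le_mul_left (ENNReal.rpow_le_rpow (hF.linf p) h0) _
  have tot : ∫⁻ p in AK k, ‖IE F p‖ₑ ^ q ≤ ENNReal.ofReal (m ^ ((1 - 2 * σ) * q) * ((C * 2 ^ k * m) ^ (σ * q) * (16 * 4 ^ k) ^ (1 - σ * q))) := by
    calc _ ≤ ∫⁻ p in AK k, ENNReal.ofReal m ^ ((1 - 2 * σ) * q) * (‖IE F p‖ₑ ^ (2:ℝ)) ^ (σ * q) := lintegral_mono fun p => hpt p
      _ = ENNReal.ofReal m ^ ((1 - 2 * σ) * q) * ∫⁻ p in AK k, (‖IE F p‖ₑ ^ (2:ℝ)) ^ (σ * q) :=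
        lintegral_const_mul _ ((hmeas.pow_const _).pow_const _)
      _ ≤ ENNReal.ofReal m ^ ((1 - 2 * σ) * q) * (ENNReal.ofReal (C * 2 ^ k * m) ^ (σ * q) * ENNReal.ofReal (16 * 4 ^ k) ^ (1 - σ * q)) := by
        refine mul_le_mul_right (H.trans (mul_le_mul' (ENNReal.rpow_le_rpow (hL k F m hF) (by positivity)) (ENNReal.rpow_le_rpow (AK_vol k) (by linarith)))) _
      _ = _ := by
        rw [ENNReal.ofReal_rpow_of_pos hm, ENNReal.ofReal_rpow_of_pos (by positivity), ENNReal.ofReal_rpow_of_pos (by positivity),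
          ← ENNReal.ofReal_mul (by positivity), ← ENNReal.ofReal_mul (by positivity)]
  refine (ENNReal.rpow_le_rpow tot (show 0 ≤ 1 / q by positivity)).trans (le_of_eq ?_)
  rw [ENNReal.ofReal_rpow_of_pos (by positivity)]
  congr 1
  rw [Real.mul_rpow (by positivity) (by positivity), Real.mul_rpow (by positivity) (by positivity), ← Real.rpow_mul hm.le,
    ← Real.rpow_mul (by positivity), ← Real.rpow_mul (by positivity)]
  rw [show (1 - 2 * σ) * q * (1 / q) = 1 - 2 * σ by field_simp, show σ * q * (1 / q) = σ by field_simp,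
    show (1 - σ * q) * (1 / q) = 1 / q - σ by field_simp]
  rw [Real.mul_rpow (by positivity) hm.le, Real.mul_rpow hC.le (by positivity), Real.mul_rpow (by norm_num) (by positivity),
    show (4:ℝ) ^ k = 2 ^ ((k:ℝ) * 2) by rw [Real.rpow_mul two_pos.le, Real.rpow_natCast, Real.rpow_two, ← pow_mul, mul_comm, pow_mul]; norm_num,
    ← Real.rpow_natCast 2 k, ← Real.rpow_mul two_pos.le, ← Real.rpow_mul two_pos.le]
  rw [show (k:ℝ) * (2 / q - σ) = k * σ + k * 2 * (1 / q - σ) by ring, Real.rpow_add two_pos,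
    show 1 - σ = (1 - 2 * σ) + σ by ring, Real.rpow_add hm]
  ring

theorem LOCB (q σ : ℝ) (hq : 0 < q) (h1 : 1 / q < σ) (h2 : σ < 3 / q) (h3 : σ + 1 / q < 1) :
    LOC q (3 / (2 * q) - σ / 2) (1 - σ) := by
  obtain ⟨C, hC, hL⟩ := L2loc
  set t := 1 / q with ht
  have ht0 : 0 < t := by positivity
  have h2' : σ < 3 * t := by rw [ht]; linarith [show 3 * (1 / q) = 3 / q by ring]
  have htq : t * q = 1 := by rw [ht]; field_simp
  set Q := 2 * (1 - 3 * t + σ) / (σ - t) with hQ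
  have hst : 0 < σ - t := by linarith
  have hQ4 : 4 < Q := by rw [hQ, lt_div_iff₀ hst]; linarith
  have hQ0 : 0 < Q := by linarith
  obtain ⟨C', hC', hZ⟩ := ZYG Q hQ4
  have hθ : 0 < 3 * t - σ := by linarith
  have hθ1 : 0 < 1 - 3 * t + σ := by linarith
  refine ⟨C ^ ((3 * t - σ) / 2) * C' ^ (1 - 3 * t + σ), by positivity, fun k F m hm hF => ?_⟩
  have hmeas := (IE_meas hF.meas).enorm
  have gen : ∀ a b : ℝ, 0 < a → 0 < b → 1 / (2 * a / b) * a = b / 2 := by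
    intro a b ha hb; field_simp
  have hQi : 1 / Q * (1 - 3 * t + σ) = (σ - t) / 2 := gen _ _ hθ1 hst
  have H := ENNReal.lintegral_mul_norm_pow_le (μ := volume.restrict (AK k)) (f := fun p => ‖IE F p‖ₑ ^ (2:ℝ)) (g := fun p => ‖IE F p‖ₑ ^ Q)
    (hmeas.pow_const _).aemeasurable (hmeas.pow_const _).aemeasurable (p := (3 * t - σ) * q / 2) (q := (σ - t) * q / 2)
    (by positivity) (by positivity) (by linear_combination htq)
  have ex : (2:ℝ) * ((3 * t - σ) * q / 2) + Q * ((σ - t) * q / 2) = q := by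
    rw [hQ]; field_simp; ring
  have e : ∀ p, (‖IE F p‖ₑ ^ (2:ℝ)) ^ ((3 * t - σ) * q / 2) * (‖IE F p‖ₑ ^ Q) ^ ((σ - t) * q / 2) = ‖IE F p‖ₑ ^ q := by
    intro p
    rw [← ENNReal.rpow_mul, ← ENNReal.rpow_mul, ← ENNReal.rpow_add_of_nonneg _ _ (by positivity) (by positivity), ex]
  simp_rw [e] at H
  have H2 := ENNReal.rpow_le_rpow H ht0.le
  refine H2.trans ?_
  rw [ENNReal.mul_rpow_of_nonneg _ _ ht0.le, ← ENNReal.rpow_mul, ← ENNReal.rpow_mul,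
    show (3 * t - σ) * q / 2 * t = (3 * t - σ) / 2 by linear_combination (3 * t - σ) / 2 * htq,
    show (σ - t) * q / 2 * t = 1 / Q * (1 - 3 * t + σ) by
      rw [hQi]; linear_combination (σ - t) / 2 * htq]
  rw [ENNReal.rpow_mul _ (1 / Q)]
  have hZ' : (∫⁻ p in AK k, ‖IE F p‖ₑ ^ Q) ^ (1 / Q) ≤ ENNReal.ofReal (C' * m ^ (1 - 3 / Q)) :=
    (ENNReal.rpow_le_rpow (setLIntegral_le_lintegral _ _) (by positivity)).trans (hZ F m hm hF)
  refine (mul_le_mul' (ENNReal.rpow_le_rpow (hL k F m hF) (by positivity)) (ENNReal.rpow_le_rpow hZ' hθ1.le)).trans (le_of_eq ?_)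
  rw [ENNReal.ofReal_rpow_of_pos (by positivity), ENNReal.ofReal_rpow_of_pos (by positivity), ← ENNReal.ofReal_mul (by positivity)]
  congr 1
  rw [Real.mul_rpow (by positivity) hm.le, Real.mul_rpow hC.le (by positivity), Real.mul_rpow hC'.le (by positivity),
    ← Real.rpow_natCast 2 k, ← Real.rpow_mul two_pos.le, ← Real.rpow_mul hm.le]
  rw [show (k:ℝ) * (3 / (2 * q) - σ / 2) = k * ((3 * t - σ) / 2) by rw [ht]; field_simp,
    show 1 - σ = (3 * t - σ) / 2 + (1 - 3 / Q) * (1 - 3 * t + σ) by linear_combination 3 * hQi, Real.rpow_add hm]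
  ring

theorem caseA (γ r q : ℝ) (hr : 1 < r) (hrq : r ≤ q) (hs : 1 - 1 / r < 1 / q) (hγ : γ = 2 / q - (1 - 1 / r)) (h1 : γ > 2 / q - 1 / 2) :
    STR γ r q := by
  have hq : 0 < q := by linarith
  have hs0 : 0 < 1 - 1 / r := by rw [sub_pos, div_lt_one (by linarith)]; exact hr
  set s := 1 - 1 / r with hsdef
  have hs2 : s < 1 / 2 := by linarith
  obtain ⟨η, hη, h3⟩ := exists_between (lt_min hs0 (lt_min (sub_pos.2 hs) (sub_pos.2 hs2)))
  simp only [lt_min_iff] at h3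
  obtain ⟨ha, hb, hc⟩ := h3
  apply COMB γ r q 1 η hr hrq one_pos hη
  · have := LOCA q (s - η) hq (by linarith) (by linarith) (by linarith)
    convert this using 1
    · rw [hγ]; ring
    · rw [hsdef]; ring
  · have := LOCA q (s + η) hq (by linarith) (by linarith) (by linarith)
    convert this using 1
    · rw [hγ]; ring
    · rw [hsdef]; ring

theorem caseB (γ r q : ℝ) (hr : 1 < r) (hrq : r ≤ q) (hs : 1 / q < 1 - 1 / r) (hγ : γ = 3 / (2 * q) - (1 - 1 / r) / 2)
    (h1 : γ > 2 / q - 1 / 2) (h0 : 0 < γ) : STR γ r q := by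
  have hq : 0 < q := by linarith
  set s := 1 - 1 / r with hsdef
  have e3 : 3 / (2 * q) = 3 / q / 2 := by field_simp
  have e4 : 2 / q = 3 / q - 1 / q := by ring
  have e5 : 3 / q = 3 * (1 / q) := by ring
  have hs3 : s < 3 / q := by linarith
  have hs4 : s + 1 / q < 1 := by linarith
  obtain ⟨η, hη, h3⟩ := exists_between (lt_min (sub_pos.2 hs3) (lt_min (sub_pos.2 hs) (sub_pos.2 hs4)))
  simp only [lt_min_iff] at h3
  obtain ⟨ha, hb, hc⟩ := h3
  apply COMB γ r q (1 / 2) η hr hrq (by norm_num) hη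
  · have := LOCB q (s - η) hq (by linarith) (by linarith) (by linarith)
    convert this using 1
    · rw [hγ]; ring
    · rw [hsdef]; ring
  · have := LOCB q (s + η) hq (by linarith) (by linarith) (by linarith)
    convert this using 1
    · rw [hγ]; ring
    · rw [hsdef]; ring


theorem CS4 (p : ℝ) (hp : 0 < p) (X Y : ℝ × ℝ → ℝ≥0∞) (hX : Measurable X) (hY : Measurable Y) :
    (∫⁻ x, (X x * Y x) ^ p) ^ (1 / p) ≤ (∫⁻ x, X x ^ (2 * p)) ^ (1 / (2 * p)) * (∫⁻ x, Y x ^ (2 * p)) ^ (1 / (2 * p)) := by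
  have H := ENNReal.lintegral_mul_norm_pow_le (μ := (volume : Measure (ℝ × ℝ))) (f := fun x => X x ^ (2 * p)) (g := fun x => Y x ^ (2 * p))
    (hX.pow_const _).aemeasurable (hY.pow_const _).aemeasurable (p := 1 / 2) (q := 1 / 2) (by norm_num) (by norm_num) (by norm_num)
  have e : ∀ x, (X x ^ (2 * p)) ^ (1 / 2 : ℝ) * (Y x ^ (2 * p)) ^ (1 / 2 : ℝ) = (X x * Y x) ^ p := by
    intro x
    rw [← ENNReal.rpow_mul, ← ENNReal.rpow_mul, show 2 * p * (1 / 2) = p by ring, ENNReal.mul_rpow_of_nonneg _ _ hp.le]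
  simp_rw [e] at H
  have H2 := ENNReal.rpow_le_rpow H (show 0 ≤ 1 / p by positivity)
  rwa [ENNReal.mul_rpow_of_nonneg _ _ (by positivity), ← ENNReal.rpow_mul, ← ENNReal.rpow_mul,
    show 1 / 2 * (1 / p) = 1 / (2 * p) by field_simp] at H2

theorem four_sum (A : ℤ → ℝ≥0∞) : (∑' i, A i) ^ 4 = ∑' z : (ℤ × ℤ × ℤ) × ℤ, A z.2 * A (z.2 + z.1.1) * (A (z.2 + z.1.2.1) * A (z.2 + z.1.2.2)) := by
  have sh : ∀ i, ∑' a, A (i + a) = ∑' a, A a := fun i => (Equiv.addLeft i).tsum_eq A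
  rw [ENNReal.tsum_prod', ENNReal.tsum_comm]
  have : ∀ i, ∑' w : ℤ × ℤ × ℤ, A i * A (i + w.1) * (A (i + w.2.1) * A (i + w.2.2)) = A i * (∑' a, A a) ^ 3 := by
    intro i
    simp only [ENNReal.tsum_prod', ENNReal.tsum_mul_left, ENNReal.tsum_mul_right, sh]
    ring
  simp_rw [this]
  rw [ENNReal.tsum_mul_right]; ring

theorem amgm4 (a b c d : ℝ≥0∞) : a * b * (c * d) ≤ a ^ 4 + b ^ 4 + c ^ 4 + d ^ 4 := by
  set M := max (max a b) (max c d) with hM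
  have h1 : a ≤ M := (le_max_left _ _).trans (le_max_left _ _)
  have h2 : b ≤ M := (le_max_right _ _).trans (le_max_left _ _)
  have h3 : c ≤ M := (le_max_left _ _).trans (le_max_right _ _)
  have h4 : d ≤ M := (le_max_right _ _).trans (le_max_right _ _)
  have h : a * b * (c * d) ≤ M ^ 4 := by
    calc a * b * (c * d) ≤ M * M * (M * M) := by gcongr
      _ = M ^ 4 := by ring
  refine h.trans ?_
  rcases max_choice (max a b) (max c d) with h | h
  · rcases max_choice a b with h' | h'
    · rw [hM, h, h', add_assoc, add_assoc]; exact le_self_add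
    · rw [hM, h, h', add_assoc, add_comm (a ^ 4), add_assoc]; exact le_self_add
  · rcases max_choice c d with h' | h'
    · rw [hM, h, h', add_assoc, add_comm (a ^ 4 + b ^ 4), add_assoc]; exact le_self_add
    · rw [hM, h, h']; exact le_add_self

theorem four_B (B : ℤ → ℝ≥0∞) (a c d : ℤ) : ∑' i, B i * B (i + a) * (B (i + c) * B (i + d)) ≤ 4 * ∑' i, B i ^ 4 := by
  have sh : ∀ a, ∑' i, B (i + a) ^ 4 = ∑' i, B i ^ 4 := fun a => (Equiv.addRight a).tsum_eq (fun i => B i ^ 4)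
  refine (ENNReal.tsum_le_tsum fun i => amgm4 _ _ _ _).trans (le_of_eq ?_)
  rw [ENNReal.tsum_add, ENNReal.tsum_add, ENNReal.tsum_add, sh, sh, sh]; ring

theorem W_sum (W : ℤ → ℝ≥0∞) : ∑' w : ℤ × ℤ × ℤ, W w.1 * (W w.2.1 * W (w.2.2 - w.1)) = (∑' n, W n) ^ 3 := by
  have sh : ∀ a, ∑' d, W (d - a) = ∑' d, W d := fun a => (Equiv.subRight a).tsum_eq W
  rw [ENNReal.tsum_prod']
  simp_rw [ENNReal.tsum_prod', ENNReal.tsum_mul_left, sh, ENNReal.tsum_mul_right]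
  ring

theorem nu_sep (ν : ℤ → ℝ) (hν : ∀ j, 0 < ν j) (h : ∀ j, ν (j + 1) ≤ 1 / 2 * ν j) (j : ℤ) (n : ℕ) :
    ν (j + n) ≤ 2 ^ (-(n:ℝ)) * ν j := by
  induction n with
  | zero => simp
  | succ n ih =>
    have := h (j + n)
    push_cast
    rw [← add_assoc, neg_add, Real.rpow_add two_pos, Real.rpow_neg_one]
    linarith

theorem P_arith (t m M : ℝ) (n : ℝ) (ht : 0 < t) (hm : 0 < m) (hM : 0 < M) (h : m ≤ 2 ^ (-n) * M) :
    m ^ (1 - 2 * t) * M ^ (1 - 4 * t) ≤ m ^ (1 - 3 * t) * M ^ (1 - 3 * t) * 2 ^ (-(t * n)) := by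
  have h1 : m ^ t ≤ 2 ^ (-(t * n)) * M ^ t := by
    have := Real.rpow_le_rpow hm.le h ht.le
    rwa [Real.mul_rpow (by positivity) hM.le, ← Real.rpow_mul two_pos.le, show -n * t = -(t * n) by ring] at this
  rw [show 1 - 2 * t = (1 - 3 * t) + t by ring, Real.rpow_add hm, show 1 - 3 * t = (1 - 4 * t) + t by ring, Real.rpow_add hM]
  calc m ^ (1 - 4 * t + t) * m ^ t * M ^ (1 - 4 * t) ≤ m ^ (1 - 4 * t + t) * (2 ^ (-(t * n)) * M ^ t) * M ^ (1 - 4 * t) := by gcongr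
    _ = _ := by ring

theorem P_bd (q : ℝ) (hq : 4 < q) : ∃ C : ℝ, 0 < C ∧ ∀ (f : ℤ → ℝ → ℂ) (ν : ℤ → ℝ), (∀ j, 0 < ν j) → (∀ j, ν (j + 1) ≤ 1 / 2 * ν j) →
    (∀ j, SubF (f j) (ν j)) → ∀ i j : ℤ,
    (∫⁻ x, (ENNReal.ofReal (2 ^ (i:ℝ)) * ‖IE (f i) x‖ₑ * (ENNReal.ofReal (2 ^ (j:ℝ)) * ‖IE (f j) x‖ₑ)) ^ (q / 2)) ^ (1 / (q / 2)) ≤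
      ENNReal.ofReal (C * ((2 ^ (i:ℝ) * ν i ^ (1 - 3 / q)) * (2 ^ (j:ℝ) * ν j ^ (1 - 3 / q)) * 2 ^ (-(1 / q * |((i - j : ℤ) : ℝ)|)))) := by
  obtain ⟨C, hC, hB⟩ := BIL (q / 2) (by linarith)
  refine ⟨C, hC, fun f ν hν hh hs => ?_⟩
  have main : ∀ (i : ℤ) (n : ℕ), (∫⁻ x, (‖IE (f (i + n)) x‖ₑ * ‖IE (f i) x‖ₑ) ^ (q / 2)) ^ (1 / (q / 2)) ≤
      ENNReal.ofReal (C * (ν (i + n) ^ (1 - 3 / q) * ν i ^ (1 - 3 / q) * 2 ^ (-(1 / q * n)))) := by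
    intro i n
    refine (hB (f (i + n)) (f i) _ _ (hν _) (hν _) (hs _) (hs _)).trans (ENNReal.ofReal_le_ofReal ?_)
    have := P_arith (1 / q) (ν (i + n)) (ν i) n (by positivity) (hν _) (hν _) (nu_sep ν hν hh i n)
    refine mul_le_mul_of_nonneg_left ?_ hC.le
    rwa [show 1 - 2 * (1 / q) = 1 - 1 / (q / 2) by rw [one_div_div]; ring, show 1 - 4 * (1 / q) = 1 - 2 / (q / 2) by rw [div_div_eq_mul_div]; ring,
      show 1 - 3 * (1 / q) = 1 - 3 / q by ring] at this
  have gen : ∀ i j : ℤ, (∫⁻ x, (‖IE (f i) x‖ₑ * ‖IE (f j) x‖ₑ) ^ (q / 2)) ^ (1 / (q / 2)) ≤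
      ENNReal.ofReal (C * (ν i ^ (1 - 3 / q) * ν j ^ (1 - 3 / q) * 2 ^ (-(1 / q * |((i - j : ℤ) : ℝ)|)))) := by
    intro i j
    rcases le_total j i with h | h
    · obtain ⟨n, rfl⟩ := Int.le.dest h
      have := main j n
      simpa using this
    · obtain ⟨n, rfl⟩ := Int.le.dest h
      have := main i n
      simp_rw [mul_comm (‖IE (f i) _‖ₑ)]
      rw [mul_comm (ν i ^ (1 - 3 / q))]
      simpa using this
  intro i j
  have hq2 : 0 ≤ q / 2 := by linarith
  have e : ∀ x, (ENNReal.ofReal (2 ^ (i:ℝ)) * ‖IE (f i) x‖ₑ * (ENNReal.ofReal (2 ^ (j:ℝ)) * ‖IE (f j) x‖ₑ)) ^ (q / 2) =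
      ENNReal.ofReal (2 ^ (i:ℝ) * 2 ^ (j:ℝ)) ^ (q / 2) * (‖IE (f i) x‖ₑ * ‖IE (f j) x‖ₑ) ^ (q / 2) := by
    intro x
    rw [← ENNReal.mul_rpow_of_nonneg _ _ hq2, ENNReal.ofReal_mul (by positivity)]; congr 1; ring
  simp_rw [e]
  have hmm : Measurable fun x => (‖IE (f i) x‖ₑ * ‖IE (f j) x‖ₑ) ^ (q / 2) :=
    ((IE_meas (hs i).meas).enorm.mul (IE_meas (hs j).meas).enorm).pow_const _
  rw [lintegral_const_mul _ hmm,
    ENNReal.mul_rpow_of_nonneg _ _ (by positivity), ← ENNReal.rpow_mul, mul_one_div_cancel (by linarith), ENNReal.rpow_one]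
  refine (mul_le_mul_right (gen i j) _).trans (le_of_eq ?_)
  rw [← ENNReal.ofReal_mul (by positivity)]
  congr 1; ring

theorem ZYGS (r q : ℝ) (hr : 1 < r) (hq : 4 < q) (hrq : 1 / r = 1 - 3 / q) : ∃ C : ℝ, 0 < C ∧ ∀ F : ℝ → ℂ, Measurable F →
    ∫⁻ φ, ‖F φ‖ₑ ^ r ∂mu0 ≠ 0 → ∫⁻ φ, ‖F φ‖ₑ ^ r ∂mu0 ≠ ∞ →
      ∫⁻ p, ‖IE F p‖ₑ ^ q ≤ ENNReal.ofReal C * (∫⁻ φ, ‖F φ‖ₑ ^ r ∂mu0) ^ (q / r) := by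
  obtain ⟨C1, hC1, hlev⟩ := LEVEL r hr
  obtain ⟨C2, hC2, hP⟩ := P_bd q hq
  have hq0 : 0 < q := by linarith
  have hr0 : 0 < r := by linarith
  obtain ⟨S, hS, hgeo⟩ := geo_sum 1 (1 / q / 2) (1 / q / 2) one_pos (by positivity) (by positivity)
  have hr4 : r ≤ 4 := by
    have h34 : 3 / q < 3 / 4 := div_lt_div_of_pos_left (by norm_num) (by norm_num) hq
    have : 1 / 4 ≤ 1 / r := by linarith
    exact le_of_one_div_le_one_div (by norm_num) this
  set K : ℝ := C2 ^ 2 * (S ^ 3 * (4 * C1 ^ (4 / r))) with hK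
  have hK0 : 0 < K := by positivity
  refine ⟨K ^ (q / 4), by positivity, fun F hF h0 hi => ?_⟩
  obtain ⟨f, ν, hν, hhalf, hsub, hIE, hsum⟩ := hlev F hF h0 hi
  set A : ℤ → ℝ × ℝ → ℝ≥0∞ := fun i x => ENNReal.ofReal (2 ^ (i:ℝ)) * ‖IE (f i) x‖ₑ with hA
  have hAm : ∀ i, Measurable (A i) := fun i => (IE_meas (hsub i).meas).enorm.const_mul _
  set β : ℤ → ℝ := fun i => 2 ^ (i:ℝ) * ν i ^ (1 - 3 / q) with hβ
  have hβ0 : ∀ i, 0 < β i := fun i => by have := hν i; positivity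
  have hP' : ∀ i j, (∫⁻ x, (A i x * A j x) ^ (q / 2)) ^ (1 / (q / 2)) ≤
      ENNReal.ofReal (C2 * (β i * β j * 2 ^ (-(1 / q * |((i - j : ℤ) : ℝ)|)))) := hP f ν hν hhalf hsub
  have hpair : ∀ i j k l, (∫⁻ x, (A i x * A j x * (A k x * A l x)) ^ (q / 4)) ^ (1 / (q / 4)) ≤
      ENNReal.ofReal (C2 ^ 2 * (β i * β j * (β k * β l) * 2 ^ (-(1 / q * (|((i - j : ℤ) : ℝ)| + |((k - l : ℤ) : ℝ)|))))) := by
    intro i j k l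
    have h := CS4 (q / 4) (by positivity) (fun x => A i x * A j x) (fun x => A k x * A l x) ((hAm i).mul (hAm j)) ((hAm k).mul (hAm l))
    rw [show 2 * (q / 4) = q / 2 by ring] at h
    refine (h.trans (mul_le_mul' (hP' i j) (hP' k l))).trans (le_of_eq ?_)
    have := hβ0 i
    have := hβ0 j
    rw [← ENNReal.ofReal_mul (by positivity)]
    congr 1
    rw [mul_add, neg_add, Real.rpow_add two_pos]; ring
  set W : ℤ → ℝ≥0∞ := fun n => ENNReal.ofReal (2 ^ (-(1 / q / 2 * |(n:ℝ)|))) with hW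
  set B : ℤ → ℝ≥0∞ := fun n => ENNReal.ofReal (β n) with hB
  have hquad : ∀ i a c d : ℤ, (∫⁻ x, (A i x * A (i + a) x * (A (i + c) x * A (i + d) x)) ^ (q / 4)) ^ (1 / (q / 4)) ≤
      ENNReal.ofReal (C2 ^ 2) * ((W a * (W c * W (d - a))) * (B i * B (i + a) * (B (i + c) * B (i + d)))) := by
    intro i a c d
    have b1 := hβ0 i
    have b2 := hβ0 (i + a)
    have b3 := hβ0 (i + c)
    have b4 := hβ0 (i + d)
    have e : ENNReal.ofReal (C2 ^ 2) * ((W a * (W c * W (d - a))) * (B i * B (i + a) * (B (i + c) * B (i + d)))) =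
        ENNReal.ofReal (C2 ^ 2 * (β i * β (i + a) * (β (i + c) * β (i + d)) * 2 ^ (-(1 / q * ((|(a:ℝ)| + |(c:ℝ)| + |((d - a : ℤ):ℝ)|) / 2))))) := by
      rw [hW, hB]; simp only
      rw [← ENNReal.ofReal_mul (by positivity), ← ENNReal.ofReal_mul (by positivity), ← ENNReal.ofReal_mul (by positivity),
        ← ENNReal.ofReal_mul (by positivity), ← ENNReal.ofReal_mul (by positivity), ← ENNReal.ofReal_mul (by positivity),
        ← ENNReal.ofReal_mul (by positivity)]
      congr 1
      rw [← Real.rpow_add two_pos, ← Real.rpow_add two_pos,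
        show -(1 / q * ((|(a:ℝ)| + |(c:ℝ)| + |((d - a : ℤ):ℝ)|) / 2)) = -(1 / q / 2 * |(a:ℝ)|) + (-(1 / q / 2 * |(c:ℝ)|) + -(1 / q / 2 * |((d - a : ℤ):ℝ)|)) by ring]
      ring
    rw [e]
    have h1 := hpair i (i + a) (i + c) (i + d)
    have h2 := hpair i (i + c) (i + a) (i + d)
    have e2 : ∀ x, A i x * A (i + c) x * (A (i + a) x * A (i + d) x) = A i x * A (i + a) x * (A (i + c) x * A (i + d) x) := fun x => by ring
    simp_rw [e2] at h2
    have e3 : |((i - (i + a) : ℤ) : ℝ)| = |(a:ℝ)| := by rw [← abs_neg]; push_cast; congr 1; ring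
    have e4 : |((i - (i + c) : ℤ) : ℝ)| = |(c:ℝ)| := by rw [← abs_neg]; push_cast; congr 1; ring
    have e5 : |((i + a - (i + d) : ℤ) : ℝ)| = |((d - a : ℤ):ℝ)| := by rw [← abs_neg]; push_cast; congr 1; ring
    rw [e3] at h1
    rw [e4, e5] at h2
    have p1 := abs_nonneg ((i + c - (i + d) : ℤ) : ℝ)
    have p2 := abs_nonneg (c:ℝ)
    rcases le_total |(a:ℝ)| (|(c:ℝ)| + |((d - a : ℤ):ℝ)|) with hle | hle
    · refine h2.trans (ENNReal.ofReal_le_ofReal ?_)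
      rw [show β i * β (i + c) * (β (i + a) * β (i + d)) = β i * β (i + a) * (β (i + c) * β (i + d)) by ring]
      gcongr
      · norm_num
      · linarith
    · refine h1.trans (ENNReal.ofReal_le_ofReal ?_)
      gcongr
      · norm_num
      · linarith
  have hWS : ∑' n, W n ≤ ENNReal.ofReal S := by
    refine le_trans (le_of_eq (tsum_congr fun n => ?_)) (hgeo 1 one_pos)
    rw [hW]; simp only
    congr 1
    rw [mul_one, mul_one, ← Real.rpow_mul two_pos.le, ← Real.rpow_mul two_pos.le]
    have ht : 0 < 1 / q / 2 := by positivity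
    rcases le_total 0 (n:ℝ) with hn | hn
    · rw [abs_of_nonneg hn, min_eq_right]
      · congr 1; ring
      · apply Real.rpow_le_rpow_of_exponent_le one_le_two
        nlinarith
    · rw [abs_of_nonpos hn, min_eq_left]
      · congr 1; ring
      · apply Real.rpow_le_rpow_of_exponent_le one_le_two
        nlinarith
  have hB4 : ∑' i, B i ^ 4 ≤ (ENNReal.ofReal C1 * ∫⁻ φ, ‖F φ‖ₑ ^ r ∂mu0) ^ (4 / r) := by
    have h := lr_lq r 4 hr0 hr4 B
    have e : ∀ i, B i ^ (4:ℝ) = B i ^ 4 := fun i => by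
      rw [← ENNReal.rpow_natCast]; norm_num
    simp_rw [e] at h
    refine h.trans (ENNReal.rpow_le_rpow (le_trans (le_of_eq (tsum_congr fun j => ?_)) hsum) (by positivity))
    have := hν j
    rw [hB, hβ]; simp only
    rw [ENNReal.ofReal_rpow_of_pos (by positivity), Real.mul_rpow (by positivity) (by positivity),
      ← Real.rpow_mul (by positivity), ← Real.rpow_mul this.le, ← hrq, one_div_mul_cancel hr0.ne', Real.rpow_one]
  have key : (∫⁻ p, ‖IE F p‖ₑ ^ q) ^ (1 / (q / 4)) ≤ ENNReal.ofReal K * (∫⁻ φ, ‖F φ‖ₑ ^ r ∂mu0) ^ (4 / r) := by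
    calc (∫⁻ p, ‖IE F p‖ₑ ^ q) ^ (1 / (q / 4))
        ≤ (∫⁻ p, (∑' z : (ℤ × ℤ × ℤ) × ℤ, A z.2 p * A (z.2 + z.1.1) p * (A (z.2 + z.1.2.1) p * A (z.2 + z.1.2.2) p)) ^ (q / 4)) ^ (1 / (q / 4)) := by
          refine ENNReal.rpow_le_rpow (lintegral_mono fun p => ?_) (by positivity)
          rw [← four_sum (fun i => A i p), ← ENNReal.rpow_natCast, ← ENNReal.rpow_mul, show ((4:ℕ):ℝ) * (q / 4) = q by push_cast; ring]
          exact ENNReal.rpow_le_rpow (hIE p) hq0.le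
      _ ≤ ∑' z : (ℤ × ℤ × ℤ) × ℤ, (∫⁻ p, (A z.2 p * A (z.2 + z.1.1) p * (A (z.2 + z.1.2.1) p * A (z.2 + z.1.2.2) p)) ^ (q / 4)) ^ (1 / (q / 4)) :=
          mink_tsum _ (q / 4) (by linarith) (fun z : (ℤ × ℤ × ℤ) × ℤ => fun p => A z.2 p * A (z.2 + z.1.1) p * (A (z.2 + z.1.2.1) p * A (z.2 + z.1.2.2) p))
            (fun z => ((hAm _).mul (hAm _)).mul ((hAm _).mul (hAm _)))
      _ ≤ ∑' z : (ℤ × ℤ × ℤ) × ℤ, ENNReal.ofReal (C2 ^ 2) * ((W z.1.1 * (W z.1.2.1 * W (z.1.2.2 - z.1.1))) * (B z.2 * B (z.2 + z.1.1) * (B (z.2 + z.1.2.1) * B (z.2 + z.1.2.2)))) :=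
          ENNReal.tsum_le_tsum fun z => hquad _ _ _ _
      _ = ENNReal.ofReal (C2 ^ 2) * ∑' w : ℤ × ℤ × ℤ, (W w.1 * (W w.2.1 * W (w.2.2 - w.1))) * ∑' i, B i * B (i + w.1) * (B (i + w.2.1) * B (i + w.2.2)) := by
          rw [ENNReal.tsum_mul_left, ENNReal.tsum_prod']
          simp_rw [ENNReal.tsum_mul_left]
      _ ≤ ENNReal.ofReal (C2 ^ 2) * ∑' w : ℤ × ℤ × ℤ, (W w.1 * (W w.2.1 * W (w.2.2 - w.1))) * (4 * ∑' i, B i ^ 4) := by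
          gcongr with w
          exact four_B B _ _ _
      _ = ENNReal.ofReal (C2 ^ 2) * ((∑' n, W n) ^ 3 * (4 * ∑' i, B i ^ 4)) := by
          rw [ENNReal.tsum_mul_right, W_sum]
      _ ≤ ENNReal.ofReal (C2 ^ 2) * (ENNReal.ofReal S ^ 3 * (4 * (ENNReal.ofReal C1 * ∫⁻ φ, ‖F φ‖ₑ ^ r ∂mu0) ^ (4 / r))) := by
          gcongr
      _ = _ := by
          rw [ENNReal.mul_rpow_of_nonneg _ _ (by positivity), ENNReal.ofReal_rpow_of_pos hC1, hK, ENNReal.ofReal_mul (by positivity),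
            ENNReal.ofReal_mul (by positivity), ENNReal.ofReal_mul (by positivity), ← ENNReal.ofReal_pow hS.le, ENNReal.ofReal_ofNat]
          ring
  have h5 := ENNReal.rpow_le_rpow key (show 0 ≤ q / 4 by positivity)
  rw [← ENNReal.rpow_mul, one_div_mul_cancel (by positivity), ENNReal.rpow_one, ENNReal.mul_rpow_of_nonneg _ _ (by positivity),
    ← ENNReal.rpow_mul, ENNReal.ofReal_rpow_of_pos hK0, show 4 / r * (q / 4) = q / r by field_simp] at h5
  exact h5

def FIN (γ r q : ℝ) : Prop := ∃ C : ℝ, 0 < C ∧ ∀ F : ℝ → ℂ, Measurable F → ∫⁻ φ, ‖F φ‖ₑ ^ r ∂mu0 ≠ 0 → ∫⁻ φ, ‖F φ‖ₑ ^ r ∂mu0 ≠ ∞ →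
      ∫⁻ p : ℝ × ℝ, (‖IE F p‖ₑ * ENNReal.ofReal ((1 + |p.1| + |p.2|) ^ (-γ))) ^ q ≤
        ENNReal.ofReal C * (∫⁻ φ, ‖F φ‖ₑ ^ r ∂mu0) ^ (q / r)

theorem AK_cover : (⋃ k, AK k) = univ := by
  ext p
  simp only [mem_iUnion, mem_univ, iff_true]
  have h1 : 1 ≤ 1 + |p.1| + |p.2| := by linarith [abs_nonneg p.1, abs_nonneg p.2]
  obtain ⟨n, hn⟩ := exists_nat_pow_near h1 one_lt_two
  exact ⟨n, hn⟩

theorem STR_FIN (γ r q : ℝ) (hγ : 0 ≤ γ) (hq : 0 < q) (h : STR γ r q) : FIN γ r q := by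
  obtain ⟨C, hC, h⟩ := h
  refine ⟨C, hC, fun F hF h0 hi => le_trans ?_ (h F hF h0 hi)⟩
  rw [← setLIntegral_univ, ← AK_cover]
  refine (lintegral_iUnion_le _ _).trans (ENNReal.tsum_le_tsum fun k => ?_)
  rw [← lintegral_const_mul _ ((IE_meas hF).enorm.pow_const q)]
  refine setLIntegral_mono' (AK_meas k) fun p hp => ?_
  rw [ENNReal.mul_rpow_of_nonneg _ _ hq.le, mul_comm]
  refine mul_le_mul_left (ENNReal.rpow_le_rpow (ENNReal.ofReal_le_ofReal ?_) hq.le) _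
  calc (1 + |p.1| + |p.2|) ^ (-γ) ≤ ((2:ℝ) ^ k) ^ (-γ) :=
        Real.rpow_le_rpow_of_nonpos (by positivity) hp.1 (by linarith)
    _ = _ := by rw [← Real.rpow_natCast, ← Real.rpow_mul two_pos.le, mul_neg]

theorem FIN_all (γ : ℝ) (hγ : 0 ≤ γ)
    (r q : ℝ) (hr : 1 < r) (hrq : r ≤ q)
    (h1 : γ > 2 / q - 1 / 2)
    (h2 : γ = max (3 / (2 * q) - (1 - 1 / r) / 2) (2 / q - (1 - 1 / r)))
    (h3 : 1 / q ≠ 1 - 1 / r) : FIN γ r q := by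
  have hq : 0 < q := by linarith
  have e3 : 3 / (2 * q) = 3 / q / 2 := by field_simp
  have e4 : 2 / q = 3 / q - 1 / q := by ring
  have e5 : 3 / q = 3 * (1 / q) := by ring
  rcases lt_or_gt_of_ne h3 with h | h
  · rw [max_eq_left (by linarith)] at h2
    rcases hγ.eq_or_lt with h0 | h0
    · have hrq' : 1 / r = 1 - 3 / q := by linarith
      have hq4 : 4 < q := by
        have : 4 * (1 / q) < 1 := by linarith
        rw [mul_one_div, div_lt_one hq] at this
        exact this
      obtain ⟨C, hC, hz⟩ := ZYGS r q hr hq4 hrq'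
      refine ⟨C, hC, fun F hF a b => le_trans (le_of_eq ?_) (hz F hF a b)⟩
      refine lintegral_congr fun p => ?_
      rw [← h0, neg_zero, Real.rpow_zero, ENNReal.ofReal_one, mul_one]
    · exact STR_FIN γ r q hγ hq (caseB γ r q hr hrq h h2 h1 h0)
  · rw [max_eq_right (by linarith)] at h2
    exact STR_FIN γ r q hγ hq (caseA γ r q hr hrq h h2 h1)

theorem Rext_le (F : ℝ → ℂ) (p : ℝ × ℝ) : ‖Rext F p.1 p.2‖ₑ ≤ ‖IE F p‖ₑ := by
  have e : Rext F p.1 p.2 = Complex.ofReal (1 / (2 * π)) * IE F p := by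
    unfold Rext IE mu0
    rw [intervalIntegral.integral_of_le (by positivity)]
  rw [e, enorm_mul]
  have : ‖Complex.ofReal (1 / (2 * π))‖ₑ ≤ 1 := by
    rw [← ofReal_norm, Complex.norm_real, Real.norm_of_nonneg (by positivity)]
    apply ENNReal.ofReal_le_one.2
    rw [div_le_one (by positivity)]
    linarith [Real.two_le_pi]
  calc _ ≤ 1 * ‖IE F p‖ₑ := by gcongr
    _ = _ := one_mul _

/-- Theorem 6 (sufficiency, endpoint case) for `R*_γ`, with `1 < r ≤ q < ∞` and
`q ≠ r'` (expressed as `1/q ≠ 1 - 1/r`). -/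
theorem statement3 (γ : ℝ) (hγ : 0 ≤ γ)
    (r q : ℝ) (hr : 1 < r) (hrq : r ≤ q)
    (h1 : γ > 2 / q - 1 / 2)
    (h2 : γ = max (3 / (2 * q) - (1 - 1 / r) / 2) (2 / q - (1 - 1 / r)))
    (h3 : 1 / q ≠ 1 - 1 / r) :
    ∃ C : ℝ, 0 < C ∧ ∀ F : ℝ → ℂ, Measurable F →
      planeLp (ENNReal.ofReal q) (fun p => Rgamma γ F p.1 p.2) ≤
        ENNReal.ofReal C * circleLp (ENNReal.ofReal r) F := by
  have hq0 : 0 < q := by linarith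
  have hr0 : 0 < r := by linarith
  obtain ⟨C, hC, hfin⟩ := FIN_all γ hγ r q hr hrq h1 h2 h3
  refine ⟨C ^ (1 / q), by positivity, fun F hF => ?_⟩
  have hc : circleLp (ENNReal.ofReal r) F = (∫⁻ φ, ‖F φ‖ₑ ^ r ∂mu0) ^ (1 / r) := by
    unfold circleLp
    rw [eLpNorm_eq_lintegral_rpow_enorm_toReal (by simpa using hr0) ENNReal.ofReal_ne_top, ENNReal.toReal_ofReal hr0.le]
    rfl
  have hp : planeLp (ENNReal.ofReal q) (fun p => Rgamma γ F p.1 p.2) ≤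
      (∫⁻ p : ℝ × ℝ, (‖IE F p‖ₑ * ENNReal.ofReal ((1 + |p.1| + |p.2|) ^ (-γ))) ^ q) ^ (1 / q) := by
    unfold planeLp
    rw [eLpNorm_eq_lintegral_rpow_enorm_toReal (by simpa using hq0) ENNReal.ofReal_ne_top, ENNReal.toReal_ofReal hq0.le]
    refine ENNReal.rpow_le_rpow (lintegral_mono fun p => ENNReal.rpow_le_rpow ?_ hq0.le) (by positivity)
    unfold Rgamma
    rw [enorm_mul]
    refine mul_le_mul' (Rext_le F p) (le_of_eq ?_)
    rw [← ofReal_norm, Complex.norm_real, Real.norm_of_nonneg (by positivity)]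
  refine hp.trans ?_
  rw [hc]
  by_cases h0 : ∫⁻ φ, ‖F φ‖ₑ ^ r ∂mu0 = 0
  · have hae : ∀ᵐ φ ∂mu0, F φ = 0 := by
      rw [lintegral_eq_zero_iff (hF.enorm.pow_const r)] at h0
      filter_upwards [h0] with φ hφ
      simpa [hr0, hr0.le, hr0.not_gt] using hφ
    have hz : ∀ p, IE F p = 0 := by
      intro p
      unfold IE
      rw [integral_eq_zero_of_ae]
      filter_upwards [hae] with φ hφ
      simp [hφ]
    simp [hz, hq0]
  by_cases hi : ∫⁻ φ, ‖F φ‖ₑ ^ r ∂mu0 = ∞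
  · rw [hi, ENNReal.top_rpow_of_pos (by positivity), ENNReal.mul_top]
    · exact le_top
    · simp only [ne_eq, ENNReal.ofReal_eq_zero, not_le]; positivity
  refine (ENNReal.rpow_le_rpow (hfin F hF h0 hi) (by positivity : 0 ≤ 1 / q)).trans (le_of_eq ?_)
  rw [ENNReal.mul_rpow_of_nonneg _ _ (by positivity), ← ENNReal.rpow_mul, ENNReal.ofReal_rpow_of_pos hC,
    show q / r * (1 / q) = 1 / r by field_simp]
end
end

section
/- Let 0 ≤ β ≤ α < ∞ and 0 < q < ∞. (i) If 1 ≤ r < ∞, α ≥ 1/q and 2β ≥ 2/q − 1/r′, then there is C > 0 such that for every measurable F : ℝ → ℂ one has ‖R*_{α,β}F‖_{L^{q,∞}_x(L^{q,∞}_y)} ≤ C · ‖F‖_{L^{r,1}(S¹)}. (ii) If r = ∞, α ≥ 1/q and 2β > 2/q − 1, then there is C > 0 such that ‖R*_{α,β}F‖_{L^{q,∞}_x(L^{q,∞}_y)} ≤ C · ess sup_{[0,2π]} |F|. -/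
open MeasureTheory Real Set Filter
open scoped ENNReal

noncomputable section

lemma planch_term (h : ℝ → ℂ) (hm : Measurable h) (L : ℝ) (hb : ∀ s, ‖h s‖ ≤ L) (θ : ℝ) :
    ∑' n : ℤ, ‖∫ s in Ioc (-π) π, h s * Complex.exp (Complex.I * Complex.ofReal ((θ + n) * s))‖ₑ ^ 2
      = ENNReal.ofReal (2 * π) * ∫⁻ s in Ioc (-π) π, ‖h s‖ₑ ^ 2 := by
  have hab : -π < π := by linarith [pi_pos]
  set f : ℝ → ℂ := fun s => h s * Complex.exp (Complex.I * Complex.ofReal (θ * s)) with hf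
  have hfn : ∀ s, ‖f s‖ = ‖h s‖ := by
    intro s
    simp only [hf, norm_mul, mul_comm Complex.I, Complex.norm_exp_ofReal_mul_I, mul_one]
  have hfm : Measurable f := by
    apply hm.mul
    fun_prop
  have hL2 : MemLp f 2 (volume.restrict (Ioc (-π) π)) := by
    refine MemLp.of_bound hfm.aestronglyMeasurable L (ae_of_all _ fun s => ?_)
    rw [hfn]; exact hb s
  have hs := hasSum_sq_fourierCoeffOn hab hL2
  have e1 : ∀ n : ℤ, (∫ s in Ioc (-π) π, h s * Complex.exp (Complex.I * Complex.ofReal ((θ + n) * s)))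
      = (2 * π : ℝ) • fourierCoeffOn hab f (-n) := by
    intro n
    rw [fourierCoeffOn_eq_integral, smul_smul, intervalIntegral.integral_of_le hab.le]
    have : 2 * π * (1 / (π - -π)) = 1 := by
      have := pi_pos
      field_simp; ring
    rw [this, one_smul]
    congr 1
    ext s
    simp only [neg_neg, smul_eq_mul, hf, fourier_coe_apply]
    rw [mul_comm (Complex.exp _), mul_assoc, ← Complex.exp_add]
    congr 2
    push_cast
    have : (π : ℂ) ≠ 0 := by exact_mod_cast pi_ne_zero
    field_simp
    ring
  have e2 : ∀ n : ℤ, ‖∫ s in Ioc (-π) π, h s * Complex.exp (Complex.I * Complex.ofReal ((θ + n) * s))‖ₑ ^ 2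
      = ENNReal.ofReal ((2 * π) ^ 2) * ENNReal.ofReal (‖fourierCoeffOn hab f (-n)‖ ^ 2) := by
    intro n
    rw [e1, ← ofReal_norm, ← ENNReal.ofReal_pow (norm_nonneg _), norm_smul, mul_pow,
      ENNReal.ofReal_mul (by positivity), Real.norm_eq_abs, sq_abs]
  simp_rw [e2]
  rw [ENNReal.tsum_mul_left]
  have e3 : ∑' n : ℤ, ENNReal.ofReal (‖fourierCoeffOn hab f (-n)‖ ^ 2)
     = ∑' n : ℤ, ENNReal.ofReal (‖fourierCoeffOn hab f n‖ ^ 2) :=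
    (Equiv.neg ℤ).tsum_eq (fun n => ENNReal.ofReal (‖fourierCoeffOn hab f n‖ ^ 2))
  rw [e3, ← ENNReal.ofReal_tsum_of_nonneg (fun _ => by positivity) hs.summable, hs.tsum_eq,
    intervalIntegral.integral_of_le hab.le, ← ENNReal.ofReal_mul (by positivity), smul_eq_mul,
    ← mul_assoc]
  have : (2 * π) ^ 2 * (π - -π)⁻¹ = 2 * π := by
    have := pi_pos
    field_simp; ring
  rw [this, ENNReal.ofReal_mul (by positivity)]
  congr 1
  rw [ofReal_integral_eq_lintegral_ofReal]
  · refine lintegral_congr fun s => ?_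
    rw [hfn, ENNReal.ofReal_pow (norm_nonneg _), ofReal_norm]
  · exact hL2.integrable_norm_pow (by norm_num)
  · exact ae_of_all _ fun s => by positivity

lemma planch (h : ℝ → ℂ) (hm : Measurable h) (L : ℝ) (hb : ∀ s, ‖h s‖ ≤ L) :
    ∫⁻ y : ℝ, ‖∫ s in Ioc (-π) π, h s * Complex.exp (Complex.I * Complex.ofReal (y * s))‖ₑ ^ 2
      = ENNReal.ofReal (2 * π) * ∫⁻ s in Ioc (-π) π, ‖h s‖ₑ ^ 2 := by
  have hHm : Measurable (fun y : ℝ =>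
      ∫ s in Ioc (-π) π, h s * Complex.exp (Complex.I * Complex.ofReal (y * s))) := by
    apply StronglyMeasurable.measurable
    apply StronglyMeasurable.integral_prod_right (f := fun y s : ℝ => h s * Complex.exp (Complex.I * Complex.ofReal (y * s)))
    apply Measurable.stronglyMeasurable
    apply (hm.comp measurable_snd).mul
    fun_prop
  rw [← setLIntegral_univ, ← iUnion_Ioc_intCast ℝ, lintegral_iUnion (fun _ => measurableSet_Ioc)
    (pairwise_disjoint_Ioc_intCast ℝ)]
  have e : ∀ n : ℤ, ∫⁻ y in Ioc (n : ℝ) (n + 1), ‖∫ s in Ioc (-π) π, h s * Complex.exp (Complex.I * Complex.ofReal (y * s))‖ₑ ^ 2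
     = ∫⁻ θ in Ioc (0 : ℝ) 1, ‖∫ s in Ioc (-π) π, h s * Complex.exp (Complex.I * Complex.ofReal ((θ + n) * s))‖ₑ ^ 2 := by
    intro n
    have := (measurePreserving_add_right (volume : Measure ℝ) (n : ℝ)).setLIntegral_comp_emb
      (measurableEmbedding_addRight (n : ℝ)) (fun y => ‖∫ s in Ioc (-π) π, h s * Complex.exp (Complex.I * Complex.ofReal (y * s))‖ₑ ^ 2) (Ioc 0 1)
    rw [this]
    simp [add_comm]
  simp_rw [e]
  rw [← lintegral_tsum]
  · simp_rw [planch_term h hm L hb]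
    simp
  · intro n
    exact ((hHm.comp (measurable_id.add_const (n : ℝ))).enorm.pow_const 2).aemeasurable

lemma piece (S : Set ℝ) (hS : MeasurableSet S) (ψ : ℝ → ℝ) (hψ : Measurable ψ)
    (hl : ∀ φ ∈ S, ψ (sin φ) = φ) (hc : ∀ φ ∈ S, cos φ ≠ 0)
    (G : ℝ → ℂ) (hG : Measurable G) (L : ℝ) (hL : 0 ≤ L) (hb : ∀ φ ∈ S, ‖G φ‖ ≤ L * |cos φ|) :
    ∫⁻ y : ℝ, ‖∫ φ in S, G φ * Complex.exp (Complex.I * Complex.ofReal (y * sin φ))‖ₑ ^ 2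
      = ENNReal.ofReal (2 * π) * ∫⁻ φ in S, ENNReal.ofReal (‖G φ‖ ^ 2 / |cos φ|) := by
  have hinj : InjOn sin S := fun a ha b hb hab => by rw [← hl a ha, ← hl b hb, hab]
  have hTm : MeasurableSet (sin '' S) := hS.image_of_continuousOn_injOn continuous_sin.continuousOn hinj
  have hTs : sin '' S ⊆ Ioc (-π) π := by
    rintro _ ⟨φ, -, rfl⟩
    have := pi_gt_three
    exact ⟨by linarith [neg_one_le_sin φ], by linarith [sin_le_one φ]⟩
  set h : ℝ → ℂ := (sin '' S).indicator (fun s => G (ψ s) / ((|cos (ψ s)| : ℝ) : ℂ)) with hh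
  have hsin : ∀ φ ∈ S, h (sin φ) = G φ / ((|cos φ| : ℝ) : ℂ) := by
    intro φ hφ
    rw [hh, indicator_of_mem (mem_image_of_mem _ hφ), hl φ hφ]
  have hoff : ∀ s, s ∉ sin '' S → h s = 0 := fun s hs => indicator_of_notMem hs _
  have hm : Measurable h := by
    apply Measurable.indicator _ hTm
    apply (hG.comp hψ).div
    exact Complex.measurable_ofReal.comp ((continuous_abs.measurable).comp (continuous_cos.measurable.comp hψ))
  have hhb : ∀ s, ‖h s‖ ≤ L := by
    intro s
    by_cases hs : s ∈ sin '' S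
    · obtain ⟨φ, hφ, rfl⟩ := hs
      rw [hsin φ hφ, norm_div, Complex.norm_real, norm_abs_eq_norm, Real.norm_eq_abs,
        div_le_iff₀ (abs_pos.2 (hc φ hφ))]
      exact hb φ hφ
    · rw [hoff s hs]; simpa using hL
  have hder : ∀ x ∈ S, HasDerivWithinAt sin (cos x) S x := fun x _ => (hasDerivAt_sin x).hasDerivWithinAt
  have e1 : ∀ y : ℝ, ∫ φ in S, G φ * Complex.exp (Complex.I * Complex.ofReal (y * sin φ))
      = ∫ s in Ioc (-π) π, h s * Complex.exp (Complex.I * Complex.ofReal (y * s)) := by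
    intro y
    rw [setIntegral_eq_of_subset_of_forall_sdiff_eq_zero measurableSet_Ioc hTs
      (fun s hs => by rw [hoff s hs.2, zero_mul]),
      integral_image_eq_integral_abs_deriv_smul hS hder hinj]
    refine setIntegral_congr_fun hS fun φ hφ => ?_
    rw [hsin φ hφ, Complex.real_smul]
    have : ((|cos φ| : ℝ) : ℂ) ≠ 0 := by exact_mod_cast (abs_pos.2 (hc φ hφ)).ne'
    field_simp
  simp_rw [e1]
  rw [planch h hm L hhb]
  congr 1
  have e2 : ∫⁻ s in Ioc (-π) π, ‖h s‖ₑ ^ 2 = ∫⁻ s in sin '' S, ‖h s‖ₑ ^ 2 := by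
    symm
    rw [← lintegral_indicator measurableSet_Ioc, ← lintegral_indicator hTm]
    refine lintegral_congr fun s => ?_
    by_cases hs : s ∈ sin '' S
    · rw [indicator_of_mem hs, indicator_of_mem (hTs hs)]
    · rw [indicator_of_notMem hs]
      by_cases hs' : s ∈ Ioc (-π) π
      · rw [indicator_of_mem hs', hoff s hs]; simp
      · rw [indicator_of_notMem hs']
  rw [e2, lintegral_image_eq_lintegral_abs_deriv_mul hS hder hinj]
  refine setLIntegral_congr_fun hS fun φ hφ => ?_
  rw [hsin φ hφ, ← ofReal_norm, ← ENNReal.ofReal_pow (norm_nonneg _),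
    ← ENNReal.ofReal_mul (abs_nonneg _), norm_div, Complex.norm_real, norm_abs_eq_norm, Real.norm_eq_abs]
  congr 1
  have := abs_pos.2 (hc φ hφ)
  field_simp

/-- the weak-type consequence of `piece`. -/
lemma piece_weak (S : Set ℝ) (hS : MeasurableSet S) (ψ : ℝ → ℝ) (hψ : Measurable ψ)
    (hl : ∀ φ ∈ S, ψ (sin φ) = φ) (hc : ∀ φ ∈ S, cos φ ≠ 0)
    (G : ℝ → ℂ) (hG : Measurable G) (L : ℝ) (hL : 0 ≤ L) (hb : ∀ φ ∈ S, ‖G φ‖ ≤ L * |cos φ|)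
    (t : ℝ) (ht : 0 < t) :
    volume {y : ℝ | t ≤ ‖∫ φ in S, G φ * Complex.exp (Complex.I * Complex.ofReal (y * sin φ))‖}
      ≤ ENNReal.ofReal (2 * π / t ^ 2) * ∫⁻ φ in S, ENNReal.ofReal (‖G φ‖ ^ 2 / |cos φ|) := by
  have hHm : Measurable (fun y : ℝ =>
      ∫ φ in S, G φ * Complex.exp (Complex.I * Complex.ofReal (y * sin φ))) := by
    apply StronglyMeasurable.measurable
    apply StronglyMeasurable.integral_prod_right (f := fun y s : ℝ => G s * Complex.exp (Complex.I * Complex.ofReal (y * sin s)))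
    apply Measurable.stronglyMeasurable
    apply (hG.comp measurable_snd).mul
    fun_prop
  have := mul_meas_ge_le_lintegral (μ := volume) (hHm.enorm.pow_const 2) (ENNReal.ofReal (t ^ 2))
  rw [piece S hS ψ hψ hl hc G hG L hL hb] at this
  have hset : {y : ℝ | t ≤ ‖∫ φ in S, G φ * Complex.exp (Complex.I * Complex.ofReal (y * sin φ))‖}
    = {y : ℝ | ENNReal.ofReal (t ^ 2) ≤ ‖∫ φ in S, G φ * Complex.exp (Complex.I * Complex.ofReal (y * sin φ))‖ₑ ^ 2} := by
    ext y
    simp only [mem_ofPred_eq]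
    rw [← ofReal_norm, ← ENNReal.ofReal_pow (norm_nonneg _), ENNReal.ofReal_le_ofReal_iff (by positivity),
      sq_le_sq₀ ht.le (norm_nonneg _)]
  rw [hset, ENNReal.ofReal_div_of_pos (by positivity), ENNReal.mul_div_right_comm.symm, 
    ENNReal.le_div_iff_mul_le (Or.inl (by simpa using ht.ne')) (Or.inl ENNReal.ofReal_ne_top), mul_comm]
  exact this

lemma cosneg {φ : ℝ} (h1 : π / 2 < φ) (h2 : φ < 3 * π / 2) : cos φ ≠ 0 :=
  (cos_neg_of_pi_div_two_lt_of_lt h1 (by linarith)).ne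

/-- Weak L² bound on the circle. -/
lemma circle_weak (G : ℝ → ℂ) (hG : Measurable G) (L : ℝ) (hL : 0 ≤ L)
    (hb : ∀ φ, ‖G φ‖ ≤ L * |cos φ|) (t : ℝ) (ht : 0 < t) :
    volume {y : ℝ | t ≤ ‖∫ φ in (0:ℝ)..(2 * π), G φ * Complex.exp (Complex.I * Complex.ofReal (y * sin φ))‖}
      ≤ ENNReal.ofReal (18 * π / t ^ 2) * ∫⁻ φ in Ioc 0 (2 * π), ENNReal.ofReal (‖G φ‖ ^ 2 / |cos φ|) := by
  have hpi := pi_pos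
  set I : Set ℝ → ℝ → ℂ := fun S y => ∫ φ in S, G φ * Complex.exp (Complex.I * Complex.ofReal (y * sin φ)) with hI
  set J : Set ℝ → ℝ≥0∞ := fun S => ∫⁻ φ in S, ENNReal.ofReal (‖G φ‖ ^ 2 / |cos φ|) with hJ
  set S1 : Set ℝ := Ioo 0 (π / 2)
  set S2 : Set ℝ := Ioo (π / 2) (3 * π / 2)
  set S3 : Set ℝ := Ioo (3 * π / 2) (2 * π)
  have ht3 : 0 < t / 3 := by positivity
  have w1 : volume {y : ℝ | t / 3 ≤ ‖I S1 y‖} ≤ ENNReal.ofReal (2 * π / (t / 3) ^ 2) * J S1 := by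
    refine piece_weak S1 measurableSet_Ioo arcsin measurable_arcsin ?_ ?_ G hG L hL (fun φ _ => hb φ) _ ht3
    · intro φ hφ
      exact arcsin_sin (by linarith [hφ.1]) hφ.2.le
    · intro φ hφ
      exact (cos_pos_of_mem_Ioo ⟨by linarith [hφ.1], hφ.2⟩).ne'
  have w2 : volume {y : ℝ | t / 3 ≤ ‖I S2 y‖} ≤ ENNReal.ofReal (2 * π / (t / 3) ^ 2) * J S2 := by
    refine piece_weak S2 measurableSet_Ioo (fun s => π - arcsin s) (measurable_arcsin.const_sub _) ?_ ?_ G hG L hL (fun φ _ => hb φ) _ ht3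
    · intro φ hφ
      show π - arcsin (sin φ) = φ
      rw [← sin_pi_sub, arcsin_sin (by linarith [hφ.2]) (by linarith [hφ.1])]
      ring
    · intro φ hφ
      exact cosneg hφ.1 hφ.2
  have w3 : volume {y : ℝ | t / 3 ≤ ‖I S3 y‖} ≤ ENNReal.ofReal (2 * π / (t / 3) ^ 2) * J S3 := by
    refine piece_weak S3 measurableSet_Ioo (fun s => 2 * π + arcsin s) (measurable_arcsin.const_add _) ?_ ?_ G hG L hL (fun φ _ => hb φ) _ ht3
    · intro φ hφ
      show 2 * π + arcsin (sin φ) = φ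
      rw [← sin_sub_two_pi, arcsin_sin (by linarith [hφ.1]) (by linarith [hφ.2])]
      ring
    · intro φ hφ
      rw [← cos_sub_two_pi]
      exact (cos_pos_of_mem_Ioo ⟨by linarith [hφ.1], by linarith [hφ.2]⟩).ne'
  have hint : ∀ y a b, IntervalIntegrable (fun φ => G φ * Complex.exp (Complex.I * Complex.ofReal (y * sin φ))) volume a b := by
    intro y a b
    refine (intervalIntegrable_const (c := L)).mono_fun ?_ (ae_of_all _ fun φ => ?_)
    · apply Measurable.aestronglyMeasurable
      apply hG.mul
      fun_prop
    · simp only [norm_mul, mul_comm Complex.I, Complex.norm_exp_ofReal_mul_I, mul_one]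
      refine (hb φ).trans ?_
      rw [Real.norm_of_nonneg hL]
      exact mul_le_of_le_one_right hL (abs_cos_le_one φ)
  have hdec : ∀ y : ℝ, ∫ φ in (0:ℝ)..(2 * π), G φ * Complex.exp (Complex.I * Complex.ofReal (y * sin φ))
      = I S1 y + I S2 y + I S3 y := by
    intro y
    rw [← intervalIntegral.integral_add_adjacent_intervals (hint y 0 (3 * π / 2)) (hint y _ _),
      ← intervalIntegral.integral_add_adjacent_intervals (hint y 0 (π / 2)) (hint y _ _),
      intervalIntegral.integral_of_le (by linarith), intervalIntegral.integral_of_le (by linarith),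
      intervalIntegral.integral_of_le (by linarith), integral_Ioc_eq_integral_Ioo,
      integral_Ioc_eq_integral_Ioo, integral_Ioc_eq_integral_Ioo]
  have hsub : {y : ℝ | t ≤ ‖∫ φ in (0:ℝ)..(2 * π), G φ * Complex.exp (Complex.I * Complex.ofReal (y * sin φ))‖}
      ⊆ ({y : ℝ | t / 3 ≤ ‖I S1 y‖} ∪ {y : ℝ | t / 3 ≤ ‖I S2 y‖}) ∪ {y : ℝ | t / 3 ≤ ‖I S3 y‖} := by
    intro y hy
    by_contra hcon
    simp only [mem_union, mem_ofPred_eq, not_or, not_le] at hcon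
    rw [mem_ofPred_eq, hdec] at hy
    have := norm_add₃_le (a := I S1 y) (b := I S2 y) (c := I S3 y)
    linarith [hcon.1.1, hcon.1.2, hcon.2]
  have hJs : J S1 + J S2 + J S3 ≤ J (Ioc 0 (2 * π)) := by
    rw [hJ]
    simp only
    rw [← lintegral_union measurableSet_Ioo, ← lintegral_union measurableSet_Ioo]
    · apply lintegral_mono_set
      rintro φ ((h | h) | h)
      · exact ⟨h.1, by linarith [h.2]⟩
      · exact ⟨by linarith [h.1], by linarith [h.2]⟩
      · exact ⟨by linarith [h.1], by linarith [h.2]⟩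
    · rw [Set.disjoint_left]
      rintro φ (h | h) h'
      · linarith [h.2, h'.1]
      · linarith [h.2, h'.1]
    · rw [Set.disjoint_left]
      rintro φ h h'
      linarith [h.2, h'.1]
  calc _ ≤ _ := measure_mono hsub
    _ ≤ _ := (measure_union_le _ _).trans (add_le_add (measure_union_le _ _) le_rfl)
    _ ≤ _ := add_le_add (add_le_add w1 w2) w3
    _ = ENNReal.ofReal (18 * π / t ^ 2) * (J S1 + J S2 + J S3) := by
      have : 2 * π / (t / 3) ^ 2 = 18 * π / t ^ 2 := by field_simp; ring
      rw [this]; ring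
    _ ≤ _ := mul_le_mul_right hJs _

lemma rpow_int (a m : ℝ) (ha1 : a < 1) (hm : 0 < m) :
    ∫⁻ u in Ioc 0 m, ENNReal.ofReal (u ^ (-a)) = ENNReal.ofReal (m ^ (1 - a) / (1 - a)) := by
  have h := integral_rpow (a := 0) (b := m) (r := -a) (Or.inl (by linarith))
  rw [intervalIntegral.integral_of_le hm.le, zero_rpow (by linarith), sub_zero] at h
  rw [← ofReal_integral_eq_lintegral_ofReal, h]
  · congr 2 <;> ring_nf
  · have := intervalIntegral.intervalIntegrable_rpow' (a := 0) (b := m) (r := -a) (by linarith)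
    rwa [intervalIntegrable_iff_integrableOn_Ioc_of_le hm.le] at this
  · refine (ae_restrict_iff' measurableSet_Ioc).2 (ae_of_all _ fun u hu => ?_)
    exact rpow_nonneg hu.1.le _

lemma abs_int (f : ℝ → ℝ≥0∞) (c : ℝ) :
    ∫⁻ φ, f |φ - c| = 2 * ∫⁻ u in Ioi 0, f u := by
  rw [lintegral_sub_right_eq_self (fun u => f |u|) c,
    ← lintegral_add_compl _ (measurableSet_Ioi (a := (0:ℝ))), two_mul]
  congr 1
  · refine setLIntegral_congr_fun measurableSet_Ioi fun u hu => ?_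
    rw [abs_of_pos hu]
  · have h := (Measure.measurePreserving_neg (volume : Measure ℝ)).setLIntegral_comp_emb
      (MeasurableEquiv.neg ℝ).measurableEmbedding f (Iic 0)
    have h2 : ∫⁻ u in (Ioi (0:ℝ))ᶜ, f |u| = ∫⁻ u in Iic (0:ℝ), f (-u) := by
      rw [compl_Ioi]
      refine setLIntegral_congr_fun measurableSet_Iic fun u hu => ?_
      rw [abs_of_nonpos hu]
    rw [h2]
    refine h.trans ?_
    rw [image_neg_eq_neg, neg_Iic, neg_zero]
    exact setLIntegral_congr Ioi_ae_eq_Ici.symm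

lemma pw (a : ℝ) (ha0 : 0 < a) (ha1 : a < 1) (c : ℝ) (E : Set ℝ) (hE : volume E ≠ ⊤) :
    ∫⁻ φ in E, ENNReal.ofReal (|φ - c| ^ (-a)) ≤ ENNReal.ofReal (1 + 2 / (1 - a)) * volume E ^ (1 - a) := by
  by_cases h0 : volume E = 0
  · rw [setLIntegral_measure_zero _ _ h0]; exact zero_le
  obtain ⟨m, hm, hmE⟩ : ∃ m : ℝ, 0 < m ∧ volume E = ENNReal.ofReal m :=
    ⟨(volume E).toReal, ENNReal.toReal_pos h0 hE, (ENNReal.ofReal_toReal hE).symm⟩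
  set f : ℝ → ℝ≥0∞ := (Iic m).indicator fun u => ENNReal.ofReal (u ^ (-a)) with hf
  have hle : ∀ φ : ℝ, ENNReal.ofReal (|φ - c| ^ (-a)) ≤ ENNReal.ofReal (m ^ (-a)) + f |φ - c| := by
    intro φ
    by_cases h : |φ - c| ≤ m
    · rw [hf, indicator_of_mem (by exact h)]
      exact le_add_self
    · refine le_trans (ENNReal.ofReal_le_ofReal ?_) le_self_add
      push Not at h
      exact rpow_le_rpow_of_nonpos hm h.le (by linarith)
  have hfi : ∫⁻ u in Ioi 0, f u = ENNReal.ofReal (m ^ (1 - a) / (1 - a)) := by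
    rw [← rpow_int a m ha1 hm, hf, lintegral_indicator measurableSet_Iic, Measure.restrict_restrict measurableSet_Iic,
      inter_comm, Ioi_inter_Iic]
  have h1a : 0 < 1 - a := by linarith
  have hr : 0 < m ^ (1 - a) := rpow_pos_of_pos hm _
  calc ∫⁻ φ in E, ENNReal.ofReal (|φ - c| ^ (-a)) ≤ ∫⁻ φ in E, (ENNReal.ofReal (m ^ (-a)) + f |φ - c|) :=
        lintegral_mono hle
    _ = ENNReal.ofReal (m ^ (-a)) * volume E + ∫⁻ φ in E, f |φ - c| := by
        rw [lintegral_add_left measurable_const, setLIntegral_const]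
    _ ≤ ENNReal.ofReal (m ^ (-a)) * volume E + ∫⁻ φ, f |φ - c| := by
        gcongr
        exact Measure.restrict_le_self
    _ = ENNReal.ofReal (1 + 2 / (1 - a)) * volume E ^ (1 - a) := by
        rw [abs_int, hfi, hmE, ENNReal.ofReal_rpow_of_pos hm, ← ENNReal.ofReal_mul (by positivity),
          ← ENNReal.ofReal_mul (by positivity)]
        have : (2 : ℝ≥0∞) = ENNReal.ofReal 2 := by simp
        rw [this, ← ENNReal.ofReal_mul (by norm_num), ← ENNReal.ofReal_add (by positivity) (by positivity)]
        congr 1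
        have : m ^ (-a) * m = m ^ (1 - a) := by
          rw [← rpow_add_one hm.ne']; congr 1; ring
        rw [this]; field_simp

lemma cos_lower {φ : ℝ} (h0 : 0 ≤ φ) (h1 : φ ≤ 2 * π) :
    2 / π * |φ - π / 2| ≤ |cos φ| ∨ 2 / π * |φ - 3 * π / 2| ≤ |cos φ| := by
  by_cases h : φ ≤ π
  · left
    have := mul_abs_le_abs_sin (x := φ - π / 2) (by rw [abs_le]; constructor <;> linarith)
    rwa [sin_sub_pi_div_two, abs_neg] at this
  · right
    push Not at h
    have := mul_abs_le_abs_sin (x := φ - 3 * π / 2) (by rw [abs_le]; constructor <;> linarith)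
    have e : sin (φ - 3 * π / 2) = cos φ := by
      rw [show φ - 3 * π / 2 = φ - π - π / 2 by ring, sin_sub_pi_div_two, cos_sub_pi, neg_neg]
    rwa [e] at this

lemma neg_rpow_bd {a x z : ℝ} (ha0 : 0 < a) (ha1 : a < 1) (hx : 0 ≤ x) (h : 2 / π * x ≤ z) (hz : x = 0 → z = 0) :
    z ^ (-a) ≤ 2 * x ^ (-a) := by
  rcases hx.eq_or_lt with rfl | hx
  · rw [hz rfl, zero_rpow (by linarith)]; simp
  have hpi := pi_pos
  have : 0 < 2 / π * x := by positivity
  calc z ^ (-a) ≤ (2 / π * x) ^ (-a) := rpow_le_rpow_of_nonpos this h (by linarith)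
    _ = (2 / π) ^ (-a) * x ^ (-a) := mul_rpow (by positivity) hx.le
    _ ≤ 2 * x ^ (-a) := by
      gcongr
      rw [rpow_neg (by positivity), ← inv_rpow (by positivity), inv_div]
      calc (π / 2) ^ a ≤ (π / 2) ^ (1:ℝ) := rpow_le_rpow_of_exponent_le (by linarith [pi_gt_three]) ha1.le
        _ ≤ 2 := by rw [rpow_one]; linarith [pi_le_four]

lemma cw (a : ℝ) (ha0 : 0 < a) (ha1 : a < 1) (E : Set ℝ) (hEm : MeasurableSet E) (hE : E ⊆ Icc 0 (2 * π)) :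
    ∫⁻ φ in E, ENNReal.ofReal (|cos φ| ^ (-a)) ≤ ENNReal.ofReal (4 * (1 + 2 / (1 - a))) * volume E ^ (1 - a) := by
  have hfin : volume E ≠ ⊤ := ((measure_mono hE).trans_lt measure_Icc_lt_top).ne
  have h1a : 0 < 1 - a := by linarith
  have hle : ∀ φ ∈ E, ENNReal.ofReal (|cos φ| ^ (-a)) ≤
      2 * (ENNReal.ofReal (|φ - π / 2| ^ (-a)) + ENNReal.ofReal (|φ - 3 * π / 2| ^ (-a))) := by
    intro φ hφ
    have h2 : (2 : ℝ≥0∞) = ENNReal.ofReal 2 := by simp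
    rw [h2, mul_add, ← ENNReal.ofReal_mul (by norm_num), ← ENNReal.ofReal_mul (by norm_num)]
    rcases cos_lower (hE hφ).1 (hE hφ).2 with h | h
    · refine le_trans (ENNReal.ofReal_le_ofReal (neg_rpow_bd ha0 ha1 (abs_nonneg _) h ?_)) le_self_add
      intro h0
      have : φ = π / 2 := by linarith [abs_eq_zero.1 h0]
      rw [this]; simp
    · refine le_trans (ENNReal.ofReal_le_ofReal (neg_rpow_bd ha0 ha1 (abs_nonneg _) h ?_)) le_add_self
      intro h0
      have : φ = π / 2 + π := by linarith [abs_eq_zero.1 h0]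
      rw [this, cos_add_pi]; simp
  calc _ ≤ ∫⁻ φ in E, 2 * (ENNReal.ofReal (|φ - π / 2| ^ (-a)) + ENNReal.ofReal (|φ - 3 * π / 2| ^ (-a))) :=
        setLIntegral_mono' hEm hle
    _ = 2 * ((∫⁻ φ in E, ENNReal.ofReal (|φ - π / 2| ^ (-a))) + ∫⁻ φ in E, ENNReal.ofReal (|φ - 3 * π / 2| ^ (-a))) := by
        rw [lintegral_const_mul _ (by fun_prop), lintegral_add_left (by fun_prop)]
    _ ≤ 2 * (ENNReal.ofReal (1 + 2 / (1 - a)) * volume E ^ (1 - a) + ENNReal.ofReal (1 + 2 / (1 - a)) * volume E ^ (1 - a)) := by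
        gcongr
        · exact pw a ha0 ha1 _ E hfin
        · exact pw a ha0 ha1 _ E hfin
    _ = _ := by
        rw [ENNReal.ofReal_mul (by norm_num)]
        have : ENNReal.ofReal 4 = 4 := by simp
        rw [this]; ring

def El (F : ℝ → ℂ) (t : ℝ) : Set ℝ := {φ ∈ Icc (0:ℝ) (2 * π) | t < ‖F φ‖}

lemma El_meas (F : ℝ → ℂ) (hF : Measurable F) (t : ℝ) : MeasurableSet (El F t) :=
  measurableSet_Icc.inter (measurableSet_lt measurable_const hF.norm)

lemma El_sub (F : ℝ → ℂ) (t : ℝ) : El F t ⊆ Icc 0 (2 * π) := fun _ h => h.1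

lemma El_vol (F : ℝ → ℂ) (t : ℝ) : volume (El F t) ≤ ENNReal.ofReal (2 * π) :=
  (measure_mono (El_sub F t)).trans (by simp)

lemma El_anti (F : ℝ → ℂ) {s t : ℝ} (h : s ≤ t) : El F t ⊆ El F s :=
  fun _ hx => ⟨hx.1, h.trans_lt hx.2⟩

/-- monotone Chebyshev. -/
lemma El_cheb (F : ℝ → ℂ) (r : ℝ) (hr : 1 ≤ r) (t : ℝ) :
    ENNReal.ofReal t * volume (El F t) ^ (1 / r) ≤ ∫⁻ t in Ioi (0:ℝ), volume (El F t) ^ (1 / r) := by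
  calc ENNReal.ofReal t * volume (El F t) ^ (1 / r) = ∫⁻ s in Ioc 0 t, volume (El F t) ^ (1 / r) := by
        rw [setLIntegral_const, Real.volume_Ioc, sub_zero, mul_comm]
    _ ≤ ∫⁻ s in Ioc 0 t, volume (El F s) ^ (1 / r) := by
        refine setLIntegral_mono' measurableSet_Ioc fun s hs => ?_
        exact ENNReal.rpow_le_rpow (measure_mono (El_anti F hs.2)) (by positivity)
    _ ≤ _ := lintegral_mono_set Ioc_subset_Ioi_self

lemma vol_pow_bd (F : ℝ → ℂ) (t e d : ℝ) (hd : 0 ≤ d) (hed : d ≤ e) :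
    volume (El F t) ^ e ≤ ENNReal.ofReal ((2 * π) ^ (e - d)) * volume (El F t) ^ d := by
  have hpi := pi_pos
  rw [show e = (e - d) + d by ring, ENNReal.rpow_add_of_nonneg _ _ (by linarith) hd]
  gcongr
  rw [show e - d + d - d = e - d by ring, ← ENNReal.ofReal_rpow_of_pos (by positivity)]
  exact ENNReal.rpow_le_rpow (El_vol F t) (by linarith)

lemma L1_bd (F : ℝ → ℂ) (hF : Measurable F) (r : ℝ) (hr : 1 ≤ r) :
    ∫⁻ φ in Icc 0 (2 * π), ‖F φ‖ₑ ≤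
      ENNReal.ofReal ((2 * π) ^ (1 - 1 / r)) * ∫⁻ t in Ioi (0:ℝ), volume (El F t) ^ (1 / r) := by
  have h := lintegral_eq_lintegral_meas_lt (volume.restrict (Icc 0 (2 * π))) (f := fun φ => ‖F φ‖)
    (ae_of_all _ fun _ => norm_nonneg _) hF.norm.aemeasurable
  simp only [ofReal_norm] at h
  rw [h, ← lintegral_const_mul']
  · refine lintegral_mono fun t => ?_
    have e : (volume.restrict (Icc 0 (2 * π))) {φ | t < ‖F φ‖} = volume (El F t) := by
      rw [Measure.restrict_apply (measurableSet_lt measurable_const hF.norm), inter_comm]; rfl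
    have h1 : 1 / r ≤ 1 := by rw [div_le_one (by linarith)]; exact hr
    have := vol_pow_bd F t 1 (1 / r) (by positivity) h1
    rw [ENNReal.rpow_one] at this
    simp only [e]
    exact this
  · exact ENNReal.ofReal_ne_top

lemma Lp_bd (F : ℝ → ℂ) (hF : Measurable F) (r p : ℝ) (hr : 1 ≤ r) (hp1 : 1 < p) (hp2 : p < 2)
    (hrp : 1 / r ≤ 2 / p - 1) :
    ∫⁻ φ in Icc 0 (2 * π), ENNReal.ofReal (|cos φ| ^ (-(p - 1)) * ‖F φ‖ ^ p) ≤
      ENNReal.ofReal (p * (4 * (1 + 2 / (1 - (p - 1)))) * (2 * π) ^ (2 - p - p / r)) *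
        (∫⁻ t in Ioi (0:ℝ), volume (El F t) ^ (1 / r)) ^ p := by
  have hpi := pi_pos
  have hr0 : 0 < r := by linarith
  have hp0 : 0 < p := by linarith
  set Λ := ∫⁻ t in Ioi (0:ℝ), volume (El F t) ^ (1 / r) with hΛ
  set K : ℝ := 4 * (1 + 2 / (1 - (p - 1))) with hK
  have hK0 : 0 ≤ K := by
    have : 0 < 1 - (p - 1) := by linarith
    positivity
  set D : ℝ := (2 * π) ^ (2 - p - p / r)
  have hD0 : 0 ≤ D := by positivity
  have hpr : p / r ≤ 2 - p := by
    have := mul_le_mul_of_nonneg_left hrp hp0.le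
    have e1 : p * (2 / p - 1) = 2 - p := by field_simp
    have e2 : p * (1 / r) = p / r := by ring
    linarith
  set w : ℝ → ℝ≥0∞ := fun φ => ENNReal.ofReal (|cos φ| ^ (-(p - 1))) with hw
  have hwm : Measurable w := by
    apply ENNReal.measurable_ofReal.comp
    exact (continuous_cos.abs.measurable).pow_const _
  set μ : Measure ℝ := (volume.restrict (Icc 0 (2 * π))).withDensity w with hμ
  have h1 : ∫⁻ φ in Icc 0 (2 * π), ENNReal.ofReal (|cos φ| ^ (-(p - 1)) * ‖F φ‖ ^ p)
      = ∫⁻ φ, ENNReal.ofReal (‖F φ‖ ^ p) ∂μ := by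
    rw [hμ, lintegral_withDensity_eq_lintegral_mul _ hwm
      (hF.norm.pow_const p).ennreal_ofReal]
    refine lintegral_congr fun φ => ?_
    rw [ENNReal.ofReal_mul (by positivity)]; rfl
  rw [h1, lintegral_rpow_eq_lintegral_meas_lt_mul μ (ae_of_all _ fun _ => norm_nonneg _) hF.norm.aemeasurable hp0]
  have key : ∀ t ∈ Ioi (0:ℝ), μ {φ | t < ‖F φ‖} * ENNReal.ofReal (t ^ (p - 1)) ≤
      ENNReal.ofReal (K * D) * Λ ^ (p - 1) * volume (El F t) ^ (1 / r) := by
    intro t ht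
    have ht : 0 < t := ht
    have hms : MeasurableSet {φ | t < ‖F φ‖} := measurableSet_lt measurable_const hF.norm
    have e : μ {φ | t < ‖F φ‖} = ∫⁻ φ in El F t, w φ := by
      rw [hμ, withDensity_apply _ hms, Measure.restrict_restrict hms, inter_comm]; rfl
    set m := volume (El F t)
    have hm : μ {φ | t < ‖F φ‖} ≤ ENNReal.ofReal (K * D) * m ^ (p / r) := by
      rw [e]
      refine (cw (p - 1) (by linarith) (by linarith) _ (El_meas F hF t) (El_sub F t)).trans ?_
      rw [ENNReal.ofReal_mul hK0, mul_assoc]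
      gcongr
      have := vol_pow_bd F t (2 - p) (p / r) (by positivity) hpr
      rw [show 1 - (p - 1) = 2 - p by ring]
      exact this
    have e3 : m ^ (p / r) = (m ^ (1 / r)) ^ (p - 1) * m ^ (1 / r) := by
      rw [← ENNReal.rpow_mul, ← ENNReal.rpow_add_of_nonneg]
      · congr 1; field_simp; ring
      · have : 0 ≤ p - 1 := by linarith
        positivity
      · positivity
    calc _ ≤ ENNReal.ofReal (K * D) * m ^ (p / r) * ENNReal.ofReal (t ^ (p - 1)) := by gcongr
      _ = ENNReal.ofReal (K * D) * (ENNReal.ofReal t * m ^ (1 / r)) ^ (p - 1) * m ^ (1 / r) := by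
        rw [ENNReal.mul_rpow_of_nonneg _ _ (by linarith), e3, ENNReal.ofReal_rpow_of_pos ht]; ring
      _ ≤ _ := by
        refine mul_le_mul_left (mul_le_mul_right (ENNReal.rpow_le_rpow (El_cheb F r hr t) ?_) _) _
        linarith
  calc _ ≤ ENNReal.ofReal p * ∫⁻ t in Ioi (0:ℝ), ENNReal.ofReal (K * D) * Λ ^ (p - 1) * volume (El F t) ^ (1 / r) := by
        refine mul_le_mul_right ?_ _
        exact setLIntegral_mono' measurableSet_Ioi key
    _ = ENNReal.ofReal p * (ENNReal.ofReal (K * D) * Λ ^ (p - 1) * Λ) := by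
        rw [lintegral_const_mul'' ]
        apply Measurable.aemeasurable
        have : Antitone fun t => volume (El F t) ^ (1 / r) := fun s t h =>
          ENNReal.rpow_le_rpow (measure_mono (El_anti F h)) (by positivity)
        exact this.measurable
    _ = _ := by
        have : Λ ^ p = Λ ^ (p - 1) * Λ := by
          nth_rewrite 3 [← ENNReal.rpow_one Λ]
          rw [← ENNReal.rpow_add_of_nonneg _ _ (by linarith) (by norm_num)]
          congr 1; ring
        rw [this, mul_assoc p, ENNReal.ofReal_mul hp0.le]; ring

lemma Rext_eq (F : ℝ → ℂ) (x y : ℝ) : Rext F x y = Complex.ofReal (1 / (2 * π)) *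
    ∫ φ in (0:ℝ)..(2 * π), (F φ * Complex.exp (Complex.I * Complex.ofReal (x * cos φ))) *
      Complex.exp (Complex.I * Complex.ofReal (y * sin φ)) := by
  rw [Rext]
  congr 1
  refine intervalIntegral.integral_congr fun φ _ => ?_
  rw [mul_assoc, ← Complex.exp_add]
  congr 2
  push_cast; ring

lemma norm_mul_expI (z : ℂ) (s : ℝ) : ‖z * Complex.exp (Complex.I * Complex.ofReal s)‖ = ‖z‖ := by
  rw [norm_mul, mul_comm Complex.I, Complex.norm_exp_ofReal_mul_I, mul_one]

lemma core_fixed (p b C1 N t x : ℝ) (F : ℝ → ℂ) (hF : Measurable F) (hp1 : 1 < p) (hp2 : p < 2)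
    (hb : b * (p - 1) = 1) (hC1 : 0 < C1) (hN : 0 < N) (ht : 0 < t)
    (hint : IntegrableOn F (Icc 0 (2 * π)))
    (hM : ∫⁻ φ in Icc 0 (2 * π), ENNReal.ofReal (|cos φ| ^ (-(p - 1)) * ‖F φ‖ ^ p) ≤ ENNReal.ofReal (C1 * N ^ p)) :
    volume {y : ℝ | t < ‖Rext F x y‖} ≤ ENNReal.ofReal (18 * (C1 / π) ^ b * (N / t) ^ (b + 1)) := by
  have hpi := pi_pos
  set L : ℝ := (C1 / π) ^ b * (N * (N / t) ^ b) with hLdef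
  have hL : 0 < L := by positivity
  have hLp : L ^ (-(p - 1)) * (C1 * N ^ p) = π * t := by
    have e1 : L ^ (-(p - 1)) = (C1 / π)⁻¹ * (N ^ (-(p - 1)) * (N / t)⁻¹) := by
      rw [hLdef, mul_rpow (by positivity) (by positivity), mul_rpow (by positivity) (by positivity),
        ← rpow_mul (by positivity), ← rpow_mul (by positivity),
        show b * -(p - 1) = -1 by linarith, rpow_neg_one, rpow_neg_one]
    have e2 : N ^ p = N ^ (p - 1) * N := by
      rw [← rpow_add_one hN.ne']; congr 1; ring
    rw [e1, e2, rpow_neg hN.le]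
    have : 0 < N ^ (p - 1) := by positivity
    field_simp
  set G : ℝ → ℂ := fun φ => F φ * Complex.exp (Complex.I * Complex.ofReal (x * cos φ)) with hGdef
  have hGn : ∀ φ, ‖G φ‖ = ‖F φ‖ := fun φ => norm_mul_expI _ _
  have hGm : Measurable G := by
    apply hF.mul; fun_prop
  set A : Set ℝ := {φ | L * |cos φ| < ‖F φ‖} with hA
  have hAm : MeasurableSet A := by
    apply measurableSet_lt _ hF.norm
    exact (continuous_cos.abs.measurable).const_mul L
  set GA := A.indicator G with hGA
  set GB := Aᶜ.indicator G with hGB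
  have hGAm : Measurable GA := hGm.indicator hAm
  have hGBm : Measurable GB := hGm.indicator hAm.compl
  have hsum : ∀ φ, G φ = GA φ + GB φ := fun φ => (congrFun (indicator_self_add_compl A G) φ).symm
  have hGAle : ∀ φ, ‖GA φ‖ ≤ ‖F φ‖ := fun φ => (norm_indicator_le_norm_self _ _).trans (hGn φ).le
  have hGBle : ∀ φ, ‖GB φ‖ ≤ ‖F φ‖ := fun φ => (norm_indicator_le_norm_self _ _).trans (hGn φ).le
  have hint' : IntegrableOn F (Ioc 0 (2 * π)) := hint.mono_set Ioc_subset_Icc_self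
  have hii : ∀ (H : ℝ → ℂ) (y : ℝ), Measurable H → (∀ φ, ‖H φ‖ ≤ ‖F φ‖) →
      IntervalIntegrable (fun φ => H φ * Complex.exp (Complex.I * Complex.ofReal (y * sin φ))) volume 0 (2 * π) := by
    intro H y hH hle
    rw [intervalIntegrable_iff_integrableOn_Ioc_of_le (by positivity)]
    refine Integrable.mono hint' ?_ (ae_of_all _ fun φ => ?_)
    · apply Measurable.aestronglyMeasurable
      apply hH.mul; fun_prop
    · rw [norm_mul_expI]; exact hle φ
  have hcos : ∀ᵐ φ : ℝ, cos φ ≠ 0 := by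
    have : {φ : ℝ | cos φ = 0} ⊆ range (fun k : ℤ => (2 * (k:ℝ) + 1) * π / 2) := by
      intro φ hφ
      obtain ⟨k, hk⟩ := cos_eq_zero_iff.1 hφ
      exact ⟨k, hk.symm⟩
    have h0 := ((countable_range _).mono this).measure_zero volume
    simpa [ae_iff] using h0
  -- bound for the A part
  have hAb : ∀ y : ℝ, ‖∫ φ in (0:ℝ)..(2 * π), GA φ * Complex.exp (Complex.I * Complex.ofReal (y * sin φ))‖ ≤ π * t := by
    intro y
    rw [intervalIntegral.integral_of_le (by positivity), ← ENNReal.ofReal_le_ofReal_iff (by positivity), ofReal_norm]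
    refine (enorm_integral_le_lintegral_enorm _).trans ?_
    calc _ ≤ ∫⁻ φ in Ioc 0 (2 * π), ENNReal.ofReal (L ^ (-(p - 1))) * ENNReal.ofReal (|cos φ| ^ (-(p - 1)) * ‖F φ‖ ^ p) := by
          apply lintegral_mono_ae
          filter_upwards [ae_restrict_of_ae hcos] with φ hφ
          rw [← ofReal_norm, norm_mul_expI, ← ENNReal.ofReal_mul (by positivity)]
          apply ENNReal.ofReal_le_ofReal
          by_cases hφA : φ ∈ A
          · rw [hGA, indicator_of_mem hφA, hGn]
            have hφA' : L * |cos φ| < ‖F φ‖ := hφA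
            have hc : 0 < |cos φ| := abs_pos.2 hφ
            have hF0 : 0 < ‖F φ‖ := lt_trans (by positivity) hφA'
            have e : ‖F φ‖ ^ p = ‖F φ‖ ^ (p - 1) * ‖F φ‖ := by
              rw [← rpow_add_one hF0.ne']; congr 1; ring
            rw [e, ← mul_assoc, ← mul_rpow hL.le hc.le, ← mul_assoc]
            apply le_mul_of_one_le_left hF0.le
            rw [rpow_neg (by positivity), inv_mul_eq_div, one_le_div (by positivity)]
            exact rpow_le_rpow (by positivity) hφA'.le (by linarith)
          · rw [hGA, indicator_of_notMem hφA, norm_zero]; positivity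
      _ = ENNReal.ofReal (L ^ (-(p - 1))) * ∫⁻ φ in Ioc 0 (2 * π), ENNReal.ofReal (|cos φ| ^ (-(p - 1)) * ‖F φ‖ ^ p) :=
          lintegral_const_mul' _ _ ENNReal.ofReal_ne_top
      _ ≤ ENNReal.ofReal (L ^ (-(p - 1))) * ENNReal.ofReal (C1 * N ^ p) :=
          mul_le_mul_right ((lintegral_mono_set Ioc_subset_Icc_self).trans hM) _
      _ = ENNReal.ofReal (π * t) := by rw [← ENNReal.ofReal_mul (by positivity), hLp]
  -- bound for the B part
  have hBb : ∫⁻ φ in Ioc 0 (2 * π), ENNReal.ofReal (‖GB φ‖ ^ 2 / |cos φ|) ≤ ENNReal.ofReal (L * (π * t)) := by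
    calc _ ≤ ∫⁻ φ in Ioc 0 (2 * π), ENNReal.ofReal (L * L ^ (-(p - 1))) * ENNReal.ofReal (|cos φ| ^ (-(p - 1)) * ‖F φ‖ ^ p) := by
          apply lintegral_mono_ae
          filter_upwards [ae_restrict_of_ae hcos] with φ hφ
          rw [← ENNReal.ofReal_mul (by positivity)]
          apply ENNReal.ofReal_le_ofReal
          by_cases hφA : φ ∈ A
          · have : φ ∉ Aᶜ := fun h => h hφA
            rw [hGB, indicator_of_notMem this, norm_zero]
            simp only [ne_eq, OfNat.ofNat_ne_zero, not_false_eq_true, zero_pow, zero_div]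
            positivity
          · have hφA' : ‖F φ‖ ≤ L * |cos φ| := not_lt.1 hφA
            rw [hGB, indicator_of_mem (by exact hφA), hGn]
            have hc : 0 < |cos φ| := abs_pos.2 hφ
            rcases (norm_nonneg (F φ)).eq_or_lt with h0 | hF0
            · rw [← h0]; simp only [ne_eq, OfNat.ofNat_ne_zero, not_false_eq_true, zero_pow, zero_div]
              positivity
            have e : ‖F φ‖ ^ 2 = ‖F φ‖ ^ (2 - p) * ‖F φ‖ ^ p := by
              rw [← rpow_add hF0, ← rpow_natCast]; congr 1; push_cast; ring
            have e2 : L * L ^ (-(p - 1)) * (|cos φ| ^ (-(p - 1)) * ‖F φ‖ ^ p)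
                = (L * |cos φ|) ^ (2 - p) * ‖F φ‖ ^ p / |cos φ| := by
              have e3 : L * L ^ (-(p - 1)) = L ^ (2 - p) := by
                rw [mul_comm, ← rpow_add_one hL.ne']; congr 1; ring
              have e4 : |cos φ| ^ (-(p - 1)) = |cos φ| ^ (2 - p) / |cos φ| := by
                rw [← rpow_sub_one hc.ne']; congr 1; ring
              rw [e3, e4, mul_rpow hL.le hc.le]; ring
            rw [e, e2]
            gcongr
      _ = ENNReal.ofReal (L * L ^ (-(p - 1))) * ∫⁻ φ in Ioc 0 (2 * π), ENNReal.ofReal (|cos φ| ^ (-(p - 1)) * ‖F φ‖ ^ p) :=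
          lintegral_const_mul' _ _ ENNReal.ofReal_ne_top
      _ ≤ ENNReal.ofReal (L * L ^ (-(p - 1))) * ENNReal.ofReal (C1 * N ^ p) :=
          mul_le_mul_right ((lintegral_mono_set Ioc_subset_Icc_self).trans hM) _
      _ = _ := by rw [← ENNReal.ofReal_mul (by positivity), mul_assoc, hLp]
  have hGBb : ∀ φ, ‖GB φ‖ ≤ L * |cos φ| := by
    intro φ
    by_cases hφA : φ ∈ A
    · have : φ ∉ Aᶜ := fun h => h hφA
      rw [hGB, indicator_of_notMem this, norm_zero]; positivity
    · rw [hGB, indicator_of_mem (by exact hφA), hGn]; exact not_lt.1 hφA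
  have hsub : {y : ℝ | t < ‖Rext F x y‖} ⊆
      {y : ℝ | π * t ≤ ‖∫ φ in (0:ℝ)..(2 * π), GB φ * Complex.exp (Complex.I * Complex.ofReal (y * sin φ))‖} := by
    intro y hy
    have hy : t < ‖Rext F x y‖ := hy
    show π * t ≤ _
    have e : ∫ φ in (0:ℝ)..(2 * π), G φ * Complex.exp (Complex.I * Complex.ofReal (y * sin φ))
        = (∫ φ in (0:ℝ)..(2 * π), GA φ * Complex.exp (Complex.I * Complex.ofReal (y * sin φ)))
         + ∫ φ in (0:ℝ)..(2 * π), GB φ * Complex.exp (Complex.I * Complex.ofReal (y * sin φ)) := by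
      rw [← intervalIntegral.integral_add (hii GA y hGAm hGAle) (hii GB y hGBm hGBle)]
      simp_rw [hsum, add_mul]
    rw [Rext_eq, e, norm_mul, Complex.norm_real, Real.norm_of_nonneg (by positivity),
      one_div_mul_eq_div, lt_div_iff₀ (by positivity)] at hy
    have := norm_add_le (∫ φ in (0:ℝ)..(2 * π), GA φ * Complex.exp (Complex.I * Complex.ofReal (y * sin φ)))
      (∫ φ in (0:ℝ)..(2 * π), GB φ * Complex.exp (Complex.I * Complex.ofReal (y * sin φ)))
    linarith [hAb y]
  refine (measure_mono hsub).trans ((circle_weak GB hGBm L hL.le hGBb (π * t) (by positivity)).trans ?_)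
  refine (mul_le_mul_right hBb _).trans ?_
  rw [← ENNReal.ofReal_mul (by positivity)]
  apply ENNReal.ofReal_le_ofReal
  rw [rpow_add_one (by positivity), hLdef]
  apply le_of_eq
  field_simp

lemma L1_int (F : ℝ → ℂ) (hF : Measurable F) (r N : ℝ) (hr : 1 ≤ r) (hl : lorentz1 r F ≤ ENNReal.ofReal N) :
    ∫⁻ φ in Icc 0 (2 * π), ‖F φ‖ₑ ≤ ENNReal.ofReal ((2 * π) ^ (1 - 1 / r) * N) := by
  have hpi := pi_pos
  refine (L1_bd F hF r hr).trans ?_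
  rw [ENNReal.ofReal_mul (by positivity)]
  exact mul_le_mul_right hl _

lemma core (r q1 : ℝ) (hr : 1 ≤ r) (hq1 : 2 < q1) (h : 1 / r ≤ 1 - 2 / q1) :
    ∃ C : ℝ, 0 < C ∧ ∀ F : ℝ → ℂ, Measurable F → ∀ N : ℝ, 0 < N → lorentz1 r F ≤ ENNReal.ofReal N →
      ∀ x t : ℝ, 0 < t → volume {y : ℝ | t < ‖Rext F x y‖} ≤ ENNReal.ofReal (C * (N / t) ^ q1) := by
  have hpi := pi_pos
  have hq10 : 0 < q1 - 1 := by linarith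
  set p : ℝ := q1 / (q1 - 1) with hp
  have hp1 : 1 < p := by rw [hp, one_lt_div hq10]; linarith
  have hp2 : p < 2 := by rw [hp, div_lt_iff₀ hq10]; linarith
  have hrp : 1 / r ≤ 2 / p - 1 := by
    have : 2 / p - 1 = 1 - 2 / q1 := by rw [hp]; field_simp; ring
    rw [this]; exact h
  set C1 : ℝ := (p * (4 * (1 + 2 / (1 - (p - 1)))) * (2 * π) ^ (2 - p - p / r)) with hC1
  have hC10 : 0 < C1 := by
    have : 0 < 1 - (p - 1) := by linarith
    have : 0 < p := by linarith
    positivity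
  refine ⟨18 * (C1 / π) ^ (q1 - 1), by positivity, fun F hF N hN hl x t ht => ?_⟩
  have hint : IntegrableOn F (Icc 0 (2 * π)) :=
    ⟨hF.aestronglyMeasurable, (L1_int F hF r N hr hl).trans_lt ENNReal.ofReal_lt_top⟩
  have hM := Lp_bd F hF r p hr hp1 hp2 hrp
  have := core_fixed p (q1 - 1) C1 N t x F hF hp1 hp2 (by rw [hp]; field_simp; ring) hC10 hN ht hint
    (hM.trans (by
      rw [ENNReal.ofReal_mul hC10.le, ← ENNReal.ofReal_rpow_of_pos hN]
      refine mul_le_mul_right (ENNReal.rpow_le_rpow hl (by linarith)) _))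
  rwa [sub_add_cancel] at this

lemma Rext_bd (F : ℝ → ℂ) (hF : Measurable F) (r N : ℝ) (hr : 1 ≤ r) (hN : 0 < N)
    (hl : lorentz1 r F ≤ ENNReal.ofReal N) (x y : ℝ) :
    ‖Rext F x y‖ ≤ (2 * π) ^ (1 - 1 / r) * N := by
  have hpi := pi_pos
  rw [Rext, norm_mul, Complex.norm_real, Real.norm_of_nonneg (by positivity)]
  have h1 : ‖∫ φ in (0:ℝ)..(2 * π), F φ * Complex.exp (Complex.I * Complex.ofReal (x * cos φ + y * sin φ))‖
      ≤ (2 * π) ^ (1 - 1 / r) * N := by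
    rw [intervalIntegral.integral_of_le (by positivity), ← ENNReal.ofReal_le_ofReal_iff (by positivity), ofReal_norm]
    refine (enorm_integral_le_lintegral_enorm _).trans ?_
    refine le_trans ?_ (L1_int F hF r N hr hl)
    refine le_trans (lintegral_mono fun φ => ?_) (lintegral_mono_set Ioc_subset_Icc_self)
    rw [← ofReal_norm, norm_mul_expI, ofReal_norm]
  refine le_trans ?_ h1
  apply mul_le_of_le_one_left (norm_nonneg _)
  rw [div_le_one (by positivity)]
  linarith [pi_gt_three]

lemma weight_weak (q γ M s : ℝ) (hq : 0 < q) (hγ : 1 / q ≤ γ) (hM : 0 < M) (hs : 0 < s) :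
    volume {y : ℝ | s < M * (1 + |y|) ^ (-γ)} ≤ ENNReal.ofReal (2 * (M / s) ^ q) := by
  have hsub : {y : ℝ | s < M * (1 + |y|) ^ (-γ)} ⊆ Icc (-(M / s) ^ q) ((M / s) ^ q) := by
    intro y hy
    have hy : s < M * (1 + |y|) ^ (-γ) := hy
    have hy0 := abs_nonneg y
    have h1 : (1 + |y|) ^ (-γ) ≤ (1 + |y|) ^ (-(1 / q)) :=
      rpow_le_rpow_of_exponent_le (by linarith) (by linarith)
    have h2 : s < M * (1 + |y|) ^ (-(1 / q)) := hy.trans_le (by gcongr)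
    rw [rpow_neg (by positivity), ← div_eq_mul_inv, lt_div_iff₀ (by positivity), ← lt_div_iff₀' hs] at h2
    have h3 := rpow_lt_rpow (by positivity) h2 hq
    rw [← rpow_mul (by positivity), one_div_mul_cancel hq.ne', rpow_one] at h3
    exact abs_le.1 (by linarith)
  refine (measure_mono hsub).trans ?_
  rw [Real.volume_Icc]
  apply ENNReal.ofReal_le_ofReal
  linarith

lemma weak_calc (q K M t : ℝ) (v : ℝ≥0∞) (hq : 0 < q) (hK : 0 < K) (hM : 0 < M) (ht : 0 < t)
    (h : v ≤ ENNReal.ofReal (K * (M / t) ^ q)) :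
    ENNReal.ofReal t * v ^ (1 / q) ≤ ENNReal.ofReal (K ^ (1 / q) * M) := by
  have h1 := ENNReal.rpow_le_rpow h (z := 1 / q) (by positivity)
  rw [ENNReal.ofReal_rpow_of_pos (by positivity)] at h1
  refine (mul_le_mul_right h1 _).trans ?_
  rw [← ENNReal.ofReal_mul ht.le, mul_rpow (by positivity) (by positivity), ← rpow_mul (by positivity),
    mul_one_div_cancel hq.ne', rpow_one]
  apply ENNReal.ofReal_le_ofReal
  apply le_of_eq
  field_simp

lemma inner_bd (β q r : ℝ) (hβ0 : 0 ≤ β) (hq : 0 < q) (hr : 1 ≤ r) (hc : 2 / q - (1 - 1 / r) ≤ 2 * β) :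
    ∃ C : ℝ, 0 < C ∧ ∀ F : ℝ → ℂ, Measurable F → ∀ N : ℝ, 0 < N → lorentz1 r F ≤ ENNReal.ofReal N →
      ∀ x s : ℝ, 0 < s → volume {y : ℝ | s < ‖Rext F x y‖ * (1 + |y|) ^ (-β)} ≤ ENNReal.ofReal (C * (N / s) ^ q) := by
  have hpi := pi_pos
  by_cases hβ : 1 / q ≤ β
  · refine ⟨2 * ((2 * π) ^ (1 - 1 / r)) ^ q, by positivity, fun F hF N hN hl x s hs => ?_⟩
    have hsub : {y : ℝ | s < ‖Rext F x y‖ * (1 + |y|) ^ (-β)} ⊆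
        {y : ℝ | s < ((2 * π) ^ (1 - 1 / r) * N) * (1 + |y|) ^ (-β)} := by
      intro y hy
      have hy : s < ‖Rext F x y‖ * (1 + |y|) ^ (-β) := hy
      refine hy.trans_le ?_
      have := Rext_bd F hF r N hr hN hl x y
      gcongr
    refine (measure_mono hsub).trans ((weight_weak q β _ s hq hβ (by positivity) hs).trans ?_)
    apply ENNReal.ofReal_le_ofReal
    rw [mul_div_assoc, mul_rpow (by positivity) (by positivity), mul_assoc]
  · push Not at hβ
    have hr0 : 0 < 1 / r := by positivity
    have hqb : 0 < 1 - q * β := by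
      have := mul_lt_mul_of_pos_left hβ hq
      rw [mul_one_div_cancel hq.ne'] at this
      linarith
    set q1 : ℝ := q / (1 - q * β) with hq1
    have hq10 : 0 < q1 := by positivity
    have e1 : 2 / q1 = 2 / q - 2 * β := by rw [hq1]; field_simp
    have hq12 : 2 < q1 := by
      have : 2 / q1 < 1 := by rw [e1]; linarith
      rwa [div_lt_one hq10] at this
    obtain ⟨C, hC, hcore⟩ := core r q1 hr hq12 (by rw [e1]; linarith)
    refine ⟨2 + C, by positivity, fun F hF N hN hl x s hs => ?_⟩
    set R : ℝ := (N / s) ^ q with hR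
    have hR0 : 0 < R := by positivity
    have hsub : {y : ℝ | s < ‖Rext F x y‖ * (1 + |y|) ^ (-β)} ⊆
        Icc (-R) R ∪ {y : ℝ | s * R ^ β < ‖Rext F x y‖} := by
      intro y hy
      have hy : s < ‖Rext F x y‖ * (1 + |y|) ^ (-β) := hy
      have hy0 := abs_nonneg y
      by_cases hyR : 1 + |y| ≤ R
      · left; exact abs_le.1 (by linarith)
      · right
        push Not at hyR
        show s * R ^ β < ‖Rext F x y‖
        have h1 : (1 + |y|) ^ (-β) ≤ R ^ (-β) := rpow_le_rpow_of_nonpos hR0 hyR.le (by linarith)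
        have h2 : s < ‖Rext F x y‖ * R ^ (-β) := hy.trans_le (by gcongr)
        rw [rpow_neg hR0.le, ← div_eq_mul_inv, lt_div_iff₀ (by positivity)] at h2
        exact h2
    refine (measure_mono hsub).trans ((measure_union_le _ _).trans ?_)
    refine (add_le_add le_rfl (hcore F hF N hN hl x (s * R ^ β) (by positivity))).trans ?_
    rw [Real.volume_Icc, ← ENNReal.ofReal_add (by linarith) (by positivity)]
    apply ENNReal.ofReal_le_ofReal
    have e2 : (N / (s * R ^ β)) ^ q1 = R := by
      have : N / (s * R ^ β) = (N / s) ^ (1 - q * β) := by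
        rw [rpow_sub (by positivity), rpow_one, hR, ← rpow_mul (by positivity), div_div]
      rw [this, ← rpow_mul (by positivity), hq1, mul_div_cancel₀ _ hqb.ne']
    rw [e2]
    apply le_of_eq; ring

lemma main_bd (α β q r : ℝ) (hβ0 : 0 ≤ β) (hq : 0 < q) (hr : 1 ≤ r) (hα : 1 / q ≤ α)
    (hc : 2 / q - (1 - 1 / r) ≤ 2 * β) :
    ∃ C : ℝ, 0 < C ∧ ∀ F : ℝ → ℂ, Measurable F → ∀ N : ℝ, 0 < N → lorentz1 r F ≤ ENNReal.ofReal N →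
      mixedXY q (fun p => Rab α β F p.1 p.2) ≤ ENNReal.ofReal (C * N) := by
  obtain ⟨C, hC, hin⟩ := inner_bd β q r hβ0 hq hr hc
  refine ⟨2 ^ (1 / q) * C ^ (1 / q), by positivity, fun F hF N hN hl => ?_⟩
  have hw : ∀ x : ℝ, wline q (fun y => Rab α β F x y) ≤ ENNReal.ofReal ((C ^ (1 / q) * N) * (1 + |x|) ^ (-α)) := by
    intro x
    have hX : 0 < (1 + |x|) ^ (-α) := by positivity
    refine iSup₂_le fun t ht => ?_
    rw [mul_assoc]
    refine weak_calc q C _ t _ hq hC (by positivity) ht ?_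
    have e : {y : ℝ | t < ‖Rab α β F x y‖} = {y : ℝ | t / (1 + |x|) ^ (-α) < ‖Rext F x y‖ * (1 + |y|) ^ (-β)} := by
      ext y
      show t < ‖Rab α β F x y‖ ↔ t / (1 + |x|) ^ (-α) < ‖Rext F x y‖ * (1 + |y|) ^ (-β)
      rw [Rab, norm_mul, Complex.norm_real, Real.norm_of_nonneg (by positivity), div_lt_iff₀ hX]
      rw [show ‖Rext F x y‖ * ((1 + |x|) ^ (-α) * (1 + |y|) ^ (-β)) = ‖Rext F x y‖ * (1 + |y|) ^ (-β) * (1 + |x|) ^ (-α) by ring]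
    rw [e]
    refine (hin F hF N hN hl x _ (by positivity)).trans (le_of_eq ?_)
    congr 3
    field_simp
  refine iSup₂_le fun t ht => ?_
  rw [mul_assoc]
  refine weak_calc q 2 _ t _ hq (by norm_num) (by positivity) ht ?_
  refine le_trans (measure_mono ?_) (weight_weak q α _ t hq hα (by positivity) ht)
  intro x hx
  have hx : ENNReal.ofReal t < wline q (fun y => Rab α β F x y) := hx
  exact (ENNReal.ofReal_lt_ofReal_iff (by positivity)).1 (hx.trans_le (hw x))

lemma part_one (α β q r : ℝ) (hβ0 : 0 ≤ β) (hq : 0 < q) (hr : 1 ≤ r) (hα : 1 / q ≤ α)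
    (hc : 2 / q - (1 - 1 / r) ≤ 2 * β) :
    ∃ C : ℝ, 0 < C ∧ ∀ F : ℝ → ℂ, Measurable F →
      mixedXY q (fun p => Rab α β F p.1 p.2) ≤ ENNReal.ofReal C * lorentz1 r F := by
  obtain ⟨C, hC, h⟩ := main_bd α β q r hβ0 hq hr hα hc
  refine ⟨C, hC, fun F hF => ?_⟩
  by_cases htop : lorentz1 r F = ⊤
  · rw [htop, ENNReal.mul_top (by simpa using hC)]; exact le_top
  refine ENNReal.le_of_forall_pos_le_add fun ε hε _ => ?_
  set l := (lorentz1 r F).toReal with hl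
  have hε' : (0:ℝ) < ε := hε
  have hl0 : 0 ≤ l := ENNReal.toReal_nonneg
  have hle : lorentz1 r F = ENNReal.ofReal l := (ENNReal.ofReal_toReal htop).symm
  refine (h F hF (l + ε / C) (by positivity) ?_).trans ?_
  · rw [hle]; apply ENNReal.ofReal_le_ofReal
    have : 0 < ε / C := by positivity
    linarith
  · rw [hle, mul_add, mul_div_cancel₀ _ hC.ne', ENNReal.ofReal_add (by positivity) (by positivity),
      ENNReal.ofReal_mul hC.le, ENNReal.ofReal_coe_nnreal]

lemma lorentz_le_sup (r : ℝ) (hr : 1 ≤ r) (F : ℝ → ℂ) :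
    lorentz1 r F ≤ ENNReal.ofReal ((2 * π) ^ (1 / r)) * circleLp ⊤ F := by
  have hpi := pi_pos
  have hr0 : 0 < 1 / r := by positivity
  by_cases htop : circleLp ⊤ F = ⊤
  · rw [htop, ENNReal.mul_top]
    · exact le_top
    · have : 0 < (2 * π) ^ (1 / r) := by positivity
      simpa using this
  set M := (circleLp ⊤ F).toReal with hM
  have hle : circleLp ⊤ F = ENNReal.ofReal M := (ENNReal.ofReal_toReal htop).symm
  have hae : ∀ᵐ φ ∂(volume.restrict (Icc (0:ℝ) (2 * π))), ‖F φ‖ ≤ M := by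
    rw [← restrict_Ioc_eq_restrict_Icc]
    have := ae_le_eLpNormEssSup (f := F) (μ := volume.restrict (Ioc (0:ℝ) (2 * π)))
    filter_upwards [this] with φ hφ
    have h2 : ‖F φ‖ₑ ≤ ENNReal.ofReal M := by
      rw [← hle, circleLp, eLpNorm_exponent_top]; exact hφ
    rw [← ofReal_norm] at h2
    exact (ENNReal.ofReal_le_ofReal_iff ENNReal.toReal_nonneg).1 h2
  have hz : ∀ t, M < t → volume (El F t) = 0 := by
    intro t ht
    have h0 : ∀ᵐ φ : ℝ, φ ∈ Icc (0:ℝ) (2 * π) → ‖F φ‖ ≤ M := (ae_restrict_iff' measurableSet_Icc).1 hae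
    refine measure_mono_null ?_ (ae_iff.1 h0)
    intro φ hφ hcon
    linarith [hcon hφ.1, hφ.2]
  calc lorentz1 r F = ∫⁻ t in Ioi (0:ℝ), volume (El F t) ^ (1 / r) := rfl
    _ ≤ ∫⁻ t in Ioi (0:ℝ), (Iic M).indicator (fun _ => ENNReal.ofReal ((2 * π) ^ (1 / r))) t := by
      refine lintegral_mono fun t => ?_
      by_cases ht : t ≤ M
      · simp only [indicator_of_mem (show t ∈ Iic M from ht)]
        rw [← ENNReal.ofReal_rpow_of_pos (by positivity)]
        exact ENNReal.rpow_le_rpow (El_vol F t) hr0.le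
      · simp only [hz t (not_le.1 ht), ENNReal.zero_rpow_of_pos hr0]; exact zero_le
    _ = ENNReal.ofReal ((2 * π) ^ (1 / r)) * circleLp ⊤ F := by
      rw [lintegral_indicator measurableSet_Iic, Measure.restrict_restrict measurableSet_Iic,
        inter_comm, Ioi_inter_Iic, setLIntegral_const, Real.volume_Ioc, sub_zero, hle]

/-- Lemma 8: mixed restricted weak-type bounds for `R*_{α,β}` when `α ≥ 1/q`.
Part (i) is for `1 ≤ r < ∞` with Lorentz `L^{r,1}` data, part (ii) for `r = ∞`. -/
theorem statement5 (α β q : ℝ) (hβ0 : 0 ≤ β) (hβα : β ≤ α) (hq : 0 < q) :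
    (∀ r : ℝ, 1 ≤ r → 1 / q ≤ α → 2 / q - (1 - 1 / r) ≤ 2 * β →
      ∃ C : ℝ, 0 < C ∧ ∀ F : ℝ → ℂ, Measurable F →
        mixedXY q (fun p => Rab α β F p.1 p.2) ≤ ENNReal.ofReal C * lorentz1 r F)
    ∧ (1 / q ≤ α → 2 / q - 1 < 2 * β →
      ∃ C : ℝ, 0 < C ∧ ∀ F : ℝ → ℂ, Measurable F →
        mixedXY q (fun p => Rab α β F p.1 p.2) ≤ ENNReal.ofReal C * circleLp ⊤ F) := by
  refine ⟨fun r hr hα hc => part_one α β q r hβ0 hq hr hα hc, fun hα hc => ?_⟩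
  have hδ : 0 < 2 * β + 1 - 2 / q := by linarith
  set δ : ℝ := 2 * β + 1 - 2 / q with hδd
  have hr : 1 ≤ max 1 (1 / δ) := le_max_left _ _
  have h1 : 1 / max 1 (1 / δ) ≤ δ := by
    rw [div_le_iff₀ (by linarith)]
    calc (1:ℝ) = δ * (1 / δ) := by field_simp
      _ ≤ δ * max 1 (1 / δ) := by gcongr; exact le_max_right _ _
  obtain ⟨C, hC, h⟩ := part_one α β q (max 1 (1 / δ)) hβ0 hq hr hα (by linarith)
  have hpi := pi_pos
  refine ⟨C * (2 * π) ^ (1 / max 1 (1 / δ)), by positivity, fun F hF => (h F hF).trans ?_⟩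
  rw [ENNReal.ofReal_mul hC.le, mul_assoc]
  exact mul_le_mul_right (lorentz_le_sup _ hr F) _
end
end
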